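/- Fix n ≥ 0. The operators 𝒢_i^{(α)} for i ≤ n are characterized by the following equations: if H = ∑_{k≥0} t^k H_k is an operator from ℚ(α)[p] to ℚ(α)[q,r]⟦t⟧, where each H_k sends p_π to a linear combination of monomials q_μ r_ν with |μ|+|ν| = |π|+k, such that H·1 = 1 and [t^k]((C_ℓ^{(α)}(−t,q) + C_ℓ^{(α)}(−t,r))·H) = [t^k](H·C_ℓ^{(α)}(−t,p)) for all ℓ ≥ 1 and all ℓ ≤ k ≤ n+ℓ, then H_i = 𝒢_i^{(α)} for all i ≤ n. -/

import Mathlib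

open scoped Classical

noncomputable section

/-- The base field `ℚ(α)` of rational functions in the Jack parameter `α`. -/
abbrev F : Type := RatFunc ℚ

/-- The Jack deformation parameter `α`. -/
def alpha : F := RatFunc.X

/-- An integer partition, encoded as a multiset of positive integers (its parts). -/
abbrev JPartition : Type := Multiset ℕ+

/-- The size `|λ|` of a partition. -/
def psize (l : JPartition) : ℕ := (l.map fun i => (i : ℕ)).sum

/-- The length `ℓ(λ)` of a partition. -/
def plen (l : JPartition) : ℕ := Multiset.card l

/-- `m_i(λ)`, the number of parts of `λ` equal to `i`. -/
def pmult (l : JPartition) (i : ℕ+) : ℕ := Multiset.count i l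

/-- `λ ∪ 1^k`, adjoining `k` parts equal to `1`. -/
def addOnes (l : JPartition) (k : ℕ) : JPartition := l + Multiset.replicate k 1

/-- `λ̃`, the partition obtained by deleting all parts equal to `1`. -/
def removeOnes (l : JPartition) : JPartition := Multiset.filter (fun i => i ≠ 1) l

/-- Exponent vectors of monomials in the power-sum generators `p₁, p₂, …`. -/
abbrev Exp : Type := ℕ+ →₀ ℕ

/-- The exponent vector of the monomial `p_λ`. -/
def toExp (l : JPartition) : Exp := l.toFinset.sum fun i => Finsupp.single i (Multiset.count i l)

/-- The partition corresponding to an exponent vector. -/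
def toPart (m : Exp) : JPartition := m.sum fun i k => Multiset.replicate k i

/-- The weighted degree (`deg p_i = i`) of an exponent vector; this is the size of the
corresponding partition. -/
def wt (m : Exp) : ℕ := m.sum fun i k => k * (i : ℕ)

/-- The algebra `ℚ(α)[p₁, p₂, …]` of symmetric functions written in the power-sum basis. -/
abbrev SymA : Type := MvPolynomial ℕ+ F

/-- The power-sum monomial `p_λ`. -/
def pPow (l : JPartition) : SymA := (l.map fun i => MvPolynomial.X i).prod

/-- `z_λ α^{ℓ(λ)}`, attached to the exponent vector of `p_λ`. -/
def zalpha (m : Exp) : F :=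
  algebraMap ℚ F (m.prod fun i k => (Nat.factorial k : ℚ) * ((i : ℕ) : ℚ) ^ k) *
    alpha ^ (m.sum fun _ k => k)

/-- The `α`-deformed Hall scalar product: `⟨p_λ, p_μ⟩ = δ_{λμ} z_λ α^{ℓ(λ)}`. -/
def hall (f g : SymA) : F :=
  ∑ m ∈ f.support, MvPolynomial.coeff m f * MvPolynomial.coeff m g * zalpha m

/-- The parts of a partition, sorted in weakly decreasing order. -/
def sortedParts (l : JPartition) : List ℕ := ((l.map fun i => (i : ℕ)).sort (· ≤ ·)).reverse

/-- The sum of the `k` largest parts of a partition. -/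
def topSum (l : JPartition) (k : ℕ) : ℕ := ((sortedParts l).take k).sum

/-- The dominance order on partitions: `μ ⊴ λ`. -/
def dominates (mu lam : JPartition) : Prop :=
  psize mu = psize lam ∧ ∀ k, topSum mu k ≤ topSum lam k

/-- Evaluation of a symmetric function (in power-sum coordinates) in `N` variables
`x₁, …, x_N`: it sends `p_i ↦ x₁^i + ⋯ + x_N^i`. -/
def evalN (N : ℕ) : SymA →ₐ[F] MvPolynomial (Fin N) F :=
  MvPolynomial.aeval fun i : ℕ+ => ∑ j : Fin N, MvPolynomial.X j ^ (i : ℕ)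

/-- The exponent of the monomial `x₁^{μ₁} ⋯ x_s^{μ_s}` in `N` variables, for `μ` a
partition; its coefficient in a symmetric polynomial is the coefficient of the monomial
symmetric function `m_μ` (provided `N ≥ ℓ(μ)`). -/
def xexp (mu : JPartition) (N : ℕ) : Fin N →₀ ℕ :=
  Finsupp.equivFunOnFinite.symm fun j => (sortedParts mu).getD (j : ℕ) 0

/-- The defining properties of the family of Jack polynomials `J_λ^{(α)}` (Macdonald's
characterization): orthogonality for the `α`-deformed Hall product, triangularity with
respect to monomial symmetric functions in dominance order, and normalization
`[p_{1^n}] J_λ^{(α)} = 1`. -/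
structure IsJackFamily (J : JPartition → SymA) : Prop where
  orthogonal : ∀ l m : JPartition, l ≠ m → hall (J l) (J m) = 0
  triangular : ∀ l m : JPartition, ¬ dominates m l →
    MvPolynomial.coeff (xexp m (psize l + psize m + plen m))
      (evalN (psize l + psize m + plen m) (J l)) = 0
  normalized : ∀ l : JPartition, MvPolynomial.coeff (Finsupp.single 1 (psize l)) (J l) = 1

/-- The Jack character `θ_μ^{(α)}(λ)`. -/
def theta (J : JPartition → SymA) (mu lam : JPartition) : F :=
  if psize lam < psize mu then 0
  else (Nat.choose (psize lam - psize mu + pmult mu 1) (pmult mu 1) : F) *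
    MvPolynomial.coeff (toExp (addOnes mu (psize lam - psize mu))) (J lam)

/-- `g` is the family of structure coefficients of Jack characters:
`θ_μ^{(α)} θ_ν^{(α)} = ∑_π g^π_{μ,ν}(α) θ_π^{(α)}` (as functions on Young diagrams,
with finitely many nonzero terms). -/
def IsStructCoeffs (J : JPartition → SymA) (g : JPartition → JPartition → JPartition → F) :
    Prop :=
  (∀ mu nu : JPartition, {pi : JPartition | g pi mu nu ≠ 0}.Finite) ∧
  ∀ mu nu lam : JPartition,
    theta J mu lam * theta J nu lam = ∑ᶠ pi : JPartition, g pi mu nu * theta J pi lam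


/-- The polynomial algebra `ℚ(α)[p₁,p₂,…][y₀,y₁,…]` containing the catalytic variables. -/
abbrev PY : Type := MvPolynomial (ℕ+ ⊕ ℕ) F

/-- The variable `p_i` inside `PY`. -/
def pv (i : ℕ+) : PY := MvPolynomial.X (Sum.inl i)

/-- The catalytic variable `y_j` inside `PY`. -/
def yv (j : ℕ) : PY := MvPolynomial.X (Sum.inr j)

/-- The operator `Y₊ = ∑_{i≥0} y_{i+1} ∂/∂y_i`. -/
def Yplus (f : PY) : PY := ∑ᶠ j : ℕ, yv (j + 1) * MvPolynomial.pderiv (Sum.inr j) f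

/-- The operator
`Γ_Y = (1+b) ∑_{i,j≥1} y_{i+j} j ∂²/(∂y_{i-1}∂p_j) + ∑_{i,j≥1} y_i p_j ∂/∂y_{i+j-1}
      + b ∑_{i≥1} y_{i+1} i ∂/∂y_i`, with `b = α - 1`. -/
def GammaY (f : PY) : PY :=
  alpha • (∑ᶠ i : ℕ+, ∑ᶠ j : ℕ+, ((j : ℕ) : F) •
      (yv ((i : ℕ) + (j : ℕ)) *
        MvPolynomial.pderiv (Sum.inl j) (MvPolynomial.pderiv (Sum.inr ((i : ℕ) - 1)) f)))
  + (∑ᶠ i : ℕ+, ∑ᶠ j : ℕ+,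
      yv (i : ℕ) * pv j * MvPolynomial.pderiv (Sum.inr ((i : ℕ) + (j : ℕ) - 1)) f)
  + (alpha - 1) • (∑ᶠ i : ℕ+, ((i : ℕ) : F) •
      (yv ((i : ℕ) + 1) * MvPolynomial.pderiv (Sum.inr (i : ℕ)) f))

/-- The operator `Θ_Y = ∑_{i≥1} p_i ∂/∂y_i`. -/
def ThetaY (f : PY) : PY := ∑ᶠ i : ℕ+, pv i * MvPolynomial.pderiv (Sum.inr (i : ℕ)) f

/-- Ordered composite of the operators `Y₊` (for `true`) and `Γ_Y` (for `false`). -/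
def wordOp : List Bool → PY → PY
  | [], f => f
  | b :: w, f => (if b then Yplus else GammaY) (wordOp w f)

/-- Projection `PY → SymA` killing the catalytic variables. -/
def dropY : PY →ₐ[F] SymA :=
  MvPolynomial.aeval fun v => match v with
    | Sum.inl i => MvPolynomial.X i
    | Sum.inr _ => 0

/-- `Bc n ℓ` is the coefficient of `u^ℓ` in the operator
`B_n^{(α)}(p, u) = Θ_Y (Γ_Y + u Y₊)^n (y₀ / (1+b))`, viewed as an operator on `ℚ(α)[p]`. -/
def Bc (n ℓ : ℕ) (f : SymA) : SymA :=
  dropY (ThetaY (∑ s ∈ Finset.univ.filter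
      (fun s : Fin n → Bool => (Finset.univ.filter fun i => s i = true).card = ℓ),
    wordOp (List.ofFn s) (alpha⁻¹ • (yv 0 * MvPolynomial.rename Sum.inl f))))

/-- Matrix entries of `Bc n ℓ` in the basis of power-sum monomials. -/
def Bmat (n ℓ : ℕ) (m m' : Exp) : F :=
  MvPolynomial.coeff m (Bc n ℓ (MvPolynomial.monomial m' 1))

/-- The adjoint of `Bc n ℓ` with respect to the `α`-deformed Hall scalar product
(`⟨Bperp f, g⟩ = ⟨f, Bc g⟩`), given by its matrix in the power-sum basis. -/
def Bperp (n ℓ : ℕ) (f : SymA) : SymA :=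
  ∑ m' ∈ f.support, MvPolynomial.coeff m' f •
    ∑ᶠ m : Exp, (Bmat n ℓ m' m * zalpha m' / zalpha m) • (MvPolynomial.monomial m (1 : F))



/-- The coefficient of `q_μ r_ν` in the `t^j`-part of the image of `p_π` under the
operator with coefficient family `Hg` (i.e. `p_π ↦ ∑ t^{|μ|+|ν|-|π|} Hg^π_{μ,ν} q_μ r_ν`). -/
def HatT (Hg : JPartition → JPartition → JPartition → F)
    (pi mu nu : JPartition) (j : ℕ) : F :=
  if psize mu + psize nu = psize pi + j then Hg pi mu nu else 0

set_option linter.unusedSimpArgs false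
set_option linter.unusedVariables false
set_option linter.unusedSectionVars false
set_option linter.unreachableTactic false
set_option linter.unusedTactic false

namespace Jk
open Polynomial

/-- generic symmetric-function algebra -/
abbrev V (K : Type) [Field K] : Type := MvPolynomial ℕ+ K
abbrev M (K : Type) [Field K] : Type := Polynomial (MvPolynomial ℕ+ K)

section abstractRing
variable {K R : Type} [Field K] [Ring R] [Algebra K R]
lemma abs1 (D L w e : R) (c : K) (h1 : D * w = w * D + w * L) (h2 : L * w = w * L + e + c • w)
    (h3 : D * e = e * D + e * L) : (D * L - L * D) * w = w * (D * L - L * D) := by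
  have e1 : D * L * w = w * D * L + w * L * L + e * D + e * L + c • (w * D + w * L) := by
    rw [mul_assoc, h2, mul_add, mul_add, ← mul_assoc, h1, h3, mul_smul_comm, h1]; noncomm_ring
  have e2 : L * D * w = w * L * D + e * D + c • w * D + w * L * L + e * L + c • w * L := by
    rw [mul_assoc, h1, mul_add, ← mul_assoc, ← mul_assoc, h2]; noncomm_ring
  rw [sub_mul, e1, e2, smul_add, smul_mul_assoc, smul_mul_assoc]; noncomm_ring
lemma abs2 (L B w e : R) (c u : K) (h1 : B * w = w * B + w * w) (h2 : L * w = w * L + e + c • w)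
    (h3 : B * e = e * B + e * w) :
    (L * B - (B * L + w * (L + u • 1))) * w = w * (L * B - (B * L + w * (L + u • 1))) := by
  have e1 : L * B * w = w * L * B + e * B + c • w * B + (w * L + e + c • w) * w := by
    rw [mul_assoc, h1, mul_add, ← mul_assoc, h2, ← mul_assoc, h2]; noncomm_ring
  have e2 : B * L * w = w * B * L + w * w * L + e * B + e * w + c • (w * B + w * w) := by
    rw [mul_assoc, h2, mul_add, mul_add, ← mul_assoc, h1, h3, mul_smul_comm, h1]; noncomm_ring
  have e3 : w * (L + u • 1) * w = w * (w * L + e + c • w) + u • (w * w) := by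
    rw [mul_assoc, add_mul, h2, smul_mul_assoc, one_mul, mul_add _ _ (u • w), mul_smul_comm]
  rw [sub_mul, add_mul, e1, e2, e3, smul_add]
  simp only [mul_add, add_mul, mul_sub, sub_mul, smul_mul_assoc, mul_smul_comm, mul_one, mul_assoc, h2, smul_add]
  abel
lemma abs3 (D L w : R) (u : K) (h1 : D * w = w * D + w * L) (h2 : D * L = L * D) :
    D * (w * (L + u • 1)) = (w * (L + u • 1)) * D + (w * (L + u • 1)) * L := by
  rw [← mul_assoc, h1]
  simp only [mul_add, add_mul, smul_mul_assoc, mul_smul_comm, mul_one, h2, mul_assoc, one_mul, smul_add]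
  abel
lemma abs4 (B L w : R) (u : K) (h1 : B * w = w * B + w * w) (h2 : L * B = B * L + w * (L + u • 1)) :
    B * (w * (L + u • 1)) = (w * (L + u • 1)) * B := by
  rw [← mul_assoc, h1]
  simp only [mul_add, add_mul, smul_mul_assoc, mul_smul_comm, mul_one, h2, mul_assoc, one_mul, smul_add]
  abel
lemma abs5 (D B L x : R) (h1 : D * x = x * D + x * L) (h2 : B * x = x * B) (h3 : L * B = B * L + x) :
    (D * B - B * D) * x = x * (D * B - B * D) + x * x := by
  have x1 : D * B * x = x * D * B + x * L * B := by
    rw [mul_assoc, h2, ← mul_assoc, h1, add_mul]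
  have x2 : B * D * x = x * B * D + x * B * L := by
    rw [mul_assoc, h1, mul_add, ← mul_assoc, h2, ← mul_assoc, h2]
  rw [sub_mul, x1, x2, mul_assoc _ L, h3]; noncomm_ring
lemma abs6 (Q x : R) (e1 : Q * x = x * Q + x * x) (n : ℕ) :
    Q * x ^ n = x ^ n * Q + (n : K) • x ^ (n+1) := by
  induction n with
  | zero => simp
  | succ n ih =>
    rw [pow_succ x n, ← mul_assoc, ih, add_mul, mul_assoc, e1, smul_mul_assoc, ← pow_succ, mul_add, pow_succ _ (n+1), pow_succ _ n]
    push_cast; rw [add_smul, one_smul]; noncomm_ring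
end abstractRing

section part1
variable {K : Type} [Field K]

def pN (K : Type) [Field K] (k : ℕ) : V K := if h : 0 < k then MvPolynomial.X (k.toPNat h) else 0

@[simp] lemma pN_zero : pN K 0 = 0 := by simp [pN]
lemma pN_coe (j : ℕ+) : pN K (j : ℕ) = MvPolynomial.X j := by
  rw [pN, dif_pos j.pos]; rfl

/-- induction principle: an additive function killing 1 compatible with mult by generators -/
lemma V_induct {N : Type} [AddCommGroup N] [Module K N] (h : V K →ₗ[K] N)
    (h1 : h 1 = 0) (hp : ∀ (j : ℕ+) (f : V K), h f = 0 → h (MvPolynomial.X j * f) = 0) : h = 0 := by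
  have key : ∀ m : ℕ+ →₀ ℕ, h (MvPolynomial.monomial m 1) = 0 := by
    intro m
    induction m using Finsupp.induction with
    | zero => exact h1
    | single_add j k f _ _ ih =>
      clear * - ih hp
      induction k with
      | zero => simpa using ih
      | succ k ih2 =>
        have := hp j _ ih2
        rw [MvPolynomial.X, MvPolynomial.monomial_mul, one_mul] at this
        convert this using 3
        rw [add_comm k 1, Finsupp.single_add, add_assoc]
  ext1 m
  ext1
  exact key m

def iot : V K →ₗ[K] M K := (Polynomial.monomial 0).restrictScalars K
@[simp] lemma iot_apply (f : V K) : iot f = Polynomial.C f := rfl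

/-- coefficientwise builder -/
lemma M_ext {N : Type} [AddCommGroup N] [Module K N] {S T : M K →ₗ[K] N}
    (h : ∀ k f, S (X ^ k * C f) = T (X ^ k * C f)) : S = T := by
  ext1 g
  induction g using Polynomial.induction_on' with
  | add p q hp hq => simp [hp, hq]
  | monomial n f =>
    have := h n f
    rwa [mul_comm, C_mul_X_pow_eq_monomial] at this

def bld {N : Type} [AddCommGroup N] [Module K N] (φ : ℕ → V K →ₗ[K] N) : M K →ₗ[K] N :=
  Polynomial.lsum φ
lemma bld_apply {N : Type} [AddCommGroup N] [Module K N] (φ : ℕ → V K →ₗ[K] N) (k : ℕ) (f : V K) :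
    bld φ (X ^ k * C f) = φ k f := by
  rw [mul_comm, C_mul_X_pow_eq_monomial]
  simp [bld, Polynomial.lsum, Polynomial.sum_monomial_index]

def w : Module.End K (M K) := LinearMap.mulLeft K X
@[simp] lemma w_apply (g : M K) : w g = X * g := rfl

lemma op_zero {Z : Module.End K (M K)} (hw : Z * w = w * Z) (hi : ∀ f, Z (C f) = 0) : Z = 0 := by
  apply M_ext
  intro k f
  induction k with
  | zero => simpa using hi f
  | succ k ih =>
    have := congrArg (fun S => S (X ^ k * C f)) hw
    simp only [Module.End.mul_apply, w_apply] at this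
    rw [pow_succ', mul_assoc, this, ih]; simp

/-- derivation p_j ↦ a j X^j -/
def dA (a : K) : Derivation K (V K) (M K) :=
  MvPolynomial.mkDerivation K (fun j => (C (MvPolynomial.C (a * (j : ℕ)))) * X ^ (j : ℕ))
def Aop (a : K) : Module.End K (M K) := bld (fun k => (LinearMap.mulLeft K (X ^ k)) ∘ₗ (dA a).toLinearMap)
lemma Aop_apply (a : K) (k : ℕ) (f : V K) : Aop a (X ^ k * C f) = X ^ k * dA a f := by
  rw [Aop, bld_apply]; rfl
lemma dA_X (a : K) (j : ℕ+) : dA a (MvPolynomial.X j) = (C (MvPolynomial.C (a * (j : ℕ)))) * X ^ (j : ℕ) := by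
  simp [dA, MvPolynomial.mkDerivation_X]
lemma dA_pN (a : K) (j : ℕ) : dA a (pN K j) = (C (MvPolynomial.C (a * (j : ℕ)))) * X ^ j := by
  rcases Nat.eq_zero_or_pos j with rfl | h
  · simp
  · lift j to ℕ+ using h
    rw [pN_coe, dA_X]

def cc (k : ℕ) : M K := ∑ x ∈ Finset.HasAntidiagonal.antidiagonal k, C (pN K x.1) * X ^ x.2
lemma cc_zero : cc (K := K) 0 = 0 := by simp [cc]
lemma cc_succ (k : ℕ) : cc (K := K) (k + 1) = X * cc k + C (pN K (k + 1)) := by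
  simp only [cc, Finset.Nat.sum_antidiagonal_succ', Finset.mul_sum, pow_zero, mul_one]
  rw [add_comm]
  refine congrArg₂ (· + ·) (Finset.sum_congr rfl fun x _ => ?_) rfl
  ring
def Cop : Module.End K (M K) := bld (fun k => (LinearMap.mulLeft K (cc k)) ∘ₗ iot)
lemma Cop_apply (k : ℕ) (f : V K) : Cop (X ^ k * C f) = cc k * C f := by
  rw [Cop, bld_apply]; rfl
def th : Module.End K (M K) := bld (fun k => (LinearMap.mulLeft K ((k : M K) * X ^ k)) ∘ₗ iot)
lemma th_apply (k : ℕ) (f : V K) : th (X ^ k * C f) = (k : M K) * (X ^ k * C f) := by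
  rw [th, bld_apply, ← mul_assoc]; rfl
/-- Theta -/
def Tht : M K →ₗ[K] V K := bld (fun k => LinearMap.mulLeft K (pN K k))
lemma Tht_apply (k : ℕ) (f : V K) : Tht (X ^ k * C f) = pN K k * f := by
  rw [Tht, bld_apply]; rfl
def cw (T : Module.End K (V K)) : Module.End K (M K) :=
  bld (fun k => (LinearMap.mulLeft K (X ^ k)) ∘ₗ iot ∘ₗ T)
lemma cw_apply (T : Module.End K (V K)) (k : ℕ) (f : V K) : cw T (X ^ k * C f) = X ^ k * C (T f) := by
  rw [cw, bld_apply]; rfl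

/-! zero-index versions -/
lemma Aop_C (a : K) (f : V K) : Aop a (C f) = dA a f := by simpa using Aop_apply a 0 f
lemma Cop_C (f : V K) : Cop (C f) = 0 := by simpa [cc_zero] using Cop_apply 0 f
lemma th_C (f : V K) : th (C f) = 0 := by simpa using th_apply 0 f
lemma Tht_C (f : V K) : Tht (C f) = 0 := by simpa using Tht_apply 0 f
lemma cw_C (T : Module.End K (V K)) (f : V K) : cw T (C f) = C (T f) := by simpa using cw_apply T 0 f
lemma th_Xk (k : ℕ) : th (K := K) (X ^ k) = (k : M K) * X ^ k := by simpa using th_apply (K := K) k 1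
lemma Tht_Xk (k : ℕ) : Tht (K := K) (X ^ k) = pN K k := by simpa using Tht_apply (K := K) k 1

/-! behaviour w.r.t. multiplication by C p -/
lemma M_forall {P : M K → Prop} (hadd : ∀ x y, P x → P y → P (x + y)) (h : ∀ k f, P (X ^ k * C f)) (g : M K) : P g := by
  induction g using Polynomial.induction_on' with
  | add p q hp hq => exact hadd _ _ hp hq
  | monomial n f => rw [← C_mul_X_pow_eq_monomial, mul_comm]; exact h n f

lemma CXC (p : V K) (k : ℕ) (f : V K) : C p * (X ^ k * C f) = X ^ k * C (p * f) := by
  rw [C_mul]; ring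
lemma Cop_mul (p : V K) (g : M K) : Cop (C p * g) = C p * Cop g := by
  induction g using M_forall with
  | hadd x y hx hy => simp only [mul_add, map_add, hx, hy]
  | h k f => rw [CXC, Cop_apply, Cop_apply, C_mul]; ring
lemma th_mul (p : V K) (g : M K) : th (C p * g) = C p * th g := by
  induction g using M_forall with
  | hadd x y hx hy => simp only [mul_add, map_add, hx, hy]
  | h k f => rw [CXC, th_apply, th_apply, C_mul]; ring
lemma Tht_mul (p : V K) (g : M K) : Tht (C p * g) = p * Tht g := by
  induction g using M_forall with
  | hadd x y hx hy => simp only [mul_add, map_add, hx, hy]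
  | h k f => rw [CXC, Tht_apply, Tht_apply]; ring
lemma Aop_mul (a : K) (p : V K) (g : M K) : Aop a (C p * g) = C p * Aop a g + dA a p * g := by
  induction g using M_forall with
  | hadd x y hx hy => simp only [mul_add, map_add, hx, hy]; ring
  | h k f =>
    rw [CXC, Aop_apply, Aop_apply, Derivation.leibniz]
    simp only [smul_eq_C_mul]; ring
lemma dA_mul (a : K) (p f : V K) : dA a (p * f) = C p * dA a f + C f * dA a p := by
  rw [Derivation.leibniz]; simp only [smul_eq_C_mul]
lemma cw_deriv (T : Derivation K (V K) (V K)) (p : V K) (g : M K) :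
    cw T.toLinearMap (C p * g) = C p * cw T.toLinearMap g + C (T p) * g := by
  induction g using M_forall with
  | hadd x y hx hy => simp only [mul_add, map_add, hx, hy]; ring
  | h k f =>
    rw [CXC, cw_apply, cw_apply]
    simp only [Derivation.coeFn_coe, Derivation.leibniz, smul_eq_mul, C_add, C_mul]; ring
lemma th_Xmul (n : ℕ) (g : M K) : th (X ^ n * g) = X ^ n * th g + (n : M K) * (X ^ n * g) := by
  induction g using M_forall with
  | hadd x y hx hy => simp only [mul_add, map_add, hx, hy]; ring
  | h k f => rw [← mul_assoc, ← pow_add, th_apply, th_apply]; push_cast; ring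
lemma cw_Xmul (T : Module.End K (V K)) (n : ℕ) (g : M K) : cw T (X ^ n * g) = X ^ n * cw T g := by
  induction g using M_forall with
  | hadd x y hx hy => simp only [mul_add, map_add, hx, hy]
  | h k f => rw [← mul_assoc, ← pow_add, cw_apply, cw_apply]; ring
lemma Aop_Xmul (a : K) (n : ℕ) (g : M K) : Aop a (X ^ n * g) = X ^ n * Aop a g := by
  induction g using M_forall with
  | hadd x y hx hy => simp only [mul_add, map_add, hx, hy]
  | h k f => rw [← mul_assoc, ← pow_add, Aop_apply, Aop_apply]; ring
lemma Cop_w (g : M K) : Cop (X * g) = X * Cop g + C (Tht (X * g)) := by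
  induction g using M_forall with
  | hadd x y hx hy => simp only [mul_add, map_add, hx, hy]; ring
  | h k f =>
    rw [← mul_assoc, ← pow_succ', Cop_apply, Cop_apply, Tht_apply, cc_succ, C_mul]; ring

/-- V_n : p_j ↦ j p_{j+n} -/
def Vd (n : ℕ) : Derivation K (V K) (V K) :=
  MvPolynomial.mkDerivation K (fun j => ((j : ℕ) : V K) * pN K ((j : ℕ) + n))
lemma Vd_X (n : ℕ) (j : ℕ+) : Vd (K := K) n (MvPolynomial.X j) = ((j : ℕ) : V K) * pN K ((j : ℕ) + n) := by
  simp [Vd, MvPolynomial.mkDerivation_X]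
lemma Vd_pN (n : ℕ) (j : ℕ) : Vd (K := K) n (pN K j) = ((j : ℕ) : V K) * pN K (j + n) := by
  rcases Nat.eq_zero_or_pos j with rfl | h
  · simp
  · lift j to ℕ+ using h
    rw [pN_coe, Vd_X]
def Ed : Derivation K (V K) (V K) :=
  MvPolynomial.mkDerivation K (fun j => ((j : ℕ) : V K) * MvPolynomial.X j)
lemma Ed_X (j : ℕ+) : Ed (K := K) (MvPolynomial.X j) = ((j : ℕ) : V K) * MvPolynomial.X j := by
  simp [Ed, MvPolynomial.mkDerivation_X]
lemma Ed_pN (j : ℕ) : Ed (K := K) (pN K j) = ((j : ℕ) : V K) * pN K j := by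
  rcases Nat.eq_zero_or_pos j with rfl | h
  · simp
  · lift j to ℕ+ using h
    rw [pN_coe, Ed_X]

abbrev cV (a : K) : V K := MvPolynomial.C a
abbrev cM (a : K) : M K := C (MvPolynomial.C a)

lemma smul_V (a : K) (f : V K) : a • f = cV a * f := MvPolynomial.smul_eq_C_mul f a
lemma smul_M (a : K) (f : M K) : a • f = cM a * f := by
  rw [← IsScalarTower.algebraMap_smul (V K) a f, smul_eq_C_mul]; rfl

lemma Tht_dA (a : K) (n : ℕ) (f : V K) : Tht (X ^ n * dA a f) = cV a * Vd n f := by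
  have : (Tht ∘ₗ (LinearMap.mulLeft K (X ^ n)) ∘ₗ (dA a).toLinearMap - (LinearMap.mulLeft K (cV a)) ∘ₗ (Vd n).toLinearMap : V K →ₗ[K] V K) = 0 := by
    apply V_induct
    · simp
    · intro j f hf
      simp only [LinearMap.sub_apply, LinearMap.comp_apply, LinearMap.mulLeft_apply, Derivation.coeFn_coe] at hf ⊢
      rw [dA_mul, mul_add, map_add, Derivation.leibniz, dA_X, Vd_X]
      rw [show (X : M K) ^ n * (C (MvPolynomial.X j) * dA a f) = C (MvPolynomial.X j) * (X ^ n * dA a f) by ring,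
        show (X : M K) ^ n * (C f * (C (MvPolynomial.C (a * (j:ℕ))) * X ^ (j:ℕ))) = X ^ ((j:ℕ) + n) * C (f * MvPolynomial.C (a * (j:ℕ))) by rw [C_mul]; ring,
        Tht_mul, Tht_apply]
      simp only [smul_eq_mul, map_mul, map_natCast]
      linear_combination (MvPolynomial.X j) * hf
  have := congrArg (fun S => S f) this
  simpa [sub_eq_zero] using this

lemma dagger (a : K) (n : ℕ) (f : V K) :
    cw (Vd n).toLinearMap (dA a f) - dA a (Vd n f) + X ^ n * th (dA a f) + (n : M K) * X ^ n * dA a f = 0 := by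
  have : (cw (Vd n).toLinearMap ∘ₗ (dA a).toLinearMap - (dA a).toLinearMap ∘ₗ (Vd n).toLinearMap
     + (LinearMap.mulLeft K (X ^ n)) ∘ₗ th ∘ₗ (dA a).toLinearMap + (LinearMap.mulLeft K ((n : M K) * X ^ n)) ∘ₗ (dA a).toLinearMap : V K →ₗ[K] M K) = 0 := by
    apply V_induct
    · simp
    · intro j f hf
      simp only [LinearMap.sub_apply, LinearMap.add_apply, LinearMap.comp_apply, LinearMap.mulLeft_apply, Derivation.coeFn_coe] at hf ⊢
      have e1 := cw_deriv (Vd n) (MvPolynomial.X j) (dA a f)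
      have e2 := cw_Xmul (Vd (K := K) n).toLinearMap j (C (f * MvPolynomial.C (a * (j : ℕ))))
      rw [cw_C] at e2
      simp only [Derivation.coeFn_coe, Derivation.leibniz] at e1 e2
      have e3 : (C f * (C (MvPolynomial.C (a * (j:ℕ))) * X ^ (j:ℕ)) : M K) = X ^ (j:ℕ) * C (f * MvPolynomial.C (a * (j:ℕ))) := by
        rw [C_mul]; ring
      have e4 : Vd n (MvPolynomial.C (a * (j : ℕ))) = (0 : V K) := by
        rw [← MvPolynomial.algebraMap_eq]; exact Derivation.map_algebraMap _ _
      rw [dA_mul, map_add, dA_X, e1, Derivation.leibniz, Vd_X, e3, e2, e4, map_add]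
      simp only [smul_eq_mul]
      rw [map_add (dA a), dA_mul, dA_mul, dA_mul, dA_X, dA_pN, map_add, th_mul, th_apply]
      have e5 : dA a ((j : ℕ) : V K) = 0 := Derivation.map_natCast _ _
      rw [e5]
      simp only [cM, cV, C_mul, map_mul, map_natCast, C_add, smul_zero, mul_zero, add_zero, C_0, zero_add]
      push_cast
      linear_combination (C (MvPolynomial.X j)) * hf
  have := DFunLike.congr_fun this f
  simpa only [LinearMap.sub_apply, LinearMap.add_apply, LinearMap.comp_apply, LinearMap.mulLeft_apply, Derivation.coeFn_coe, LinearMap.zero_apply] using this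

variable (a : K)
def Lam : Module.End K (M K) := Aop a + Cop + (a - 1) • th
def Dop : Module.End K (V K) := (2⁻¹ : K) • (a⁻¹ • (Tht ∘ₗ Lam a ∘ₗ Lam a ∘ₗ iot) - (a - 1) • Ed.toLinearMap)

def sk (k : ℕ) : V K := cV 2⁻¹ * (k : V K) * Tht (cc k) + cV (2⁻¹ * (a - 1) * (k ^ 2 - k)) * pN K k

lemma Lam_mul (p : V K) (g : M K) : Lam a (C p * g) = C p * Lam a g + dA a p * g := by
  simp only [Lam, LinearMap.add_apply, LinearMap.smul_apply, Aop_mul, Cop_mul, th_mul, smul_M]; ring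
lemma Lam_C (f : V K) : Lam a (C f) = dA a f := by
  simp [Lam, Aop_C, Cop_C, th_C]
lemma Lam_XC (k : ℕ) (f : V K) : Lam a (X ^ k * C f) = X ^ k * dA a f + cc k * C f + cM (a - 1) * (k : M K) * X ^ k * C f := by
  simp only [Lam, LinearMap.add_apply, LinearMap.smul_apply, Aop_apply, Cop_apply, th_apply, smul_M]; ring

lemma Dop_one : Dop a 1 = 0 := by
  have : (C 1 : M K) = 1 := C_1
  simp only [Dop, LinearMap.smul_apply, LinearMap.sub_apply, LinearMap.comp_apply, iot_apply, Lam_C]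
  simp

variable [CharZero K]

lemma Dop_mul (ha : a ≠ 0) (k : ℕ) (f : V K) :
    Dop a (pN K k * f) = pN K k * Dop a f + cV (a * k) * Vd k f + sk a k * f := by
  simp only [Dop, LinearMap.smul_apply, LinearMap.sub_apply, LinearMap.comp_apply, iot_apply, Lam_C,
    Derivation.coeFn_coe, dA_mul, dA_pN, map_add]
  rw [Derivation.leibniz, Lam_mul, dA_pN, show (C f * (C (MvPolynomial.C (a * (k:ℕ))) * X ^ (k:ℕ)) : M K) = C (MvPolynomial.C (a * (k:ℕ))) * (X ^ (k:ℕ) * C f) by ring, Lam_mul, Lam_XC]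
  have e5 : dA a (cV (a * k)) = 0 := Derivation.map_algebraMap _ _
  rw [e5, zero_mul, add_zero, map_add, Tht_mul, Tht_mul, map_add, map_add, mul_assoc _ (X ^ k), Tht_mul, Tht_dA, mul_comm (cc k), Tht_mul,
    show (cM (a - 1) * (k : M K) * X ^ k * C f) = C (cV (a-1) * k * f) * X ^ k by simp only [C_mul, map_natCast]; ring, Tht_mul, Tht_Xk, Ed_pN]
  simp only [smul_V, sk, smul_eq_mul]
  have h2 : (cV 2⁻¹ * 2 : V K) = 1 := by
    rw [show (2 : V K) = cV 2 from rfl, ← MvPolynomial.C_mul]; simp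
  have h3 : (cV a⁻¹ * cV a : V K) = 1 := by
    rw [← MvPolynomial.C_mul]; simp [ha]
  simp only [MvPolynomial.C_mul, MvPolynomial.C_sub, map_natCast, map_pow, MvPolynomial.C_1]
  linear_combination (norm := skip) (cV a * k * Vd k f) * h2 + (cV 2⁻¹ * 2 * k * cV a * Vd k f  + cV 2⁻¹ * k * f * Tht (cc k) + cV 2⁻¹ * k^2 * (cV a - 1) * f * pN K k) * h3
  ring


lemma Tht_cc (k : ℕ) : Tht (cc (K := K) k) = ∑ x ∈ Finset.HasAntidiagonal.antidiagonal k, pN K x.1 * pN K x.2 := by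
  simp only [cc, map_sum, Tht_mul, Tht_Xk]
lemma th_cc (k : ℕ) : th (cc (K := K) k) = ∑ x ∈ Finset.HasAntidiagonal.antidiagonal k, C (pN K x.1) * ((x.2 : M K) * X ^ x.2) := by
  simp only [cc, map_sum, th_mul, th_Xk]
lemma two_inv : (cV 2⁻¹ * 2 : V K) = 1 := by
  rw [show (2 : V K) = cV 2 from rfl, ← MvPolynomial.C_mul]; simp
lemma Tht_th_cc (k : ℕ) : Tht (th (cc (K := K) k)) = cV 2⁻¹ * (k : V K) * Tht (cc k) := by
  have e1 : Tht (th (cc (K := K) k)) = ∑ x ∈ Finset.HasAntidiagonal.antidiagonal k, (x.2 : V K) * (pN K x.1 * pN K x.2) := by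
    rw [th_cc, map_sum]
    refine Finset.sum_congr rfl fun x _ => ?_
    rw [Tht_mul, show ((x.2 : M K)) = C (x.2 : V K) by simp, Tht_mul, Tht_Xk]; ring
  have e2 : Tht (th (cc (K := K) k)) = ∑ x ∈ Finset.HasAntidiagonal.antidiagonal k, (x.1 : V K) * (pN K x.1 * pN K x.2) := by
    rw [e1, ← Finset.Nat.sum_antidiagonal_swap]
    refine Finset.sum_congr rfl fun x _ => ?_
    simp only [Prod.fst_swap, Prod.snd_swap]; ring
  have e3 : 2 * Tht (th (cc (K := K) k)) = (k : V K) * Tht (cc k) := by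
    rw [two_mul]; nth_rw 1 [e1]; rw [e2, ← Finset.sum_add_distrib, Tht_cc, Finset.mul_sum]
    refine Finset.sum_congr rfl fun x hx => ?_
    rw [← Finset.HasAntidiagonal.mem_antidiagonal.mp hx]; push_cast; ring
  linear_combination cV 2⁻¹ * e3 - Tht (th (cc (K := K) k)) * two_inv (K := K)

lemma dA_sk (k : ℕ) : dA a (sk a k) = cM (a * k) * (th (cc k) + cM (2⁻¹ * (a - 1) * (k ^ 2 - k)) * X ^ k) := by
  have h1 : ∀ (c : K) (f : V K), dA a (cV c * f) = cM c * dA a f := by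
    intro c f
    rw [dA_mul, show dA a (cV c) = 0 from Derivation.map_algebraMap _ _]; simp
  have h0 : dA a ((k : V K)) = 0 := Derivation.map_natCast _ _
  have e1 : dA a (Tht (cc k)) = cM (2 * a) * th (cc k) := by
    have e1 : dA a (Tht (cc k)) = ∑ x ∈ Finset.HasAntidiagonal.antidiagonal k, C (pN K x.1) * dA a (pN K x.2) +
        ∑ x ∈ Finset.HasAntidiagonal.antidiagonal k, C (pN K x.2) * dA a (pN K x.1) := by
      rw [Tht_cc, map_sum, ← Finset.sum_add_distrib]
      exact Finset.sum_congr rfl fun x _ => dA_mul _ _ _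
    have e2 : ∑ x ∈ Finset.HasAntidiagonal.antidiagonal k, C (pN K x.2) * dA a (pN K x.1) = 
        ∑ x ∈ Finset.HasAntidiagonal.antidiagonal k, C (pN K x.1) * dA a (pN K x.2) := by
      rw [← Finset.Nat.sum_antidiagonal_swap]; rfl
    have e3 : ∑ x ∈ Finset.HasAntidiagonal.antidiagonal k, C (pN K x.1) * dA a (pN K x.2) = cM a * th (cc k) := by
      rw [th_cc, Finset.mul_sum]
      refine Finset.sum_congr rfl fun x _ => ?_
      rw [dA_pN]; simp only [cM, cV, map_mul, map_natCast]; ring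
    rw [e1, e2, e3]; simp only [cM, cV, map_mul, map_ofNat]; ring
  have h2 : (cM 2⁻¹ * 2 : M K) = 1 := by
    rw [show (2 : M K) = cM 2 from rfl, ← C_mul, ← MvPolynomial.C_mul]; simp
  rw [sk, map_add, h1, mul_assoc, h1, dA_mul, h0, e1, dA_pN]
  simp only [cM, cV, map_mul, map_natCast, map_ofNat, mul_zero, add_zero]
  linear_combination cM a * (k : M K) * th (cc k) * h2

def Dh : Module.End K (M K) :=
  cw (Dop a) + Aop a * th + th * Cop + (2⁻¹ * (a - 1)) • (th * th - th)

lemma Dh_C (f : V K) : Dh a (C f) = C (Dop a f) := by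
  simp only [Dh, LinearMap.add_apply, Module.End.mul_apply, LinearMap.smul_apply, LinearMap.sub_apply, cw_C, th_C, Cop_C]
  simp

lemma Tht_XnC (k : ℕ) (f : V K) : Tht (X ^ k * C f) = pN K k * f := Tht_apply k f

lemma Dh_XC (k : ℕ) (f : V K) : Dh a (X ^ k * C f) = X ^ k * C (Dop a f) + (k : M K) * X ^ k * dA a f
   + C f * th (cc k) + cM (2⁻¹ * (a - 1) * (k ^ 2 - k)) * (X ^ k * C f) := by
  have hk : ((k : M K)) = C (k : V K) := by simp
  simp only [Dh, LinearMap.add_apply, Module.End.mul_apply, LinearMap.smul_apply, LinearMap.sub_apply, cw_apply, th_apply, Cop_apply, smul_M]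
  rw [hk, CXC, Aop_apply, dA_mul, show dA a ((k : V K)) = 0 from Derivation.map_natCast _ _, mul_comm (cc k), th_mul, th_apply]
  simp only [cM, cV, C_mul, map_mul, map_natCast, map_sub, map_pow]; ring

lemma Tht_Dh (ha : a ≠ 0) (g : M K) : Tht (Dh a g) = Dop a (Tht g) := by
  induction g using M_forall with
  | hadd x y hx hy => simp only [map_add, hx, hy]
  | h k f =>
    rw [Dh_XC, Tht_apply, Dop_mul a ha, map_add, map_add, map_add, Tht_apply, Tht_mul, Tht_mul, Tht_apply, Tht_th_cc,
      show ((k : M K)) = C (k : V K) by simp, mul_assoc, Tht_mul, Tht_dA, sk]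
    simp only [cM, cV, map_mul, map_natCast, map_sub, map_pow]; ring

lemma Dh_w : Dh a * w = w * Dh a + w * Lam a := by
  apply M_ext
  intro k f
  simp only [LinearMap.add_apply, Module.End.mul_apply, w_apply]
  rw [← mul_assoc, ← pow_succ', Dh_XC, Dh_XC, Lam_XC, cc_succ, map_add, th_C,
    show th (X * cc k) = X * th (cc k) + X * cc (K := K) k by simpa using th_Xmul 1 (cc (K := K) k)]
  have h2 : (cM 2⁻¹ * 2 : M K) = 1 := by
    rw [show (2 : M K) = cM 2 from rfl, ← C_mul, ← MvPolynomial.C_mul]; simp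
  simp only [cM, cV, map_mul, map_natCast, map_sub, map_pow]
  push_cast
  simp only [cM, cV, map_mul, map_natCast, map_sub, map_pow, map_add, map_one]
  linear_combination (cM a - 1) * (k : M K) * X^(k+1) * C f * h2

lemma Lam_w : Lam a * w = w * Lam a + iot ∘ₗ Tht ∘ₗ w + (a - 1) • w := by
  apply M_ext
  intro k f
  simp only [LinearMap.add_apply, Module.End.mul_apply, w_apply, LinearMap.comp_apply, iot_apply, LinearMap.smul_apply, smul_M]
  rw [← mul_assoc, ← pow_succ', Lam_XC, Lam_XC, cc_succ, Tht_apply]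
  simp only [map_mul]
  push_cast
  ring

def eps : Module.End K (M K) := iot ∘ₗ Tht ∘ₗ w

lemma Dh_eps (ha : a ≠ 0) : Dh a * eps = eps * Dh a + eps * Lam a := by
  ext1 g
  have h := DFunLike.congr_fun (Dh_w a) g
  simp only [LinearMap.add_apply, Module.End.mul_apply, eps, LinearMap.comp_apply, iot_apply, w_apply] at h ⊢
  rw [Dh_C, ← Tht_Dh a ha, h, map_add, C_add]

lemma cw_Dop_mul (ha : a ≠ 0) (n : ℕ) (g : M K) : cw (Dop a) (C (pN K n) * g) = C (pN K n) * cw (Dop a) g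
   + cM (a * n) * cw (Vd n).toLinearMap g + C (sk a n) * g := by
  induction g using M_forall with
  | hadd x y hx hy => simp only [mul_add, map_add, hx, hy]; ring
  | h k f => 
    rw [CXC, cw_apply, cw_apply, cw_apply, Dop_mul a ha]; simp only [C_add, C_mul, Derivation.coeFn_coe]; ring

lemma Dh_mul (ha : a ≠ 0) (n : ℕ) (g : M K) : Dh a (C (pN K n) * g) = C (pN K n) * Dh a g
   + cM (a * n) * cw (Vd n).toLinearMap g + C (sk a n) * g + cM (a * n) * (X ^ n * th g) := by
  simp only [Dh, LinearMap.add_apply, Module.End.mul_apply, LinearMap.smul_apply, LinearMap.sub_apply, smul_M]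
  rw [cw_Dop_mul a ha, th_mul, th_mul, Aop_mul, Cop_mul, th_mul, dA_pN]
  ring

lemma Dh_dA (ha : a ≠ 0) (f : V K) : Dh a (dA a f) = dA a (Dop a f) := by
  have : (Dh a ∘ₗ (dA a).toLinearMap - (dA a).toLinearMap ∘ₗ Dop a : V K →ₗ[K] M K) = 0 := by
    apply V_induct
    · simp [Dop_one]
    · intro j f hf
      simp only [LinearMap.sub_apply, LinearMap.comp_apply, Derivation.coeFn_coe] at hf ⊢
      have hd := dagger a j f
      rw [← pN_coe, Dop_mul a ha, dA_mul, dA_pN, map_add, map_add, map_add, Dh_mul a ha, dA_mul, dA_mul, dA_mul, dA_pN,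
        show (C f * (C (MvPolynomial.C (a * (j:ℕ))) * X ^ (j:ℕ)) : M K) = X ^ (j:ℕ) * C (f * MvPolynomial.C (a * (j:ℕ))) by
        rw [C_mul]; ring, Dh_XC, dA_mul, dA_sk]
      have e5 : dA a (cV (a * (j : ℕ))) = 0 := Derivation.map_algebraMap _ _
      have e6 : Dop a (f * cV (a * (j : ℕ))) = cV (a * (j : ℕ)) * Dop a f := by
        rw [mul_comm, ← smul_V, ← smul_V, map_smul]
      rw [e5, e6]
      simp only [cM, cV, C_mul, map_mul, map_natCast, mul_zero, add_zero]
      linear_combination (C (pN K j)) * hf + cM a * (j : M K) * hd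
  have := DFunLike.congr_fun this f
  simpa only [LinearMap.sub_apply, LinearMap.comp_apply, Derivation.coeFn_coe, LinearMap.zero_apply, sub_eq_zero] using this

lemma Dh_Lam (ha : a ≠ 0) : Dh a * Lam a = Lam a * Dh a := by
  rw [← sub_eq_zero]
  apply op_zero
  · exact abs1 (R := Module.End K (M K)) _ _ _ eps (a-1) (Dh_w a) (Lam_w a) (Dh_eps a ha)
  · intro f
    simp only [LinearMap.sub_apply, Module.End.mul_apply, Lam_C, Dh_C, Dh_dA a ha, sub_self]

/-! B_1 -/
variable (u : K)
def B1 : Module.End K (V K) := (u / a) • LinearMap.mulLeft K (pN K 1) + (Vd 1).toLinearMap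
def Bh : Module.End K (M K) := (u / a) • LinearMap.mulLeft K (C (pN K 1)) + cw (Vd 1).toLinearMap + w * th

lemma Bh_XC (k : ℕ) (f : V K) : Bh a u (X ^ k * C f) = X ^ k * C (B1 a u f) + (k : M K) * X ^ (k+1) * C f := by
  simp only [Bh, B1, LinearMap.add_apply, LinearMap.smul_apply, LinearMap.mulLeft_apply, Module.End.mul_apply, w_apply, cw_apply, th_apply, smul_M, smul_V, C_add, C_mul, Derivation.coeFn_coe]
  ring
lemma Bh_C (f : V K) : Bh a u (C f) = C (B1 a u f) := by simpa using Bh_XC a u 0 f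
lemma Tht_Bh (g : M K) : Tht (Bh a u g) = B1 a u (Tht g) := by
  induction g using M_forall with
  | hadd x y hx hy => simp only [map_add, hx, hy]
  | h k f =>
    rw [Bh_XC, map_add, show ((k : M K)) = C (k : V K) by simp, mul_assoc, Tht_mul, Tht_apply, Tht_apply, Tht_apply]
    simp only [B1, LinearMap.add_apply, LinearMap.smul_apply, LinearMap.mulLeft_apply, Derivation.coeFn_coe, Derivation.leibniz, Vd_pN, smul_V, smul_eq_mul]
    ring
lemma Bh_w : Bh a u * w = w * Bh a u + w * w := by
  apply M_ext
  intro k f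
  simp only [LinearMap.add_apply, Module.End.mul_apply, w_apply]
  rw [← mul_assoc, ← pow_succ', Bh_XC, Bh_XC]; push_cast; ring
lemma Bh_eps : Bh a u * eps = eps * Bh a u + eps * w := by
  ext1 g
  have h := DFunLike.congr_fun (Bh_w a u) g
  simp only [LinearMap.add_apply, Module.End.mul_apply, eps, LinearMap.comp_apply, iot_apply, w_apply] at h ⊢
  rw [Bh_C, ← Tht_Bh, h, map_add, C_add]

def Xu : Module.End K (M K) := w * (Lam a + u • 1)

lemma Lam_Bh (ha : a ≠ 0) : Lam a * Bh a u = Bh a u * Lam a + Xu a u := by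
  rw [← sub_eq_zero]
  apply op_zero
  · exact abs2 (R := Module.End K (M K)) _ _ _ eps (a-1) u (Bh_w a u) (Lam_w a) (Bh_eps a u)
  · intro f
    have hd := dagger a 1 f
    have e5 : dA a (cV (u/a)) = 0 := Derivation.map_algebraMap _ _
    simp only [Xu, LinearMap.sub_apply, LinearMap.add_apply, LinearMap.smul_apply, Module.End.one_apply, Module.End.mul_apply, Lam_C, Bh_C, w_apply] at hd ⊢
    simp only [Bh, B1, LinearMap.add_apply, LinearMap.smul_apply, Module.End.mul_apply, w_apply, LinearMap.mulLeft_apply, smul_M, smul_V, map_add,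
      dA_mul, dA_pN, e5, Derivation.coeFn_coe] at hd ⊢
    have h3 : (cM (u/a) * cM a : M K) = cM u := by
      rw [← C_mul, ← MvPolynomial.C_mul]; simp [ha]
    simp only [Nat.cast_one, mul_one, mul_zero, add_zero, pow_one] at hd ⊢
    linear_combination C f * X * h3 - hd

lemma Dh_Xu (ha : a ≠ 0) : Dh a * Xu a u = Xu a u * Dh a + Xu a u * Lam a :=
  abs3 (R := Module.End K (M K)) _ _ _ u (Dh_w a) (Dh_Lam a ha)
lemma Bh_Xu (ha : a ≠ 0) : Bh a u * Xu a u = Xu a u * Bh a u :=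
  abs4 (R := Module.End K (M K)) _ _ _ u (Bh_w a u) (Lam_Bh a u ha)

/-- a * B_n(u) -/
def Bn (n : ℕ) : Module.End K (V K) := a⁻¹ • (Tht ∘ₗ ((Xu a u) ^ n : Module.End K (M K)) ∘ₗ iot)

def Qop : Module.End K (V K) := Dop a * B1 a u - B1 a u * Dop a

lemma Bn_one (ha : a ≠ 0) : Bn a u 1 = B1 a u := by
  refine LinearMap.ext fun f => ?_
  simp only [Bn, B1, pow_one, LinearMap.add_apply, LinearMap.smul_apply, LinearMap.comp_apply, iot_apply, Xu, Module.End.mul_apply, Module.End.one_apply, Lam_C, w_apply, LinearMap.mulLeft_apply]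
  rw [mul_add, map_add, show X * dA a f = X ^ 1 * dA a f by ring, Tht_dA, smul_M, show X * (cM u * C f) = X ^ 1 * C (cV u * f) by rw [C_mul]; ring, Tht_apply]
  simp only [smul_V, mul_add, Derivation.coeFn_coe]
  have h3 : (cV a⁻¹ * cV a : V K) = 1 := by
    rw [← MvPolynomial.C_mul]; simp [ha]
  simp only [div_eq_mul_inv, cV, MvPolynomial.C_mul]
  linear_combination Vd 1 f * h3

lemma Bn_rec (ha : a ≠ 0) (n : ℕ) : (n : K) • Bn a u (n + 1) = Qop a u * Bn a u n - Bn a u n * Qop a u := by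
  set Qh := Dh a * Bh a u - Bh a u * Dh a with hQ
  have hDX := Dh_Xu a u ha
  have hBX := Bh_Xu a u ha
  have hLB := Lam_Bh a u ha
  have e2 : ∀ n : ℕ, Qh * Xu a u ^ n = Xu a u ^ n * Qh + (n : K) • Xu a u ^ (n+1) :=
    abs6 (R := Module.End K (M K)) _ _ (abs5 (R := Module.End K (M K)) _ _ _ _ hDX hBX hLB)
  have tQ : ∀ g, Tht (Qh g) = Qop a u (Tht g) := by
    intro g
    simp only [hQ, Qop, LinearMap.sub_apply, Module.End.mul_apply, map_sub, Tht_Dh a ha, Tht_Bh]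
  have cQ : ∀ f, Qh (C f) = C (Qop a u f) := by
    intro g
    simp only [hQ, Qop, LinearMap.sub_apply, Module.End.mul_apply, map_sub, Dh_C, Bh_C]
  refine LinearMap.ext fun f => ?_
  have e3 := DFunLike.congr_fun (e2 n) (C f)
  simp only [LinearMap.add_apply, LinearMap.smul_apply, Module.End.mul_apply, cQ] at e3
  have e4 := congrArg Tht e3
  rw [tQ, map_add, map_smul] at e4
  simp only [Bn, LinearMap.smul_apply, LinearMap.sub_apply, Module.End.mul_apply, LinearMap.comp_apply, iot_apply, map_smul]
  rw [e4, smul_comm, ← smul_sub, add_sub_cancel_left]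

end part1
end Jk

namespace Jk
open Polynomial

section part2
variable {K : Type} [Field K]

/-- partial derivative w.r.t. p_k (zero for k = 0) -/
def pd (k : ℕ) : Derivation K (V K) (V K) :=
  if h : 0 < k then MvPolynomial.pderiv (k.toPNat h) else 0
lemma pd_coe (j : ℕ+) : pd (K := K) (j : ℕ) = MvPolynomial.pderiv j := by
  rw [pd, dif_pos j.pos]; rfl
@[simp] lemma pd_zero : pd (K := K) 0 = 0 := by simp [pd]
lemma pd_pN (k j : ℕ) : pd (K := K) k (pN K j) = if k = j ∧ 0 < k then 1 else 0 := by
  rcases Nat.eq_zero_or_pos k with rfl | hk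
  · simp
  rcases Nat.eq_zero_or_pos j with rfl | hj
  · simp
  lift k to ℕ+ using hk
  lift j to ℕ+ using hj
  rw [pd_coe, pN_coe, MvPolynomial.pderiv_X, Pi.single_apply]
  simp [eq_comm]

def Ld (n : ℕ) : Derivation K (V K) (V K) :=
  MvPolynomial.mkDerivation K (fun j => ((j : ℕ) : V K) * pN K ((j : ℕ) - n))
lemma Ld_X (n : ℕ) (j : ℕ+) : Ld (K := K) n (MvPolynomial.X j) = ((j : ℕ) : V K) * pN K ((j : ℕ) - n) := by
  simp [Ld, MvPolynomial.mkDerivation_X]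
lemma Ld_pN (n : ℕ) (j : ℕ) : Ld (K := K) n (pN K j) = ((j : ℕ) : V K) * pN K (j - n) := by
  rcases Nat.eq_zero_or_pos j with rfl | h
  · simp
  · lift j to ℕ+ using h
    rw [pN_coe, Ld_X]
lemma Ld_zero : Ld (K := K) 0 = Ed := by
  apply MvPolynomial.derivation_ext
  intro j
  rw [Ld_X, Ed_X, Nat.sub_zero, pN_coe]

/-- derivation bracket -/
lemma der_comm (D1 D2 D3 : Derivation K (V K) (V K))
    (h : ∀ j : ℕ+, D1 (D2 (MvPolynomial.X j)) = D2 (D1 (MvPolynomial.X j)) + D3 (MvPolynomial.X j)) (f : V K) :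
    D1 (D2 f) = D2 (D1 f) + D3 f := by
  have : ⁅D1, D2⁆ = D3 := by
    apply MvPolynomial.derivation_ext
    intro j
    rw [Derivation.commutator_apply, h]; ring
  rw [← this, Derivation.commutator_apply]; ring

lemma der_nat_mul (D : Derivation K (V K) (V K)) (n : ℕ) (f : V K) : D ((n : V K) * f) = (n : V K) * D f := by
  rw [Derivation.leibniz, Derivation.map_natCast]; simp

lemma pd_Ld (j k : ℕ) (hj : 0 < j) (f : V K) : pd j (Ld k f) = Ld k (pd j f) + ((j + k : ℕ) : V K) * pd (j + k) f := by
  have := der_comm (pd j) (Ld k) (((j + k : ℕ) : V K) • pd (j + k)) (by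
    intro i
    rw [Ld_X, der_nat_mul, ← pN_coe, Derivation.smul_apply]
    simp only [pd_pN, smul_eq_mul]
    have : Ld k (if j = (i:ℕ) ∧ 0 < j then (1 : V K) else 0) = 0 := by split_ifs <;> simp
    rw [this]
    by_cases h : j = (i:ℕ) - k
    · rw [if_pos ⟨h, hj⟩, if_pos ⟨by omega, by omega⟩, show j + k = (i : ℕ) by omega]; simp
    · rw [if_neg (by tauto), if_neg (by omega)]; simp) f
  simpa using this
lemma pd_pd (j k : ℕ) (f : V K) : pd j (pd k f) = pd k (pd j f) := by
  have := der_comm (pd j) (pd k) 0 (by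
    intro i
    rw [← pN_coe, pd_pN, pd_pN]
    split_ifs <;> simp) f
  simpa using this
lemma pd_Ed (j : ℕ) (f : V K) : pd j (Ed f) = Ed (pd j f) + (j : V K) * pd j f := by
  have := der_comm (pd j) Ed ((j : V K) • pd j) (by
    intro i
    rw [← pN_coe, Ed_pN, der_nat_mul, Derivation.smul_apply, pd_pN]
    split_ifs with h
    · simp [h.1]
    · simp) f
  simpa using this
/-- [∂_1, R] = 0 -/
lemma pd_Vd (f : V K) : pd 1 (Vd 1 f) = Vd 1 (pd 1 f) := by
  have := der_comm (pd 1) (Vd 1) 0 (by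
    intro i
    rw [← pN_coe, Vd_pN, der_nat_mul, pd_pN, pd_pN, if_neg (by have := i.pos; omega)]
    split_ifs <;> simp) f
  simpa using this
/-- [L, R] = 2 E -/
lemma Ld_Vd (f : V K) : Ld 1 (Vd 1 f) = Vd 1 (Ld 1 f) + 2 * Ed f := by
  have := der_comm (Ld 1) (Vd 1) ((2 : V K) • Ed) (by
    intro i
    rw [← pN_coe, Vd_pN, der_nat_mul, Ld_pN, Ld_pN, der_nat_mul, Vd_pN, Derivation.smul_apply, Ed_pN]
    have := i.pos
    rw [show (i:ℕ) - 1 + 1 = i by omega, show (i:ℕ) + 1 - 1 = i by omega]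
    push_cast [Nat.cast_sub (show 1 ≤ (i:ℕ) by omega)]
    simp only [smul_eq_mul]
    ring) f
  simpa using this
lemma Ed_Ld (n : ℕ) (f : V K) : Ld n (Ed f) = Ed (Ld n f) + (n : V K) * Ld n f := by
  have := der_comm (Ld n) Ed ((n : V K) • Ld n) (by
    intro i
    rw [← pN_coe, Ed_pN, der_nat_mul, Ld_pN, der_nat_mul, Ed_pN, Derivation.smul_apply, Ld_pN]
    simp only [smul_eq_mul]
    rcases le_or_gt n (i:ℕ) with h | h
    · push_cast [Nat.cast_sub h]; ring
    · rw [show (i:ℕ) - n = 0 by omega]; simp) f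
  simpa using this
lemma Ed_Vd (n : ℕ) (f : V K) : Ed (Vd n f) = Vd n (Ed f) + (n : V K) * Vd n f := by
  have := der_comm Ed (Vd n) ((n : V K) • Vd n) (by
    intro i
    rw [← pN_coe, Ed_pN, der_nat_mul, Vd_pN, der_nat_mul, Ed_pN, Derivation.smul_apply, Vd_pN]
    simp only [smul_eq_mul]
    push_cast; ring) f
  simpa using this

lemma V_ind_prop {P : V K → Prop} (h1 : ∀ c : K, P (cV c)) (hadd : ∀ f g, P f → P g → P (f + g))
    (hp : ∀ (j : ℕ+) f, P f → P (pN K j * f)) (f : V K) : P f := by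
  induction f using MvPolynomial.induction_on with
  | C c => exact h1 c
  | add p q hp hq => exact hadd _ _ hp hq
  | mul_X p n h => rw [mul_comm, ← pN_coe]; exact hp _ _ h

/-! ### Hall product -/
def zl (a : K) (m : ℕ+ →₀ ℕ) : K := m.prod fun i k => (k.factorial : K) * (a * (i : ℕ)) ^ k
def hl (a : K) : V K →ₗ[K] V K →ₗ[K] K :=
  (MvPolynomial.basisMonomials ℕ+ K).constr K (fun m => zl a m • MvPolynomial.lcoeff K m)
lemma hl_monomial (a : K) (m : ℕ+ →₀ ℕ) (g : V K) :
    hl a (MvPolynomial.monomial m 1) g = zl a m * MvPolynomial.coeff m g := by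
  have : (MvPolynomial.monomial m 1 : V K) = MvPolynomial.basisMonomials ℕ+ K m := by simp
  rw [hl, this, Module.Basis.constr_basis]
  simp [MvPolynomial.lcoeff_apply]
lemma hl_one (a : K) (g : V K) : hl a 1 g = MvPolynomial.coeff 0 g := by
  have := hl_monomial a 0 g
  simpa [zl] using this
lemma zl_add (a : K) (m : ℕ+ →₀ ℕ) (j : ℕ+) : zl a (m + Finsupp.single j 1) = zl a m * ((m j + 1 : ℕ) : K) * (a * (j : ℕ)) := by
  have e : ∀ m : ℕ+ →₀ ℕ, zl a m = (m.erase j).prod (fun i k => (k.factorial : K) * (a * (i : ℕ)) ^ k) * ((m j).factorial * (a * (j : ℕ)) ^ (m j)) := by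
    intro m
    rw [mul_comm]
    exact (Finsupp.mul_prod_erase' m j (fun i k => (k.factorial : K) * (a * (i : ℕ)) ^ k) (by simp)).symm
  rw [e, e m, Finsupp.erase_add, Finsupp.erase_single, add_zero]
  simp only [Finsupp.add_apply, Finsupp.single_eq_same, Nat.factorial_succ, pow_succ]
  push_cast; ring
lemma hl_pN (a : K) (j : ℕ) (f g : V K) : hl a (pN K j * f) g = hl a f ((a * j) • pd j g) := by
  rcases Nat.eq_zero_or_pos j with rfl | h
  · simp
  lift j to ℕ+ using h
  induction f using MvPolynomial.induction_on' with
  | monomial m c =>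
    rw [show MvPolynomial.monomial m c = c • (MvPolynomial.monomial m 1 : V K) by simp [MvPolynomial.smul_monomial], mul_smul_comm, LinearMap.map_smul₂, LinearMap.map_smul₂]
    congr 1
    rw [pN_coe, MvPolynomial.X, MvPolynomial.monomial_mul, one_mul, hl_monomial, hl_monomial, add_comm, zl_add, MvPolynomial.coeff_smul, pd_coe, MvPolynomial.coeff_pderiv]
    push_cast; simp only [smul_eq_mul]; ring
  | add p q hp hq => rw [mul_add, map_add, map_add, LinearMap.add_apply, LinearMap.add_apply, hp, hq]
lemma hl_comm (a : K) (f g : V K) : hl a f g = hl a g f := by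
  induction f using MvPolynomial.induction_on' with
  | add p q hp hq => rw [map_add, map_add, LinearMap.add_apply, hp, hq]
  | monomial m c =>
    induction g using MvPolynomial.induction_on' with
    | add p q hp hq => rw [map_add, map_add, LinearMap.add_apply, hp, hq]
    | monomial n d =>
      have e : ∀ (m : ℕ+ →₀ ℕ) (c : K), MvPolynomial.monomial m c = c • (MvPolynomial.monomial m 1 : V K) := by
        intro m c; simp [MvPolynomial.smul_monomial]
      rw [e m c, e n d]
      simp only [map_smul, LinearMap.smul_apply, hl_monomial, MvPolynomial.coeff_monomial, smul_eq_mul]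
      by_cases h : n = m
      · subst h; simp; ring
      · rw [if_neg h, if_neg (Ne.symm h)]; simp
lemma hl_pN' (a : K) (j : ℕ) (f g : V K) : hl a f (pN K j * g) = hl a ((a * j) • pd j f) g := by
  rw [hl_comm, hl_pN, hl_comm]

variable [CharZero K]
lemma zl_ne (a : K) (ha : a ≠ 0) (m : ℕ+ →₀ ℕ) : zl a m ≠ 0 := by
  rw [zl, Finsupp.prod, Finset.prod_ne_zero_iff]
  intro i _
  have : ((i : ℕ) : K) ≠ 0 := by exact_mod_cast i.ne_zero
  have : ((m i).factorial : K) ≠ 0 := by exact_mod_cast (m i).factorial_ne_zero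
  positivity
lemma hl_nondeg (a : K) (ha : a ≠ 0) {g : V K} (h : ∀ f, hl a f g = 0) : g = 0 := by
  ext m
  have := h (MvPolynomial.monomial m 1)
  rw [hl_monomial] at this
  simpa [zl_ne a ha m] using this
lemma hl_ext (a : K) (ha : a ≠ 0) {g g' : V K} (h : ∀ f, hl a f g = hl a f g') : g = g' := by
  rw [← sub_eq_zero]
  exact hl_nondeg a ha fun f => by rw [map_sub, h, sub_self]

lemma coeff0_der_like (f : V K) (j : ℕ) : MvPolynomial.coeff 0 (pN K j * f) = 0 := by
  have := hl_comm (1 : K) 1 (pN K j * f)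
  rw [hl_one, hl_pN] at this
  rw [this]; simp

lemma hl_Ed (a : K) (f g : V K) : hl a (Ed f) g = hl a f (Ed g) := by
  induction f using V_ind_prop generalizing g with
  | h1 c =>
    rw [show Ed (cV c) = 0 from Derivation.map_algebraMap _ _, show cV c = c • (1 : V K) by simp [smul_V], LinearMap.map_smul₂, hl_comm]
    simp only [map_zero, smul_eq_mul]
    induction g using V_ind_prop with
    | h1 c => rw [show Ed (cV c) = 0 from Derivation.map_algebraMap _ _]; simp
    | hadd p q hp hq => simp only [map_add, mul_add, ← hp, ← hq]; simp
    | hp j f h =>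
      rw [hl_one] at h ⊢
      rw [Derivation.leibniz, smul_eq_mul, smul_eq_mul, Ed_pN, show (f * (((j:ℕ):V K) * pN K j)) = pN K j * (f * (j:ℕ)) by ring, ← mul_add, coeff0_der_like]; simp
  | hadd p q hp hq => simp only [map_add, LinearMap.add_apply, hp, hq]
  | hp j f h =>
    rw [Derivation.leibniz, smul_eq_mul, smul_eq_mul, map_add, LinearMap.add_apply, hl_pN, hl_pN, Ed_pN, show (f * (((j:ℕ):V K) * pN K j)) = ((j:ℕ) : K) • (pN K j * f) by rw [smul_V]; simp; ring, LinearMap.map_smul₂, hl_pN, h, pd_Ed]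
    simp only [Derivation.map_smul, LinearMap.map_smul, map_add, smul_eq_mul]
    rw [show (((j:ℕ):V K) * pd j g) = ((j:ℕ) : K) • (pd j g) by rw [smul_V]; simp]
    simp only [Derivation.map_smul, LinearMap.map_smul, map_add, smul_eq_mul]; ring

lemma hl_Vd (a : K) (n : ℕ) (f g : V K) : hl a (Vd n f) g = hl a f (Ld n g) := by
  induction f using V_ind_prop generalizing g with
  | h1 c =>
    rw [show Vd n (cV c) = 0 from Derivation.map_algebraMap _ _, show cV c = c • (1 : V K) by simp [smul_V], LinearMap.map_smul₂, hl_one]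
    simp only [map_zero, smul_eq_mul, LinearMap.zero_apply]
    induction g using V_ind_prop with
    | h1 c => rw [show Ld n (cV c) = 0 from Derivation.map_algebraMap _ _]; simp
    | hadd p q hp hq => simp only [map_add, MvPolynomial.coeff_add, mul_add, ← hp, ← hq]; simp
    | hp j f h =>
      rw [Derivation.leibniz, smul_eq_mul, smul_eq_mul, Ld_pN, show (f * (((j:ℕ):V K) * pN K (j - n))) = pN K (j - n) * (f * (j:ℕ)) by ring, MvPolynomial.coeff_add, coeff0_der_like, coeff0_der_like]; simp
  | hadd p q hp hq => simp only [map_add, LinearMap.add_apply, hp, hq]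
  | hp j f h =>
    rw [Derivation.leibniz, smul_eq_mul, smul_eq_mul, map_add, LinearMap.add_apply, hl_pN, hl_pN, Vd_pN, show (f * (((j:ℕ):V K) * pN K (j + n))) = ((j:ℕ) : K) • (pN K (j + n) * f) by rw [smul_V]; simp; ring, LinearMap.map_smul₂, hl_pN, h, pd_Ld _ _ j.pos]
    simp only [Derivation.map_smul, LinearMap.map_smul, map_add, smul_eq_mul]
    rw [show (((j+n:ℕ):V K) * pd (j+n) g) = ((j+n:ℕ) : K) • (pd (j+n) g) by rw [smul_V]; simp]
    simp only [Derivation.map_smul, LinearMap.map_smul, map_add, smul_eq_mul]; ring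

/-! pairing on M -/
def hlM (a : K) (g : M K) : M K →ₗ[K] K :=
  bld (fun k => hl a (g.coeff k))
lemma hlM_apply (a : K) (g : M K) (k : ℕ) (f : V K) : hlM a g (X ^ k * C f) = hl a (g.coeff k) f := by
  rw [hlM, bld_apply]
lemma hlM_add (a : K) (g g' h : M K) : hlM a (g + g') h = hlM a g h + hlM a g' h := by
  induction h using M_forall with
  | hadd x y hx hy => simp only [map_add, hx, hy]; ring
  | h k f => rw [hlM_apply, hlM_apply, hlM_apply, coeff_add, map_add, LinearMap.add_apply]
lemma coeff_dA (a : K) (j : ℕ) (f : V K) : (dA a f).coeff j = (a * j) • pd j f := by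
  induction f using V_ind_prop with
  | h1 c => rw [show dA a (cV c) = 0 from Derivation.map_algebraMap _ _, show pd j (cV c) = 0 from Derivation.map_algebraMap _ _]; simp
  | hadd p q hp hq => simp only [map_add, coeff_add, hp, hq, smul_add]
  | hp i f h =>
    rw [dA_mul, coeff_add, coeff_C_mul, h, dA_pN, Derivation.leibniz, pd_pN, coeff_C_mul, coeff_C_mul, coeff_X_pow]
    by_cases hh : j = i
    · subst hh; simp [smul_V]; ring
    · simp [hh, smul_V]; ring
lemma hlM_Aop (a : K) (g h : M K) : hlM a (Aop a g) h = hlM a g (Cop h) := by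
  induction g using M_forall with
  | hadd x y hx hy => simp only [map_add, hlM_add, hx, hy]
  | h k f =>
    induction h using M_forall with
    | hadd x y hx hy => simp only [map_add, hx, hy]
    | h l e =>
      rw [Aop_apply, hlM_apply, Cop_apply, cc, Finset.sum_mul, map_sum]
      have : ∀ x ∈ Finset.HasAntidiagonal.antidiagonal l, hlM a (X ^ k * C f) (C (pN K x.1) * X ^ x.2 * C e) = if x.2 = k then hl a f (pN K x.1 * e) else 0 := by
        intro x _
        rw [show C (pN K x.1) * X ^ x.2 * C e = X ^ x.2 * C (pN K x.1 * e) by rw [C_mul]; ring, hlM_apply, coeff_X_pow_mul', coeff_C]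
        split_ifs with h1 h2 h3 <;> first | rfl | omega | simp
      rw [Finset.sum_congr rfl this, coeff_X_pow_mul']
      split_ifs with h
      · rw [Finset.sum_eq_single (l - k, k)]
        · simp only [if_true]; rw [hl_pN', coeff_dA]
        · intro b hb hb2
          rw [if_neg]
          intro h3; apply hb2
          have := Finset.HasAntidiagonal.mem_antidiagonal.mp hb
          ext <;> simp <;> omega
        · intro h3; exact absurd (Finset.HasAntidiagonal.mem_antidiagonal.mpr (by simp; omega)) h3
      · rw [Finset.sum_eq_zero]; simp
        intro x hx
        have := Finset.HasAntidiagonal.mem_antidiagonal.mp hx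
        rw [if_neg (by omega)]
lemma hlM_comm (a : K) (g h : M K) : hlM a g h = hlM a h g := by
  induction g using M_forall with
  | hadd x y hx hy => simp only [map_add, hlM_add, hx, hy]
  | h k f =>
    induction h using M_forall with
    | hadd x y hx hy => simp only [map_add, hlM_add, hx, hy]
    | h l e =>
      rw [hlM_apply, hlM_apply, coeff_X_pow_mul', coeff_X_pow_mul', coeff_C, coeff_C]
      by_cases hh : k = l
      · subst hh; simp [hl_comm]
      · split_ifs <;> first | omega | simp
lemma hlM_th (a : K) (g h : M K) : hlM a (th g) h = hlM a g (th h) := by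
  induction g using M_forall with
  | hadd x y hx hy => simp only [map_add, hlM_add, hx, hy]
  | h k f =>
    induction h using M_forall with
    | hadd x y hx hy => simp only [map_add, hlM_add, hx, hy]
    | h l e =>
      have e1 : ∀ (k:ℕ) (g : M K), (k : M K) * g = (k : K) • g := by
        intro k g; rw [smul_M]; simp only [cM, map_natCast]
      rw [th_apply, th_apply, e1, e1, map_smul, hlM_apply, hlM_apply, coeff_smul, map_smul, LinearMap.smul_apply, coeff_X_pow_mul', coeff_C]
      by_cases hh : k = l
      · subst hh; rfl
      · split_ifs <;> first | omega | simp
lemma hlM_smul (a c : K) (g h : M K) : hlM a (c • g) h = c * hlM a g h := by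
  rw [hlM_comm, map_smul, hlM_comm, smul_eq_mul]
lemma hlM_Lam (a : K) (g h : M K) : hlM a (Lam a g) h = hlM a g (Lam a h) := by
  have : hlM a (Cop g) h = hlM a g (Aop a h) := by rw [hlM_comm, ← hlM_Aop, hlM_comm]
  simp only [Lam, LinearMap.add_apply, LinearMap.smul_apply, hlM_add, map_add, map_smul, hlM_smul, smul_eq_mul]
  rw [hlM_Aop, this, hlM_th]; ring
lemma coeff0_Lam (a : K) (g : M K) : (Lam a g).coeff 0 = Tht g := by
  induction g using M_forall with
  | hadd x y hx hy => simp only [map_add, coeff_add, hx, hy]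
  | h k f =>
    rw [Lam_XC, Tht_apply]
    simp only [coeff_add]
    have h1 : ((cc k : M K) * C f).coeff 0 = pN K k * f := by
      rw [coeff_mul_C, cc, finsetSum_coeff, Finset.sum_eq_single (k, 0)]
      · simp
      · intro b hb hb2
        rw [coeff_C_mul, coeff_X_pow, if_neg]; simp
        intro h3; apply hb2
        have := Finset.HasAntidiagonal.mem_antidiagonal.mp hb
        ext <;> simp <;> omega
      · intro h3; exact absurd (Finset.HasAntidiagonal.mem_antidiagonal.mpr (by simp)) h3
    have h2 : (X ^ k * dA a f : M K).coeff 0 = 0 := by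
      rw [coeff_X_pow_mul']
      split_ifs
      · rw [coeff_dA]; simp
      · rfl
    have h3 : (cM (a - 1) * (k : M K) * X ^ k * C f).coeff 0 = 0 := by
      rcases Nat.eq_zero_or_pos k with rfl | h
      · simp
      · rw [coeff_mul_C, coeff_mul_X_pow', if_neg (by omega)]; simp
    rw [h1, h2, h3]; simp
lemma hlM_C (a : K) (g : M K) (f : V K) : hlM a g (C f) = hl a (g.coeff 0) f := by
  simpa using hlM_apply a g 0 f
lemma hl_Dop (a : K) (f g : V K) : hl a (Dop a f) g = hl a f (Dop a g) := by
  simp only [Dop, LinearMap.smul_apply, LinearMap.sub_apply, LinearMap.comp_apply, iot_apply, map_smul, map_sub, Derivation.coeFn_coe]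
  rw [hl_Ed, ← coeff0_Lam a, ← coeff0_Lam a, ← hlM_C, hl_comm a f (coeff _ 0), ← hlM_C, hlM_Lam, hlM_Lam, hlM_Lam, hlM_comm]

lemma Dop_p1 (a : K) (ha : a ≠ 0) (f : V K) : Dop a (pN K 1 * f) = pN K 1 * Dop a f + a • Vd 1 f := by
  rw [Dop_mul a ha]
  have : sk a 1 = 0 := by simp [sk, cc_succ, cc_zero, Tht_C]
  rw [this, smul_V]; simp
/-- [∂_1, D] = L -/
lemma pd_Dop (a : K) (ha : a ≠ 0) (g : V K) : pd 1 (Dop a g) = Dop a (pd 1 g) + Ld 1 g := by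
  apply hl_ext a ha
  intro f
  have h1 : hl a (Dop a (pN K 1 * f)) g = hl a (pN K 1 * f) (Dop a g) := hl_Dop a _ _
  rw [Dop_p1 a ha, hl_pN, map_add, LinearMap.add_apply, map_smul, LinearMap.smul_apply, hl_Vd, hl_pN, hl_Dop, map_smul, map_smul, map_smul] at h1
  rw [map_add]
  simp only [Nat.cast_one, mul_one, smul_eq_mul] at h1
  have := mul_left_cancel₀ ha (h1.symm.trans (mul_add _ _ _).symm)
  exact this
end part2
end Jk

namespace Jk
open Polynomial

section part3
variable {K : Type} [Field K] [CharZero K]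

/-- shift homomorphism p_k ↦ p_k + X^k -/
def U : V K →ₐ[K] M K := MvPolynomial.aeval (fun j : ℕ+ => C (pN K j) + X ^ (j : ℕ))
lemma U_pN (k : ℕ) : U (pN K k) = C (pN K k) + X ^ k - if k = 0 then 1 else 0 := by
  rcases Nat.eq_zero_or_pos k with rfl | h
  · simp
  · rw [if_neg (by omega)]
    lift k to ℕ+ using h
    rw [pN_coe, U, MvPolynomial.aeval_X, pN_coe, sub_zero]
lemma U_mul (k : ℕ) (hk : 0 < k) (f : V K) : U (pN K k * f) = C (pN K k) * U f + X ^ k * U f := by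
  rw [map_mul, U_pN, if_neg (by omega)]; ring
lemma U_C (c : K) : U (cV c) = cM c := by
  rw [U, MvPolynomial.aeval_C]; rfl
lemma U_AE (a : K) (f : V K) : a • th (U f) = Aop a (U f) := by
  induction f using V_ind_prop with
  | h1 c => rw [U_C, th_C, Aop_C, show dA a (cV c) = 0 from Derivation.map_algebraMap _ _, smul_zero]
  | hadd p q hp hq => simp only [map_add, smul_add, hp, hq]
  | hp j f h =>
    rw [U_mul _ j.pos, map_add, map_add, th_mul, th_Xmul, Aop_mul, Aop_Xmul, ← h, dA_pN]
    simp only [smul_M, cM, map_mul, map_natCast]; ring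
lemma U_Vd (k : ℕ) (hk : 0 < k) (f : V K) : U (Vd k f) = cw (Vd k).toLinearMap (U f) + X ^ k * th (U f) := by
  induction f using V_ind_prop with
  | h1 c =>
    rw [show Vd k (cV c) = 0 from Derivation.map_algebraMap _ _, U_C, th_C, cw_C, Derivation.coeFn_coe, show Vd k (cV c) = 0 from Derivation.map_algebraMap _ _]; simp
  | hadd p q hp hq => simp only [map_add, mul_add, hp, hq]; ring
  | hp j f h =>
    have hj := j.pos
    rw [U_mul _ j.pos, Derivation.leibniz, smul_eq_mul, smul_eq_mul, map_add, U_mul _ j.pos, h, Vd_pN, map_mul, map_mul, U_pN, if_neg (by omega), map_add, map_add, th_mul, th_Xmul, cw_deriv, cw_Xmul, Vd_pN]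
    simp only [map_natCast, map_mul, pow_add]
    ring
lemma U_cc (k : ℕ) : U (Tht (cc (K := K) k)) = C (Tht (cc k)) + 2 * cc k + (k : M K) * X ^ k - X ^ k - 2 * C (pN K k) + (if k = 0 then 1 else 0) := by
  rw [Tht_cc, map_sum]
  have : ∀ x ∈ Finset.HasAntidiagonal.antidiagonal k, U (pN K x.1 * pN K x.2) =
      C (pN K x.1 * pN K x.2) + C (pN K x.1) * X ^ x.2 + C (pN K x.2) * X ^ x.1 + X ^ k
      - (if x.1 = 0 then C (pN K k) + X ^ k else 0) - (if x.2 = 0 then C (pN K k) + X ^ k else 0) + (if k = 0 then 1 else 0) := by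
    intro x hx
    have hx := Finset.HasAntidiagonal.mem_antidiagonal.mp hx
    rw [map_mul, U_pN, U_pN, ← hx, pow_add]
    rcases x with ⟨i, j⟩
    simp only
    rcases Nat.eq_zero_or_pos i with rfl | hi <;> rcases Nat.eq_zero_or_pos j with rfl | hj
    · simp
    · simp [hj.ne']
    · simp [hi.ne']; 
    · simp [hi.ne', hj.ne']; ring
  rw [Finset.sum_congr rfl this]
  simp only [Finset.sum_add_distrib, Finset.sum_sub_distrib]
  have e1 : ∑ x ∈ Finset.HasAntidiagonal.antidiagonal k, (C (pN K x.2) * X ^ x.1 : M K) = cc k := by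
    rw [cc, ← Finset.Nat.sum_antidiagonal_swap]; rfl
  have e2 : ∑ x ∈ Finset.HasAntidiagonal.antidiagonal k, (if x.1 = 0 then C (pN K k) + X ^ k else 0 : M K) = C (pN K k) + X ^ k := by
    rw [Finset.sum_eq_single (0, k)]
    · simp
    · intro b hb hb2
      rw [if_neg]; intro h; apply hb2
      have := Finset.HasAntidiagonal.mem_antidiagonal.mp hb
      ext <;> simp <;> omega
    · intro h3; exact absurd (Finset.HasAntidiagonal.mem_antidiagonal.mpr (by simp)) h3
  have e3 : ∑ x ∈ Finset.HasAntidiagonal.antidiagonal k, (if x.2 = 0 then C (pN K k) + X ^ k else 0 : M K) = C (pN K k) + X ^ k := by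
    rw [← Finset.Nat.sum_antidiagonal_swap]; exact e2
  rw [e1, e2, e3, ← map_sum, Finset.sum_const, Finset.sum_const]
  rw [show ∑ x ∈ Finset.HasAntidiagonal.antidiagonal k, (C (pN K x.1) * X ^ x.2 : M K) = cc k from rfl]
  have : (Finset.HasAntidiagonal.antidiagonal k).card = k + 1 := Finset.Nat.card_antidiagonal k
  rw [this]
  simp only [nsmul_eq_mul]
  push_cast
  rcases Nat.eq_zero_or_pos k with rfl | h
  · simp; ring
  · simp [h.ne']; ring
lemma U_sk (a : K) (k : ℕ) (hk : 0 < k) : U (sk a k) = C (sk a k) + (k : M K) * cc k - (k : M K) * C (pN K k) + cM (2⁻¹ * a * (k ^ 2 - k)) * X ^ k := by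
  have h2 : (cM 2⁻¹ * 2 : M K) = 1 := by
    have := congrArg (C : V K → M K) (two_inv (K := K))
    rw [C_mul, C_ofNat, C_1] at this; exact this
  rw [sk]
  have e1 : ∀ c : K, U (MvPolynomial.C c : V K) = C (MvPolynomial.C c) := U_C
  simp only [map_add, map_mul, U_cc, U_pN, map_natCast, if_neg hk.ne', cV, cM, map_sub, map_one, map_pow, e1] at h2 ⊢
  linear_combination ((k:M K) * cc k - (k : M K) * C (pN K k)) * h2

/-! ### the strip operators -/
def czl (n : ℤ) : M K →ₗ[K] V K := if 0 ≤ n then (Polynomial.lcoeff (V K) n.toNat).restrictScalars K else 0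
lemma czl_nat (n : ℕ) (g : M K) : czl (n : ℤ) g = g.coeff n := by
  simp [czl]
lemma czl_neg (n : ℤ) (h : n < 0) (g : M K) : czl n g = 0 := by
  rw [czl, if_neg (by omega)]; rfl
lemma czl_C (n : ℤ) (p : V K) (g : M K) : czl n (C p * g) = p * czl n g := by
  rcases lt_or_ge n 0 with h | h
  · rw [czl_neg _ h, czl_neg _ h, mul_zero]
  · lift n to ℕ using h
    rw [czl_nat, czl_nat, coeff_C_mul]
lemma czl_X (n : ℤ) (k : ℕ) (g : M K) : czl n (X ^ k * g) = czl (n - k) g := by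
  rcases lt_or_ge n 0 with h | h
  · rw [czl_neg _ h, czl_neg _ (by omega)]
  · lift n to ℕ using h
    rw [czl_nat, coeff_X_pow_mul']
    split_ifs with h
    · rw [← czl_nat, Nat.cast_sub h]
    · rw [czl_neg _ (by omega)]
lemma czl_XC (n : ℤ) (k : ℕ) (f : V K) : czl n (X ^ k * C f) = if n = k then f else 0 := by
  rw [czl_X]
  split_ifs with h
  · subst h; simpa using czl_nat 0 (C f)
  · rcases lt_or_ge (n - k) 0 with h1 | h1
    · rw [czl_neg _ h1]
    · obtain ⟨m, hm⟩ := Int.eq_ofNat_of_zero_le h1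
      rw [hm, czl_nat, coeff_C, if_neg (by omega)]
lemma czl_th (n : ℤ) (g : M K) : czl n (th g) = cV (n : K) * czl n g := by
  induction g using M_forall with
  | hadd x y hx hy => simp only [map_add, mul_add, hx, hy]
  | h k f =>
    have e1 : (k : M K) * (X ^ k * C f) = (k : K) • (X ^ k * C f) := by rw [smul_M]; simp only [cM, map_natCast]
    rw [th_apply, e1, map_smul, czl_XC, smul_V]
    split_ifs with h
    · subst h; simp
    · simp
lemma czl_cw (n : ℤ) (T : Module.End K (V K)) (g : M K) : czl n (cw T g) = T (czl n g) := by
  induction g using M_forall with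
  | hadd x y hx hy => simp only [map_add, mul_add, hx, hy]
  | h k f =>
    rw [cw_apply, czl_XC, czl_XC]
    split_ifs <;> simp

def Tn (n : ℤ) : V K →ₗ[K] V K := czl n ∘ₗ U.toLinearMap
lemma Tn_def (n : ℤ) (f : V K) : Tn n f = czl n (U f) := rfl
lemma Tn_neg (n : ℤ) (h : n < 0) (f : V K) : Tn n f = 0 := czl_neg _ h _
lemma Tn_mul (n : ℤ) (k : ℕ) (hk : 0 < k) (f : V K) : Tn n (pN K k * f) = pN K k * Tn n f + Tn (n - k) f := by
  rw [Tn_def, U_mul _ hk, map_add, czl_C, czl_X]; rfl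
lemma Tn_Cc (n : ℤ) (c : K) : Tn n (cV c) = if n = 0 then cV c else 0 := by
  rw [Tn_def, U_C]
  simpa using czl_XC n 0 (cV c)
lemma Tn_Vd (n : ℤ) (k : ℕ) (hk : 0 < k) (f : V K) : Tn n (Vd k f) = Vd k (Tn n f) + cV ((n : K) - k) * Tn (n - k) f := by
  rw [Tn_def, U_Vd _ hk, map_add, czl_cw, czl_X, czl_th]
  push_cast; rfl
lemma Tn_sk (a : K) (n : ℤ) (N k : ℕ) (hk : 0 < k) (hN : n < N) (f : V K) : Tn n (sk a k * f) =
    sk a k * Tn n f + (k : V K) * ∑ i ∈ Finset.range N, pN K (k - i) * Tn (n - i) f - (k : V K) * pN K k * Tn n f + cV (2⁻¹ * a * (k ^ 2 - k)) * Tn (n - k) f := by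
  have e : czl n (cc k * U f) = ∑ i ∈ Finset.range N, pN K (k - i) * Tn (n - i) f := by
    rw [cc, Finset.sum_mul, map_sum]
    have : ∀ x : ℕ × ℕ, czl n (C (pN K x.1) * X ^ x.2 * U f) = pN K x.1 * Tn (n - x.2) f := by
      intro x; rw [mul_assoc, czl_C, czl_X]; rfl
    simp only [this]
    rw [← Finset.Nat.sum_antidiagonal_swap]
    simp only [Prod.fst_swap, Prod.snd_swap]
    rw [Finset.Nat.sum_antidiagonal_eq_sum_range_succ (fun i j => pN K j * Tn (n - i) f)]
    have e2 : ∀ Q : ℕ, (n < Q ∨ k < Q) → ∑ i ∈ Finset.range (max (k+1) N), pN K (k - i) * Tn (n - i) f = ∑ i ∈ Finset.range (Q), pN K (k - i) * Tn (n - i) f ∨ max (k+1) N < Q := by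
      intro Q hQ
      rcases le_or_gt Q (max (k+1) N) with h | h
      · left
        symm
        apply Finset.sum_subset
        · intro i; simp; omega
        · intro i _ hi
          simp at hi
          rcases hQ with h | h
          · rw [Tn_neg _ (by omega), mul_zero]
          · rw [show k - i = 0 by omega]; simp
      · right; exact h
    rcases e2 (k+1) (by omega) with h | h <;> rcases e2 N (by omega) with h' | h' <;> try omega
    rw [← h', h]
  rw [Tn_def, map_mul, U_sk _ _ hk]
  have : ∀ c : ℕ, (c : M K) = C (c : V K) := by intro c; simp
  rw [this, add_mul, sub_mul, add_mul, mul_assoc, mul_assoc, mul_assoc (cM _), map_add, map_sub, map_add, czl_C, czl_C, e, czl_C, czl_C, czl_C, czl_X]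
  simp only [← Tn_def]; ring

lemma Tn_Dop (a : K) (ha : a ≠ 0) (f : V K) : ∀ (n : ℤ) (N : ℕ), n < N → Tn n (Dop a f) =
    cV (a * (2⁻¹ * n * (n - 1))) * Tn n f + Dop a (Tn n f) - Ed (Tn n f) + ∑ i ∈ Finset.range N, Ld i (Tn (n - i) f) := by
  induction f using V_ind_prop with
  | h1 c =>
    intro n N hN
    have hc : cV c = c • (1 : V K) := by simp [smul_V]
    have e1 : Dop a (cV c) = 0 := by rw [hc, map_smul, Dop_one, smul_zero]
    have e2 : ∀ n : ℤ, (Tn n) (cV c) = cV (if n = 0 then c else 0) := by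
      intro n; rw [Tn_Cc]; split_ifs <;> simp
    have e3 : ∀ (i : ℕ) (c : K), Ld i (cV c) = 0 := fun i c => Derivation.map_algebraMap _ _
    have e4 : ∀ (c : K), Ed (cV c) = 0 := fun c => Derivation.map_algebraMap _ _
    have e5 : ∀ c : K, Dop a (cV c) = 0 := by
      intro c
      rw [show cV c = c • (1 : V K) by simp [smul_V], map_smul, Dop_one, smul_zero]
    simp only [e2, e3, e4, e5, map_zero, Finset.sum_const_zero]
    split_ifs with h
    · subst h; simp
    · simp
  | hadd p q hp hq =>
    intro n N hN
    simp only [map_add, Finset.sum_add_distrib, hp n N hN, hq n N hN]; ring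
  | hp j f h =>
    intro n N hN
    have hj := j.pos
    rw [Dop_mul a ha, map_add, map_add, Tn_mul _ _ hj, h n N hN, h (n - (j:ℕ)) N (by omega), ← smul_V (a * (j:ℕ)), map_smul, Tn_Vd _ _ hj, Tn_sk a n N _ hj hN, Tn_mul _ _ hj, map_add, Dop_mul a ha, map_add, Derivation.leibniz, Ed_pN]
    have : ∀ i ∈ Finset.range N, Ld i ((Tn (n - (i:ℤ))) (pN K ↑j * f)) = pN K j * Ld i (Tn (n - i) f) + (((j:ℕ):V K) * (pN K (j - i) * Tn (n - i) f) + Ld i (Tn (n - (j:ℕ) - i) f)) := by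
      intro i _
      rw [Tn_mul _ _ hj, map_add, Derivation.leibniz, Ld_pN, smul_eq_mul, smul_eq_mul, sub_right_comm]; ring
    rw [Finset.sum_congr rfl this]
    simp only [Finset.sum_add_distrib, ← Finset.mul_sum, smul_V, smul_eq_mul]
    have e5 : (cV (2⁻¹ * a * (((j:ℕ):K) ^ 2 - ((j:ℕ):K))) : V K) = cV (a * (2⁻¹ * n * (n - 1))) - cV (a * (2⁻¹ * (n - (j:ℕ) : ℤ) * ((n - (j:ℕ) : ℤ) - 1))) - cV (a * (j:ℕ)) * cV ((n:K) - (j:ℕ)) := by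
      rw [← map_mul, ← map_sub, ← map_sub]
      congr 1
      push_cast
      field_simp
      ring
    rw [e5]
    ring

/-! ### stripping sums -/
def sh (i : ℕ) : Module.End K (M K) := bld (fun k => if i ≤ k then LinearMap.mulLeft K (X ^ (k - i)) ∘ₗ iot else 0)
lemma sh_apply (i k : ℕ) (f : V K) : sh i (X ^ k * C f) = if i ≤ k then X ^ (k - i) * C f else 0 := by
  rw [sh, bld_apply]; split_ifs <;> simp
lemma sh_mul (i : ℕ) (p : V K) (g : M K) : sh i (C p * g) = C p * sh i g := by
  induction g using M_forall with
  | hadd x y hx hy => simp only [map_add, mul_add, hx, hy]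
  | h k f => rw [CXC, sh_apply, sh_apply]; split_ifs <;> simp [CXC]; ring
lemma Tht_sh (a : K) (i : ℕ) (f : V K) : Tht (sh i (dA a f)) = cV a * Ld i f := by
  induction f using V_ind_prop with
  | h1 c => rw [show dA a (cV c) = 0 from Derivation.map_algebraMap _ _, show Ld i (cV c) = 0 from Derivation.map_algebraMap _ _]; simp
  | hadd p q hp hq => simp only [map_add, mul_add, hp, hq]
  | hp j f h =>
    rw [dA_mul, map_add, sh_mul, sh_mul, map_add, Tht_mul, Tht_mul, h, dA_pN, Derivation.leibniz, Ld_pN]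
    rw [sh_mul, Tht_mul, show (X ^ (j:ℕ) : M K) = X ^ (j:ℕ) * C 1 by simp, sh_apply]
    split_ifs with h
    · rw [Tht_apply]; simp only [smul_eq_mul, map_mul, map_natCast]; ring
    · rw [show (j:ℕ) - i = 0 by omega]; simp only [smul_eq_mul, map_mul, map_natCast]; simp; ring
lemma sh_X (i k : ℕ) (h : k ≤ i) (g : M K) : sh i (X ^ k * g) = sh (i - k) g := by
  induction g using M_forall with
  | hadd x y hx hy => simp only [map_add, mul_add, hx, hy]
  | h l f =>
    rw [← mul_assoc, ← pow_add, sh_apply, sh_apply]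
    split_ifs <;> first | omega | rfl | skip
    congr 2; omega
lemma sh_X' (i k : ℕ) (h : i ≤ k) (g : M K) : sh i (X ^ k * g) = X ^ (k - i) * g := by
  induction g using M_forall with
  | hadd x y hx hy => simp only [map_add, mul_add, hx, hy]
  | h l f =>
    rw [← mul_assoc, ← pow_add, sh_apply, if_pos (by omega), ← mul_assoc, ← pow_add]
    congr 2; omega
lemma U_expand (s : ℕ) (f : V K) (h : ∀ m : ℤ, (s:ℤ) < m → Tn m f = 0) : U f = ∑ m ∈ Finset.range (s+1), X ^ m * C (Tn m f) := by
  rw [(U f).as_sum_range' (s+1)]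
  · apply Finset.sum_congr rfl
    intro m _
    rw [Tn_def, czl_nat, ← C_mul_X_pow_eq_monomial, mul_comm]
  · rw [Nat.lt_succ_iff, natDegree_le_iff_coeff_eq_zero]
    intro N hN
    rw [← czl_nat]; exact h N (by exact_mod_cast hN)
lemma strip0 (a : K) (ha : a ≠ 0) (s : ℕ) (f : V K) (h : ∀ m : ℤ, (s:ℤ) < m → Tn m f = 0) :
    ∑ i ∈ Finset.range (s+1), Ld i (Tn ((s:ℤ) - i) f) = 0 := by
  have h1 := congrArg (fun g => Tht (sh s g)) (U_AE a f)
  simp only [U_expand s f h, map_sum, th_apply, Aop_apply, Finset.smul_sum] at h1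
  have e0 : Tht (0 : M K) = 0 := map_zero _
  have e1 : ∀ m ∈ Finset.range (s+1), Tht (sh s (a • ((m : M K) * (X ^ m * C (Tn (m:ℤ) f))))) = 0 := by
    intro m hm
    have hm : m < s + 1 := by simpa using hm
    have : (m : M K) = C (m : V K) := by simp
    rw [map_smul, map_smul, this, sh_mul, Tht_mul, sh_apply]
    split_ifs with h2
    · rw [show m - s = 0 by omega, Tht_apply]; simp
    · simp
  have e2 : ∀ m ∈ Finset.range (s+1), Tht (sh s (X ^ m * dA a (Tn (m:ℤ) f))) = cV a * Ld (s - m) (Tn (m:ℤ) f) := by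
    intro m hm
    have hm : m < s + 1 := by simpa using hm
    rw [sh_X _ _ (by omega), Tht_sh]
  rw [Finset.sum_congr rfl e1, Finset.sum_congr rfl e2, Finset.sum_const_zero, ← Finset.mul_sum, eq_comm] at h1
  have ha' : (cV a : V K) ≠ 0 := by simpa using ha
  have h2 := (mul_eq_zero.mp h1).resolve_left ha'
  rw [← h2, ← Finset.sum_range_reflect]
  apply Finset.sum_congr rfl
  intro m hm
  have hm : m < s + 1 := by simpa using hm
  rw [show s + 1 - 1 - m = s - m by omega, show s - (m) = s - m from rfl, Nat.cast_sub (by omega)]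
  congr 2; ring_nf
lemma strip1 (a : K) (ha : a ≠ 0) (s : ℕ) (f : V K) (h : ∀ m : ℤ, ((s+1:ℕ):ℤ) < m → Tn m f = 0) :
    ∑ i ∈ Finset.range (s+1), Ld i (Tn ((s:ℤ) - i) f) = cV ((s:K)+1) * (pN K 1 * Tn (s+1) f) - Vd 1 (Tn (s+1) f) := by
  have h1 := congrArg (fun g => Tht (sh s g)) (U_AE a f)
  simp only [U_expand (s+1) f h, map_sum, th_apply, Aop_apply, Finset.smul_sum] at h1
  rw [Finset.sum_range_succ, Finset.sum_range_succ _ (s+1)] at h1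
  have e1 : ∀ m ∈ Finset.range (s+1), Tht (sh s (a • ((m : M K) * (X ^ m * C (Tn (m:ℤ) f))))) = 0 := by
    intro m hm
    have hm : m < s + 1 := by simpa using hm
    have : (m : M K) = C (m : V K) := by simp
    rw [map_smul, map_smul, this, sh_mul, Tht_mul, sh_apply]
    split_ifs with h2
    · rw [show m - s = 0 by omega, Tht_apply]; simp
    · simp
  have e2 : ∀ m ∈ Finset.range (s+1), Tht (sh s (X ^ m * dA a (Tn (m:ℤ) f))) = cV a * Ld (s - m) (Tn (m:ℤ) f) := by
    intro m hm
    have hm : m < s + 1 := by simpa using hm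
    rw [sh_X _ _ (by omega), Tht_sh]
  have e3 : Tht (sh s (a • (((s+1:ℕ) : M K) * (X ^ (s+1) * C (Tn ((s+1:ℕ):ℤ) f))))) = cV a * (cV ((s:K)+1) * (pN K 1 * Tn (s+1) f)) := by
    have : ((s+1:ℕ) : M K) = C ((s+1:ℕ) : V K) := by simp
    rw [map_smul, map_smul, this, sh_mul, Tht_mul, sh_apply, if_pos (by omega), Tht_apply, smul_V, show s + 1 - s = 1 by omega]
    push_cast; simp
  have e4 : Tht (sh s (X ^ (s+1) * dA a (Tn ((s+1:ℕ):ℤ) f))) = cV a * Vd 1 (Tn (s+1) f) := by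
    rw [sh_X' _ _ (by omega), show s + 1 - s = 1 by omega, Tht_dA]; push_cast; rfl
  rw [Finset.sum_congr rfl e1, Finset.sum_congr rfl e2, Finset.sum_const_zero, ← Finset.mul_sum, e3, e4, zero_add, ← mul_add] at h1
  have ha' : (cV a : V K) ≠ 0 := by simpa using ha
  have h2 := mul_left_cancel₀ ha' h1
  rw [h2, ← Finset.sum_range_reflect, eq_sub_iff_add_eq]
  congr 1
  apply Finset.sum_congr rfl
  intro m hm
  have hm : m < s + 1 := by simpa using hm
  rw [show s + 1 - 1 - m = s - m by omega, Nat.cast_sub (by omega)]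
  congr 2; ring_nf
end part3
end Jk

namespace Jk
open Polynomial

section part4
variable {K : Type} [Field K] [CharZero K]

/-- the complete-type functions -/
def gg (a : K) : ℕ → V K
  | 0 => 1
  | (n+1) => ((a * (n + 1))⁻¹ : K) • ∑ k : Fin (n+1), pN K (k + 1) * gg a (n - k)
lemma gg_zero (a : K) : gg a 0 = 1 := by rw [gg]
def gz (a : K) (n : ℤ) : V K := if 0 ≤ n then gg a n.toNat else 0
lemma gz_nat (a : K) (n : ℕ) : gz a n = gg a n := by simp [gz]
lemma gz_neg (a : K) (n : ℤ) (h : n < 0) : gz a n = 0 := by rw [gz, if_neg (by omega)]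
lemma gz_zero (a : K) : gz a 0 = 1 := by simp [gz, gg_zero]
lemma gz_rec (a : K) (ha : a ≠ 0) (n : ℤ) (N : ℕ) (h : n ≤ N) : (a * n) • gz a n = ∑ k ∈ Finset.range N, pN K (k + 1) * gz a (n - (k + 1)) := by
  rcases lt_trichotomy n 0 with h0 | h0 | h0
  · rw [gz_neg a n h0, smul_zero, Finset.sum_eq_zero]
    intro k _; rw [gz_neg a _ (by omega), mul_zero]
  · subst h0
    rw [Finset.sum_eq_zero]
    · simp
    intro k _; rw [gz_neg a _ (by omega), mul_zero]
  · obtain ⟨m, rfl⟩ : ∃ m : ℕ, n = m + 1 := ⟨(n - 1).toNat, by omega⟩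
    have e : gz a ((m:ℤ) + 1) = gg a (m + 1) := gz_nat a (m + 1)
    rw [e, gg, smul_smul]
    push_cast
    have : (a * ((m:K) + 1)) ≠ 0 := mul_ne_zero ha (by exact_mod_cast Nat.succ_ne_zero m)
    rw [mul_inv_cancel₀ this, one_smul, Finset.sum_fin_eq_sum_range]
    have : ∀ i ∈ Finset.range (m+1), (if h : i < m + 1 then pN K (((⟨i, h⟩ : Fin (m+1)) : ℕ) + 1) * gg a (m - ((⟨i, h⟩ : Fin (m+1)) : ℕ)) else 0) = pN K (i + 1) * gz a ((m:ℤ) + 1 - (i + 1)) := by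
      intro i hi
      have hi : i < m + 1 := by simpa using hi
      rw [dif_pos hi, show (m:ℤ) + 1 - (i + 1) = ((m - i : ℕ) : ℤ) by omega, gz_nat]
    rw [Finset.sum_congr rfl this]
    apply Finset.sum_subset
    · intro i; simp; omega
    · intro i _ hi
      simp at hi
      rw [gz_neg a _ (by omega), mul_zero]
lemma pd_nat_smul (k : ℕ) (c : K) (f : V K) : pd k (c • f) = c • pd k f := Derivation.map_smul _ _ _
lemma pd_gz (a : K) (ha : a ≠ 0) (k : ℕ) (hk : 0 < k) (n : ℤ) : (a * k) • pd k (gz a n) = gz a (n - k) := by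
  rcases lt_or_ge n 0 with h | h
  · rw [gz_neg a n h, gz_neg a _ (by omega)]; simp
  lift n to ℕ using h
  induction n using Nat.strong_induction_on with
  | _ n ih =>
    rcases Nat.eq_zero_or_pos n with rfl | hn
    · rw [Nat.cast_zero, gz_zero, gz_neg a _ (by omega)]; simp
    have h1 := congrArg (fun f => (a * k) • pd k f) (gz_rec a ha n (n + k) (by omega))
    have h2 : ∀ i ∈ Finset.range (n + k), (a * k) • pd k (pN K (i + 1) * gz a ((n:ℤ) - (i + 1))) =
        pN K (i + 1) * gz a ((n:ℤ) - k - (i + 1)) + (if i + 1 = k then (a * k) • gz a ((n:ℤ) - k) else 0) := by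
      intro i _
      rw [Derivation.leibniz, smul_add, smul_eq_mul, smul_eq_mul, ← mul_smul_comm]
      congr 1
      · rcases lt_or_ge ((n:ℤ) - (i+1)) 0 with h | h
        · rw [gz_neg a _ h, gz_neg a _ (by omega)]; simp
        · have := ih (n - (i+1)) (by omega)
          rw [show ((n - (i+1) : ℕ) : ℤ) = (n:ℤ) - (i + 1) by omega] at this
          rw [this, sub_right_comm]
      · rw [pd_pN]
        by_cases hi : i + 1 = k
        · subst hi; simp
        · rw [if_neg hi, if_neg (by omega)]; simp
    rw [map_sum, Finset.smul_sum, Finset.sum_congr rfl h2, Finset.sum_add_distrib, ← gz_rec a ha _ _ (by omega), Finset.sum_eq_single (k-1)] at h1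
    · rw [if_pos (by omega), ← add_smul, pd_nat_smul, smul_comm] at h1
      have hne : a * (n : K) ≠ 0 := mul_ne_zero ha (by exact_mod_cast hn.ne')
      have e : a * (((n:ℤ) - (k:ℤ) : ℤ) : K) + a * k = a * (n:K) := by push_cast; ring
      rw [e, Int.cast_natCast] at h1
      exact smul_right_injective _ hne h1
    · intro b _ hb; rw [if_neg (by omega)]
    · intro hb; simp at hb; omega
lemma coeff0_gz (a : K) (n : ℤ) : MvPolynomial.coeff 0 (gz a n) = if n = 0 then 1 else 0 := by
  rcases lt_or_ge n 0 with h | h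
  · rw [gz_neg a n h, if_neg (by omega)]; simp
  lift n to ℕ using h
  rw [gz_nat]
  cases n with
  | zero => simp [gg_zero]
  | succ n =>
    rw [gg, MvPolynomial.coeff_smul, MvPolynomial.coeff_sum, Finset.sum_eq_zero]
    · rw [if_neg (by omega)]; simp
    intro i _; exact coeff0_der_like _ _
lemma hl_cV (a c : K) (g : V K) : hl a (cV c) g = c * MvPolynomial.coeff 0 g := by
  rw [show cV c = c • (1 : V K) by simp [smul_V], LinearMap.map_smul₂, hl_one, smul_eq_mul]
/-- multiplication by gz is adjoint to T -/
lemma hl_gz (a : K) (ha : a ≠ 0) (f : V K) : ∀ (n : ℤ) (h : V K), hl a f (gz a n * h) = hl a (Tn n f) h := by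
  induction f using V_ind_prop with
  | h1 c =>
    intro n h
    have : ∀ x y : V K, MvPolynomial.coeff 0 (x * y) = MvPolynomial.coeff 0 x * MvPolynomial.coeff 0 y := by
      intro x y
      simp only [← MvPolynomial.constantCoeff_eq, map_mul]
    rw [Tn_Cc, hl_cV, this, coeff0_gz]
    split_ifs
    · rw [hl_cV]; ring
    · simp
  | hadd p q hp hq => intro n h; simp only [map_add, LinearMap.add_apply, hp, hq]
  | hp j f h =>
    intro n x
    rw [hl_pN, Derivation.leibniz, smul_add, smul_eq_mul, smul_eq_mul, ← mul_smul_comm, ← mul_smul_comm, map_add, h, pd_gz a ha _ j.pos, mul_comm x, h, Tn_mul _ _ j.pos, map_add, LinearMap.add_apply, hl_pN]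
/-- D on g_s h -/
lemma Dop_gz (a : K) (ha : a ≠ 0) (n : ℤ) (N : ℕ) (hN : n < N) (h : V K) : Dop a (gz a n * h) =
    cV (a * (2⁻¹ * n * (n - 1))) * (gz a n * h) + gz a n * Dop a h - gz a n * Ed h + ∑ i ∈ Finset.range N, gz a (n - i) * Vd i h := by
  apply hl_ext a ha
  intro f
  rw [← hl_Dop, hl_gz a ha, Tn_Dop a ha f n N hN]
  have : ∀ (c : K) (f g : V K), hl a f (cV c * g) = hl a (cV c * f) g := by
    intro c f g
    rw [← smul_V, ← smul_V, LinearMap.map_smul, LinearMap.map_smul₂]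
  simp only [map_add, map_sub, LinearMap.add_apply, LinearMap.sub_apply, map_sum, LinearMap.sum_apply, this, hl_gz a ha, hl_Dop, hl_Ed]
  congr 1
  · congr 2
    rw [← smul_V, ← smul_V, LinearMap.map_smul, LinearMap.map_smul, LinearMap.map_smul]
  · apply Finset.sum_congr rfl
    intro i _
    rw [hl_comm, ← hl_Vd, hl_comm]
lemma dA_gz (a : K) (ha : a ≠ 0) (n : ℤ) (N : ℕ) (hN : n ≤ N) : dA a (gz a n) = ∑ j ∈ Finset.range N, X ^ (j + 1) * C (gz a (n - (j + 1))) := by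
  ext1 i
  rw [coeff_dA, finsetSum_coeff]
  rcases Nat.eq_zero_or_pos i with rfl | hi
  · rw [Finset.sum_eq_zero]
    · simp
    · intro j _; rw [coeff_mul_C, coeff_X_pow]; simp
  · rw [pd_gz a ha _ hi]
    have : ∀ j ∈ Finset.range N, (X ^ (j + 1) * C (gz a (n - (j + 1))) : M K).coeff i = if j = i - 1 then gz a (n - i) else 0 := by
      intro j _
      rw [coeff_mul_C, coeff_X_pow]
      by_cases h : j = i - 1
      · have h' : i = j + 1 := by omega
        rw [if_pos h, if_pos h', h', one_mul]; push_cast; rfl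
      · rw [if_neg h, if_neg (by omega), zero_mul]
    rw [Finset.sum_congr rfl this, Finset.sum_ite_eq']
    split_ifs with h
    · rfl
    · simp at h; rw [gz_neg a _ (by omega)]
lemma Vd_gz (a : K) (ha : a ≠ 0) (i : ℕ) (n : ℤ) (N : ℕ) (hN : n ≤ N) : a • Vd i (gz a n) = ∑ j ∈ Finset.range N, pN K (i + (j + 1)) * gz a (n - (j + 1)) := by
  rw [smul_V, ← Tht_dA, dA_gz a ha n N hN, Finset.mul_sum, map_sum]
  apply Finset.sum_congr rfl
  intro j _
  rw [← mul_assoc, ← pow_add, Tht_apply]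
/-- H operator -/
def Hg0 (a : K) (N : ℕ) (x y : ℤ) : V K := ∑ i ∈ Finset.range N, gz a (x - i) * Vd i (gz a y)
lemma Hg0_rec (a : K) (ha : a ≠ 0) (N : ℕ) (x y : ℤ) (hx : x < N) (hy : y ≤ N) (h0 : 0 ≤ x) (h1 : 1 ≤ y) : Hg0 a N x y = ((x:K) - y + 2) • (gz a (x + 1) * gz a (y - 1)) + Hg0 a (N+1) (x+1) (y-1) := by
  have hinj := smul_right_injective (V K) ha
  apply hinj
  simp only [Hg0, Finset.smul_sum, smul_add]
  have e1 : ∀ i ∈ Finset.range N, a • (gz a (x - i) * Vd i (gz a y)) = pN K (i + 1) * gz a (x + 1 - (i + 1)) * gz a (y - 1) + ∑ j ∈ Finset.range N, pN K (i + 1 + (j + 1)) * (gz a (x - i) * gz a (y - 1 - (j + 1))) := by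
    intro i _
    rw [← mul_smul_comm, Vd_gz a ha i y (N+1) (by omega), Finset.sum_range_succ', mul_add, Finset.mul_sum, add_comm]
    congr 1
    · push_cast; rw [show x + 1 - ((i:ℤ) + 1) = x - i by ring]; ring
    · apply Finset.sum_congr rfl
      intro j _
      rw [show i + (j + 1 + 1) = i + 1 + (j + 1) by ring]
      push_cast
      rw [show y - ((j:ℤ) + 1 + 1) = y - 1 - (j + 1) by ring]; ring
  have e2 : ∀ i ∈ Finset.range (N+1), a • (gz a (x + 1 - i) * Vd i (gz a (y - 1))) = ∑ j ∈ Finset.range N, pN K (i + (j + 1)) * (gz a (x + 1 - i) * gz a (y - 1 - (j + 1))) := by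
    intro i _
    rw [← mul_smul_comm, Vd_gz a ha i _ N (by omega), Finset.mul_sum]
    apply Finset.sum_congr rfl
    intro j _; ring
  rw [Finset.sum_congr rfl e1, Finset.sum_congr rfl e2, Finset.sum_add_distrib, Finset.sum_range_succ', ← Finset.sum_mul, ← gz_rec a ha (x + 1) N (by omega)]
  have e3 : ∑ j ∈ Finset.range N, pN K (0 + (j + 1)) * (gz a (x + 1 - (0:ℕ)) * gz a (y - 1 - (j + 1))) = gz a (x + 1) * ((a * (y - 1 : ℤ)) • gz a (y - 1)) := by
    rw [gz_rec a ha (y-1) N (by omega), Finset.mul_sum]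
    apply Finset.sum_congr rfl
    intro j _; rw [zero_add]; simp; ring
  rw [e3]
  have e4 : ∀ i ∈ Finset.range N, ∑ j ∈ Finset.range N, pN K (i + 1 + (j + 1)) * (gz a (x + 1 - ((i + 1 : ℕ) : ℤ)) * gz a (y - 1 - (j + 1))) = ∑ j ∈ Finset.range N, pN K (i + 1 + (j + 1)) * (gz a (x - i) * gz a (y - 1 - (j + 1))) := by
    intro i _
    rw [show x + 1 - ((i+1:ℕ):ℤ) = x - i by push_cast; ring]
  rw [Finset.sum_congr rfl e4]
  simp only [smul_V, map_add, map_sub, map_mul]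
  push_cast
  simp only [cV, map_add, map_sub, map_mul, map_one, map_ofNat, map_intCast]
  ring
lemma Hg0_mem (a : K) (ha : a ≠ 0) (y : ℕ) : ∀ (N : ℕ) (x : ℤ), x < N → (y:ℤ) ≤ N → 0 ≤ x → Hg0 a N x y ∈ Submodule.span K {f | ∃ i : ℕ, 1 ≤ i ∧ i ≤ y ∧ f = gz a (x + i) * gz a (y - i)} := by
  induction y with
  | zero =>
    intro N x hx hy h0
    rw [Hg0, Finset.sum_eq_zero]
    · exact zero_mem _
    · intro i _; rw [Nat.cast_zero, gz_zero]; simp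
  | succ y ih =>
    intro N x hx hy h0
    rw [Hg0_rec a ha N x _ hx hy h0 (by push_cast; omega)]
    apply add_mem
    · apply Submodule.smul_mem
      apply Submodule.subset_span
      exact ⟨1, le_refl _, by omega, by simp⟩
    · have := ih (N+1) (x+1) (by push_cast; omega) (by push_cast at hy ⊢; omega) (by omega)
      rw [show ((y+1:ℕ):ℤ) - 1 = y by push_cast; ring]
      refine Submodule.span_mono ?_ this
      rintro f ⟨i, h1, h2, rfl⟩
      refine ⟨i+1, by omega, by omega, ?_⟩
      push_cast
      congr 2 <;> ring
end part4
end Jk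

namespace Jk

section part5

lemma exists_max (m : Multiset ℕ) (h : m ≠ 0) : ∃ s μ, m = s ::ₘ μ ∧ ∀ x ∈ μ, x ≤ s := by
  have h1 : m.toFinset.Nonempty := by
    obtain ⟨x, hx⟩ := Multiset.exists_mem_of_ne_zero h
    exact ⟨x, by simpa using hx⟩
  obtain ⟨s, hs, hmax⟩ := Finset.exists_max_image m.toFinset id h1
  refine ⟨s, m.erase s, (Multiset.cons_erase (by simpa using hs)).symm, ?_⟩
  intro x hx
  exact hmax x (by simpa using Multiset.mem_of_mem_erase hx)
lemma exists_max' (m : Multiset ℕ+) (h : m ≠ 0) : ∃ s μ, m = s ::ₘ μ ∧ ∀ x ∈ μ, x ≤ s := by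
  have h1 : m.toFinset.Nonempty := by
    obtain ⟨x, hx⟩ := Multiset.exists_mem_of_ne_zero h
    exact ⟨x, by simpa using hx⟩
  obtain ⟨s, hs, hmax⟩ := Finset.exists_max_image m.toFinset id h1
  refine ⟨s, m.erase s, (Multiset.cons_erase (by simpa using hs)).symm, ?_⟩
  intro x hx
  exact hmax x (by simpa using Multiset.mem_of_mem_erase hx)
lemma ms_induct {P : Multiset ℕ → Prop} (h0 : P 0) (hc : ∀ s μ, (∀ x ∈ μ, x ≤ s) → P μ → P (s ::ₘ μ)) (m : Multiset ℕ) : P m := by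
  induction hn : Multiset.card m generalizing m with
  | zero => rw [Multiset.card_eq_zero.mp hn]; exact h0
  | succ n ih =>
    obtain ⟨s, μ, rfl, h⟩ := exists_max m (by rintro rfl; simp at hn)
    exact hc s μ h (ih μ (by simpa using hn))
lemma ms_induct' {P : Multiset ℕ+ → Prop} (h0 : P 0) (hc : ∀ s μ, (∀ x ∈ μ, x ≤ s) → P μ → P (s ::ₘ μ)) (m : Multiset ℕ+) : P m := by
  induction hn : Multiset.card m generalizing m with
  | zero => rw [Multiset.card_eq_zero.mp hn]; exact h0
  | succ n ih =>
    obtain ⟨s, μ, rfl, h⟩ := exists_max' m (by rintro rfl; simp at hn)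
    exact hc s μ h (ih μ (by simpa using hn))

def S (t : ℕ) (m : Multiset ℕ) : ℕ := (m.map (fun x => x - t)).sum
def hh (t : ℕ) (m : Multiset ℕ) : ℕ := m.countP (fun x => t < x)
def nu (l : Multiset ℕ+) : Multiset ℕ := l.map (fun i : ℕ+ => (i : ℕ))
def mle (m l : Multiset ℕ) : Prop := S 0 m = S 0 l ∧ ∀ t, S t m ≤ S t l
def mlt (m l : Multiset ℕ) : Prop := mle m l ∧ ∃ t, S t m < S t l
lemma nu_inj : Function.Injective nu := Multiset.map_injective PNat.coe_injective
@[simp] lemma nu_zero : nu 0 = 0 := rfl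
@[simp] lemma nu_cons (s : ℕ+) (l) : nu (s ::ₘ l) = (s:ℕ) ::ₘ nu l := by simp [nu]
@[simp] lemma S_zero (t : ℕ) : S t 0 = 0 := by simp [S]
@[simp] lemma S_cons (t s : ℕ) (m) : S t (s ::ₘ m) = (s - t) + S t m := by simp [S]
@[simp] lemma hh_zero (t : ℕ) : hh t 0 = 0 := by simp [hh]
lemma hh_cons (t s : ℕ) (m) : hh t (s ::ₘ m) = hh t m + if t < s then 1 else 0 := by simp [hh, Multiset.countP_cons]
lemma S_succ (t : ℕ) (m) : S t m = S (t+1) m + hh t m := by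
  induction m using Multiset.induction with
  | empty => simp
  | cons s m ih => rw [S_cons, S_cons, hh_cons]; split_ifs <;> omega
lemma S_zero_of (t : ℕ) (m) (h : S 0 m ≤ t) : S t m = 0 := by
  induction m using Multiset.induction with
  | empty => simp
  | cons s m ih => rw [S_cons] at h ⊢; have := ih (by omega); omega
lemma hh_zero_of (t : ℕ) (m) (h : S 0 m ≤ t) : hh t m = 0 := by
  have := S_succ t m
  rw [S_zero_of t m h] at this; omega
lemma S_zero_max (t : ℕ) (m : Multiset ℕ) (h : ∀ x ∈ m, x ≤ t) : S t m = 0 := by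
  induction m using Multiset.induction with
  | empty => simp
  | cons s m ih =>
    rw [S_cons, ih (fun x hx => h x (Multiset.mem_cons_of_mem hx))]
    have := h s (Multiset.mem_cons_self _ _); omega
lemma max_of_S (t : ℕ) (m : Multiset ℕ) (h : S t m = 0) : ∀ x ∈ m, x ≤ t := by
  induction m using Multiset.induction with
  | empty => simp
  | cons s m ih =>
    rw [S_cons] at h
    intro x hx
    rcases Multiset.mem_cons.mp hx with rfl | hx
    · omega
    · exact ih (by omega) x hx
lemma count_hh (j : ℕ) (m : Multiset ℕ) : m.count (j+1) + hh (j+1) m = hh j m := by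
  induction m using Multiset.induction with
  | empty => simp
  | cons s m ih => rw [Multiset.count_cons, hh_cons, hh_cons]; split_ifs <;> omega
lemma hh_ext {l m : Multiset ℕ+} (h : ∀ j, hh j (nu l) = hh j (nu m)) : l = m := by
  apply nu_inj
  ext j
  cases j with
  | zero =>
    rw [Multiset.count_eq_zero_of_notMem, Multiset.count_eq_zero_of_notMem] <;> · simp [nu]
  | succ j => have h1 := count_hh j (nu l); have h2 := count_hh j (nu m); rw [h, h] at h1; omega
lemma S_ext {l m : Multiset ℕ+} (h : ∀ j, S j (nu l) = S j (nu m)) : l = m := by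
  apply hh_ext
  intro j
  have h1 := S_succ j (nu l); have h2 := S_succ j (nu m); rw [h, h] at h1; omega
lemma mle_refl (m) : mle m m := ⟨rfl, fun _ => le_refl _⟩
lemma mle_trans {l m k} (h1 : mle l m) (h2 : mle m k) : mle l k := ⟨h1.1.trans h2.1, fun t => (h1.2 t).trans (h2.2 t)⟩
lemma mle_antisymm {l m : Multiset ℕ+} (h1 : mle (nu l) (nu m)) (h2 : mle (nu m) (nu l)) : l = m :=
  S_ext fun j => le_antisymm (h1.2 j) (h2.2 j)
lemma mle_cons (s : ℕ) {l m} (h : mle l m) : mle (s ::ₘ l) (s ::ₘ m) :=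
  ⟨by simp [h.1], fun t => by simpa using h.2 t⟩
lemma mlt_cons (s : ℕ) {l m} (h : mlt l m) : mlt (s ::ₘ l) (s ::ₘ m) := by
  obtain ⟨h1, t, ht⟩ := h
  exact ⟨mle_cons s h1, t, by simpa using ht⟩
lemma mlt_not {l m} (h : mlt l m) : ¬ mle m l := by
  obtain ⟨h1, t, ht⟩ := h
  intro h2; have := h2.2 t; omega
lemma mlt_raise (x y i : ℕ) (r) (hxy : y ≤ x) (hi : 1 ≤ i) (hi2 : i ≤ y) : mlt (x ::ₘ y ::ₘ r) ((x + i) ::ₘ (y - i) ::ₘ r) := by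
  refine ⟨⟨by simp; omega, fun t => by simp; omega⟩, x, by simp; omega⟩
def npp (m : Multiset ℕ) : ℕ := (m.map (fun x => x.choose 2)).sum
@[simp] lemma npp_zero : npp 0 = 0 := by simp [npp]
@[simp] lemma npp_cons (s m) : npp (s ::ₘ m) = s.choose 2 + npp m := by simp [npp]
lemma choose_sum (p N : ℕ) (h : p ≤ N) : p.choose 2 = ∑ j ∈ Finset.range N, if j < p then j else 0 := by
  rw [← Finset.sum_filter]
  rw [show (Finset.range N).filter (· < p) = Finset.range p by ext; simp; omega, Finset.sum_range_id, Nat.choose_two_right]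
lemma npp_hh (m : Multiset ℕ) (N : ℕ) (h : S 0 m ≤ N) : npp m = ∑ j ∈ Finset.range N, j * hh j m := by
  induction m using Multiset.induction with
  | empty => simp
  | cons s m ih =>
    rw [S_cons] at h
    rw [npp_cons, ih (by omega), choose_sum s N (by omega), ← Finset.sum_add_distrib]
    apply Finset.sum_congr rfl
    intro j _
    rw [hh_cons]; split_ifs <;> ring
lemma S0_hh (m : Multiset ℕ) (N : ℕ) (h : S 0 m ≤ N) : S 0 m = ∑ j ∈ Finset.range N, hh j m := by
  have : ∀ N, S 0 m = ∑ j ∈ Finset.range N, hh j m + S N m := by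
    intro N
    induction N with
    | zero => simp
    | succ N ih => rw [Finset.sum_range_succ, ih, S_succ N]; ring
  rw [this N, S_zero_of N m h]; simp
lemma npp_S (m : Multiset ℕ) (N : ℕ) (h : S 0 m ≤ N) : npp m = ∑ j ∈ Finset.range N, S (j+1) m := by
  rw [npp_hh m N h]
  have : ∀ N, ∑ j ∈ Finset.range N, j * hh j m + N * S N m = ∑ j ∈ Finset.range N, S (j+1) m := by
    intro N
    induction N with
    | zero => simp
    | succ N ih =>
      rw [Finset.sum_range_succ, Finset.sum_range_succ, ← ih]
      have := S_succ N m
      rw [this]; ring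
  rw [← this N, S_zero_of N m h]; simp
lemma npp_mono {l m} (h : mle l m) : npp l ≤ npp m := by
  rw [npp_S l _ le_rfl, npp_S m (S 0 l) h.1.ge]
  exact Finset.sum_le_sum fun j _ => h.2 _
lemma npp_strict {l m} (h : mle l m) (he : npp m ≤ npp l) : ∀ t, S t l = S t m := by
  have he := le_antisymm he (npp_mono h)
  rw [npp_S l _ le_rfl, npp_S m (S 0 l) h.1.ge, eq_comm, Finset.sum_eq_sum_iff_of_le (fun j _ => h.2 _)] at he
  intro t
  rcases Nat.eq_zero_or_pos t with rfl | ht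
  · exact h.1
  rcases lt_or_ge (t-1) (S 0 l) with h1 | h1
  · have := he (t-1) (by simpa using h1)
    rwa [show t - 1 + 1 = t by omega] at this
  · rw [S_zero_of t l (by omega), S_zero_of t m (by have := h.1; omega)]
lemma npp_strict' {l m : Multiset ℕ+} (h : mle (nu l) (nu m)) (he : npp (nu m) ≤ npp (nu l)) : l = m := S_ext (npp_strict h he)
def nn (m : Multiset ℕ) : ℕ := ∑ j ∈ Finset.range (S 0 m), (hh j m).choose 2
lemma nn_hh (m : Multiset ℕ) (N : ℕ) (h : S 0 m ≤ N) : nn m = ∑ j ∈ Finset.range N, (hh j m).choose 2 := by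
  apply Finset.sum_subset
  · intro j; simp; omega
  · intro j _ hj; simp at hj; rw [hh_zero_of j m hj]; rfl
lemma hh_max (t : ℕ) (m : Multiset ℕ) (h : ∀ x ∈ m, x ≤ t) : hh t m = 0 := by
  have := S_succ t m; rw [S_zero_max t m h] at this; omega
lemma nn_cons (s : ℕ) (m : Multiset ℕ) (h : ∀ x ∈ m, x ≤ s) : nn (s ::ₘ m) = nn m + S 0 m := by
  have e1 : S 0 (s ::ₘ m) = s + S 0 m := by simp
  rw [nn, nn_hh m _ (show S 0 m ≤ S 0 (s ::ₘ m) by omega), S0_hh m _ (show S 0 m ≤ S 0 (s ::ₘ m) by omega), ← Finset.sum_add_distrib]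
  apply Finset.sum_congr rfl
  intro j _
  rw [hh_cons]
  split_ifs with h2
  · rw [Nat.choose_succ_succ' _ 1]; simp; ring
  · rw [hh_max j m (fun x hx => (h x hx).trans (by omega))]; simp
lemma nn_zero : nn 0 = 0 := by simp [nn]
/-- content-type eigenvalue -/
def ct {K : Type} [Field K] (a : K) (m : Multiset ℕ) : K := a * npp m - nn m
lemma ct_cons {K : Type} [Field K] (a : K) (s : ℕ) (m : Multiset ℕ) (h : ∀ x ∈ m, x ≤ s) :
    ct a (s ::ₘ m) = a * (s.choose 2 : ℕ) - S 0 m + ct a m := by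
  rw [ct, ct, nn_cons s m h, npp_cons]; push_cast; ring
/-- adding a box in column j -/
def addbox (l m : Multiset ℕ+) (j : ℕ) : Prop := ∀ i, hh i (nu m) = hh i (nu l) + if i = j then 1 else 0
lemma addbox_S0 {l m j} (h : addbox l m j) : S 0 (nu m) = S 0 (nu l) + 1 ∧ npp (nu m) = npp (nu l) + j ∧ nn (nu m) = nn (nu l) + hh j (nu l) := by
  set N := S 0 (nu l) + S 0 (nu m) + j + 1 with hN
  rw [S0_hh (nu l) N (by omega), S0_hh (nu m) N (by omega), npp_hh (nu l) N (by omega), npp_hh (nu m) N (by omega), nn_hh (nu l) N (by omega), nn_hh (nu m) N (by omega)]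
  refine ⟨?_, ?_, ?_⟩
  · simp only [h _, Finset.sum_add_distrib, Finset.sum_ite_eq']
    rw [if_pos (by simp; omega)]
  · simp only [h _, mul_add, Finset.sum_add_distrib, mul_ite, mul_one, mul_zero, Finset.sum_ite_eq']
    rw [if_pos (by simp; omega)]
  · have : ∀ i ∈ Finset.range N, (hh i (nu m)).choose 2 = (hh i (nu l)).choose 2 + if i = j then hh i (nu l) else 0 := by
      intro i _
      rw [h]; split_ifs
      · rw [Nat.choose_succ_succ' _ 1]; simp; ring
      · simp
    rw [Finset.sum_congr rfl this, Finset.sum_add_distrib, Finset.sum_ite_eq', if_pos (by simp; omega)]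
lemma addbox_ct {K : Type} [Field K] (a : K) {l m j} (h : addbox l m j) : ct a (nu m) = ct a (nu l) + (a * j - hh j (nu l)) := by
  obtain ⟨_, h2, h3⟩ := addbox_S0 h
  rw [ct, ct, h2, h3]; push_cast; ring

/-! dominance -/
lemma list_take_le (t : ℕ) (L : List ℕ) : ∀ k, (L.take k).sum ≤ (L.map (fun x => x - t)).sum + k * t := by
  induction L with
  | nil => simp
  | cons x L ih =>
    intro k
    cases k with
    | zero => simp
    | succ k => have := ih k; simp; rw [add_mul]; omega
lemma list_take_eq (t : ℕ) (L : List ℕ) (hL : L.Pairwise (· ≥ ·)) : ∃ k, (L.map (fun x => x - t)).sum + k * t = (L.take k).sum := by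
  induction L with
  | nil => exact ⟨0, by simp⟩
  | cons x L ih =>
    rw [List.pairwise_cons] at hL
    rcases le_or_gt x t with h | h
    · refine ⟨0, ?_⟩
      have e : (List.map (fun x => x - t) (x :: L)).sum = 0 := by
        apply List.sum_eq_zero
        intro y hy
        obtain ⟨z, hz, rfl⟩ := List.mem_map.mp hy
        rcases List.mem_cons.mp hz with rfl | hz
        · omega
        · have := hL.1 z hz; omega
      rw [e]; simp
    · obtain ⟨k, hk⟩ := ih hL.2
      refine ⟨k+1, ?_⟩
      simp; rw [add_mul]; omega
lemma S_list (t : ℕ) (L : List ℕ) : S t (L : Multiset ℕ) = (L.map (fun x => x - t)).sum := by simp [S]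
end part5
end Jk

namespace Jk
section part6
variable {K : Type} [Field K] [CharZero K]

def gm (a : K) (σ : Multiset ℕ) : V K := (σ.map (gg a)).prod
@[simp] lemma gm_zero (a : K) : gm a 0 = 1 := by simp [gm]
lemma gm_cons (a : K) (s : ℕ) (σ) : gm a (s ::ₘ σ) = gz a s * gm a σ := by simp [gm, gz_nat]
lemma gm_add (a : K) (σ τ) : gm a (σ + τ) = gm a σ * gm a τ := by simp [gm]
lemma S_add (t : ℕ) (σ τ) : S t (σ + τ) = S t σ + S t τ := by simp [S]
lemma gm_strip (a : K) (σ : Multiset ℕ) : ∃ l : Multiset ℕ+, (∀ t, S t (nu l) = S t σ) ∧ gm a σ = gm a (nu l) := by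
  induction σ using Multiset.induction with
  | empty => exact ⟨0, by simp, by simp⟩
  | cons s σ ih =>
    obtain ⟨l, h1, h2⟩ := ih
    rcases Nat.eq_zero_or_pos s with rfl | hs
    · refine ⟨l, by simpa using h1, ?_⟩
      rw [gm_cons, ← h2, Nat.cast_zero, gz_zero, one_mul]
    · lift s to ℕ+ using hs
      refine ⟨s ::ₘ l, by simpa using h1, ?_⟩
      rw [nu_cons, gm_cons, gm_cons, h2]

/-! homogeneity -/
def Hm (n : ℕ) (f : V K) : Prop := Ed f = (n : K) • f
def wtN (m : ℕ+ →₀ ℕ) : ℕ := m.sum fun i k => k * (i : ℕ)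
def pm (l : Multiset ℕ+) : V K := MvPolynomial.monomial (Multiset.toFinsupp l) 1
lemma pm_cons (s : ℕ+) (l) : pm (K := K) (s ::ₘ l) = pN K s * pm l := by
  rw [pm, pm, pN_coe, MvPolynomial.X, MvPolynomial.monomial_mul, one_mul, ← Multiset.singleton_add, map_add, Multiset.toFinsupp_singleton]
lemma pm_zero : pm (K := K) 0 = 1 := by simp [pm]
lemma wtN_toFinsupp (l : Multiset ℕ+) : wtN (Multiset.toFinsupp l) = S 0 (nu l) := by
  have hadd : ∀ x y, wtN (x + y) = wtN x + wtN y := by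
    intro x y
    rw [wtN, Finsupp.sum_add_index']; rfl
    · simp
    · intro i k1 k2; ring
  induction l using Multiset.induction with
  | empty => simp [wtN]
  | cons s l ih =>
    rw [← Multiset.singleton_add, map_add, hadd, ih, Multiset.toFinsupp_singleton, Multiset.singleton_add, nu_cons, S_cons]
    simp [wtN]
lemma Hm_mul {n m : ℕ} {f g : V K} (hf : Hm n f) (hg : Hm m g) : Hm (n + m) (f * g) := by
  rw [Hm, Derivation.leibniz, hf, hg]
  simp only [smul_V, smul_eq_mul]; push_cast; simp only [cV, map_add, map_natCast]; ring
lemma Hm_one : Hm (K := K) 0 1 := by rw [Hm]; simp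
lemma Hm_pN (k : ℕ) : Hm k (pN K k) := by rw [Hm, Ed_pN, smul_V]; simp
lemma Hm_add {n : ℕ} {f g : V K} (hf : Hm n f) (hg : Hm n g) : Hm n (f + g) := by
  rw [Hm] at *; rw [map_add, hf, hg, smul_add]
lemma Hm_smul {n : ℕ} (c : K) {f : V K} (hf : Hm n f) : Hm n (c • f) := by
  rw [Hm] at *; rw [Derivation.map_smul, hf, smul_comm]
lemma Hm_sub {n : ℕ} {f g : V K} (hf : Hm n f) (hg : Hm n g) : Hm n (f - g) := by
  rw [Hm] at *; rw [map_sub, hf, hg, smul_sub]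
lemma Hm_zero (n : ℕ) : Hm (K := K) n 0 := by rw [Hm]; simp
lemma Hm_sum {ι} {n : ℕ} (s : Finset ι) (f : ι → V K) (h : ∀ i ∈ s, Hm n (f i)) : Hm n (∑ i ∈ s, f i) := by
  rw [Hm, map_sum, Finset.smul_sum]
  exact Finset.sum_congr rfl h
lemma Hm_pm (l : Multiset ℕ+) : Hm (S 0 (nu l)) (pm (K := K) l) := by
  induction l using Multiset.induction with
  | empty => rw [pm_zero]; simpa using Hm_one
  | cons s l ih => rw [pm_cons]; simpa using Hm_mul (Hm_pN (K := K) s) ih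
lemma toFinsupp_surj (m : ℕ+ →₀ ℕ) : ∃ l, Multiset.toFinsupp l = m := ⟨Finsupp.toMultiset m, by simp⟩
lemma coeff_Ed (m : ℕ+ →₀ ℕ) (f : V K) : MvPolynomial.coeff m (Ed f) = (wtN m : K) * MvPolynomial.coeff m f := by
  induction f using MvPolynomial.induction_on' with
  | add p q hp hq => simp only [map_add, MvPolynomial.coeff_add, hp, hq]; ring
  | monomial u c =>
    obtain ⟨l, rfl⟩ := toFinsupp_surj u
    rw [show MvPolynomial.monomial (Multiset.toFinsupp l) c = c • pm (K := K) l by simp [pm, MvPolynomial.smul_monomial], Hm_smul c (Hm_pm l), MvPolynomial.coeff_smul, MvPolynomial.coeff_smul, pm, MvPolynomial.coeff_monomial]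
    split_ifs with h
    · rw [← h, wtN_toFinsupp]; simp
    · simp
lemma Hm_iff (n : ℕ) (f : V K) : Hm n f ↔ ∀ m, wtN m ≠ n → MvPolynomial.coeff m f = 0 := by
  constructor
  · intro h m hm
    have h1 := coeff_Ed m f
    rw [h, MvPolynomial.coeff_smul, smul_eq_mul] at h1
    by_contra h2
    exact hm (by exact_mod_cast (mul_right_cancel₀ h2 h1).symm)
  · intro h
    rw [Hm]; ext m
    rw [coeff_Ed, MvPolynomial.coeff_smul, smul_eq_mul]
    by_cases hm : wtN m = n
    · rw [hm]
    · rw [h m hm]; simp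
lemma hl_Hm (a : K) {n m : ℕ} {f g : V K} (hf : Hm n f) (hg : Hm m g) (h : n ≠ m) : hl a f g = 0 := by
  have h1 := hl_Ed a f g
  rw [hf, hg, LinearMap.map_smul, LinearMap.smul_apply, LinearMap.map_smul, smul_eq_mul, smul_eq_mul] at h1
  by_contra h2
  exact h (by exact_mod_cast mul_right_cancel₀ h2 h1)
lemma Vd_zero : Vd (K := K) 0 = Ed := by
  apply MvPolynomial.derivation_ext
  intro j; rw [Vd_X, Ed_X, add_zero, pN_coe]
lemma Hm_gz (a : K) (ha : a ≠ 0) (n : ℕ) : Hm n (gz a n) := by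
  apply smul_right_injective (V K) ha
  show a • Ed (gz a n) = a • _
  rw [← Vd_zero, Vd_gz a ha 0 n n le_rfl, smul_smul]
  have := gz_rec a ha n n le_rfl
  rw [Int.cast_natCast] at this
  rw [this]; simp
lemma Hm_gm (a : K) (ha : a ≠ 0) (σ) : Hm (S 0 σ) (gm a σ) := by
  induction σ using Multiset.induction with
  | empty => simpa using Hm_one
  | cons s l ih => rw [gm_cons]; simpa using Hm_mul (Hm_gz a ha s) ih

def Wn (a : K) (n : ℕ) : Submodule K (V K) := Submodule.span K {f | ∃ σ, S 0 σ = n ∧ f = gm a σ}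
lemma Wn_mul (a : K) {n m : ℕ} {f g : V K} (hf : f ∈ Wn a n) (hg : g ∈ Wn a m) : f * g ∈ Wn a (n + m) := by
  have : f * g ∈ Wn a n * Wn a m := Submodule.mul_mem_mul hf hg
  rw [Wn, Wn, Submodule.span_mul_span] at this
  refine Submodule.span_mono ?_ this
  rintro x ⟨_, ⟨σ, h1, rfl⟩, _, ⟨τ, h2, rfl⟩, rfl⟩
  exact ⟨σ + τ, by rw [S_add, h1, h2], (gm_add a σ τ).symm⟩
lemma gz_Wn (a : K) (n : ℕ) : gz a n ∈ Wn a n := Submodule.subset_span ⟨{n}, by simp [S], by simp [gm, gz_nat]⟩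
lemma pN_Wn (a : K) (ha : a ≠ 0) (n : ℕ) : pN K n ∈ Wn a n := by
  induction n using Nat.strong_induction_on with
  | _ n ih =>
    cases n with
    | zero => rw [pN_zero]; exact zero_mem _
    | succ n =>
      have h := gz_rec a ha ((n+1:ℕ):ℤ) (n+1) le_rfl
      rw [Finset.sum_range_succ] at h
      rw [show ((n+1:ℕ):ℤ) - ((n:ℤ) + 1) = 0 by push_cast; ring, gz_zero, mul_one] at h
      rw [eq_sub_of_add_eq' h.symm]
      refine sub_mem (Submodule.smul_mem _ _ (gz_Wn a (n+1))) (sum_mem ?_)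
      intro k hk
      have hk : k < n := by simpa using hk
      have := Wn_mul a (ih (k+1) (by omega)) (gz_Wn a (n - k))
      rw [show k + 1 + (n - k) = n + 1 by omega] at this
      rwa [show ((n+1:ℕ):ℤ) - ((k:ℤ) + 1) = ((n - k : ℕ) : ℤ) by omega]
lemma pm_Wn (a : K) (ha : a ≠ 0) (l : Multiset ℕ+) : pm l ∈ Wn a (S 0 (nu l)) := by
  induction l using Multiset.induction with
  | empty => rw [pm_zero]; exact Submodule.subset_span ⟨0, by simp, by simp⟩
  | cons s l ih => rw [pm_cons, nu_cons, S_cons]; exact Wn_mul a (pN_Wn a ha s) ih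
abbrev PP (n : ℕ) : Type := {l : Multiset ℕ+ // S 0 (nu l) = n}
instance (n : ℕ) : Finite (PP n) := by
  apply Finite.of_injective (β := Nat.Partition n) (fun l => ⟨nu l.1, by
    intro i hi; obtain ⟨j, _, rfl⟩ := Multiset.mem_map.mp hi; exact j.pos, by
    have := l.2; simpa [S] using this⟩)
  intro l m h
  apply Subtype.ext; apply nu_inj
  exact congrArg Nat.Partition.parts h
instance (n : ℕ) : Fintype (PP n) := Fintype.ofFinite _
lemma Hm_expand {n : ℕ} {f : V K} (hf : Hm n f) : f = ∑ l : PP n, MvPolynomial.coeff (Multiset.toFinsupp l.1) f • pm l.1 := by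
  ext m
  obtain ⟨l, rfl⟩ := toFinsupp_surj m
  rw [MvPolynomial.coeff_sum]
  simp only [MvPolynomial.coeff_smul, pm, MvPolynomial.coeff_monomial]
  by_cases h : S 0 (nu l) = n
  · rw [Finset.sum_eq_single (⟨l, h⟩ : PP n)]
    · simp
    · intro b _ hb
      rw [if_neg]; simp
      intro h2; apply hb; apply Subtype.ext
      exact Multiset.toFinsupp.injective h2
    · simp
  · rw [(Hm_iff n f).mp hf _ (by rwa [wtN_toFinsupp]), Finset.sum_eq_zero]
    intro x _
    rw [if_neg]; simp
    intro h2
    apply h; rw [← Multiset.toFinsupp.injective h2]; exact x.2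
lemma Hm_Wn (a : K) (ha : a ≠ 0) {n : ℕ} {f : V K} (hf : Hm n f) : f ∈ Wn a n := by
  rw [Hm_expand hf]
  refine sum_mem fun l _ => Submodule.smul_mem _ _ ?_
  have := pm_Wn a ha l.1
  rwa [l.2] at this

/-- D on gm : triangular -/
lemma Dop_gm (a : K) (ha : a ≠ 0) (μ : Multiset ℕ) : Dop a (gm a μ) - ct a μ • gm a μ ∈ Submodule.span K {f | ∃ σ, mlt μ σ ∧ f = gm a σ} := by
  induction μ using ms_induct with
  | h0 =>
    rw [gm_zero, Dop_one, ct, nn_zero]; simp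
  | hc s μ hmax ih =>
    rw [gm_cons, Dop_gz a ha s (s + 1 + S 0 μ) (by push_cast; omega), ct_cons a s μ hmax, Hm_gm a ha μ]
    have hder : ∀ (N : ℕ) (hN : s < N) (ρ τ : Multiset ℕ) (hm : ∀ x ∈ ρ, x ≤ s ∧ x ≤ N), ∑ i ∈ Finset.range N, gz a ((s:ℤ) - i) * Vd i (gm a ρ) * gm a τ ∈
        Submodule.span K {f | ∃ σ, mlt (s ::ₘ (ρ + τ)) σ ∧ f = gm a σ} := by
      intro N hN ρ
      induction ρ using Multiset.induction with
      | empty => intro τ _; simp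
      | cons y ρ ih2 =>
        intro τ hm
        have e : ∀ i ∈ Finset.range N, gz a ((s:ℤ) - i) * Vd i (gm a (y ::ₘ ρ)) * gm a τ = gz a ((s:ℤ) - i) * Vd i (gz a y) * (gm a (ρ + τ)) + gz a ((s:ℤ) - i) * Vd i (gm a ρ) * gm a (y ::ₘ τ) := by
          intro i _
          rw [gm_cons, Derivation.leibniz, smul_eq_mul, smul_eq_mul, gm_add, gm_cons]; ring
        rw [Finset.sum_congr rfl e, Finset.sum_add_distrib]
        apply add_mem
        · rw [← Finset.sum_mul]
          have h1 := Hg0_mem a ha y N s (by omega) (by have := (hm y (Multiset.mem_cons_self _ _)).2; omega) (by omega)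
          rw [Hg0] at h1
          refine Submodule.span_induction (p := fun x _ => x * gm a (ρ + τ) ∈ Submodule.span K {f | ∃ σ, mlt (s ::ₘ (y ::ₘ ρ + τ)) σ ∧ f = gm a σ}) ?_ ?_ ?_ ?_ h1
          · rintro x ⟨i, hi1, hi2, rfl⟩
            apply Submodule.subset_span
            refine ⟨(s + i) ::ₘ (y - i) ::ₘ (ρ + τ), ?_, ?_⟩
            · rw [Multiset.cons_add]; exact mlt_raise s y i _ (hm y (Multiset.mem_cons_self _ _)).1 hi1 hi2
            · rw [gm_cons, gm_cons, Nat.cast_sub hi2]; push_cast; ring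
          · rw [zero_mul]; exact zero_mem _
          · intro x y _ _ hx hy; rw [add_mul]; exact add_mem hx hy
          · intro c x _ hx; rw [smul_mul_assoc]; exact Submodule.smul_mem _ _ hx
        · have := ih2 (y ::ₘ τ) (fun x hx => hm x (Multiset.mem_cons_of_mem hx))
          rwa [Multiset.add_cons, ← Multiset.cons_add] at this
    have h1 := hder (s + 1 + S 0 μ) (by omega) μ 0 (fun x hx => ⟨hmax x hx, by have := hmax x hx; omega⟩)
    simp only [gm_zero, mul_one, add_zero] at h1
    have h2 : gz a s * (Dop a (gm a μ) - ct a μ • gm a μ) ∈ Submodule.span K {f | ∃ σ, mlt (s ::ₘ μ) σ ∧ f = gm a σ} := by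
      refine Submodule.span_induction (p := fun x _ => gz a s * x ∈ Submodule.span K {f | ∃ σ, mlt (s ::ₘ μ) σ ∧ f = gm a σ}) ?_ ?_ ?_ ?_ ih
      · rintro x ⟨σ, hσ, rfl⟩
        exact Submodule.subset_span ⟨s ::ₘ σ, mlt_cons s hσ, (gm_cons a s σ).symm⟩
      · rw [mul_zero]; exact zero_mem _
      · intro x y _ _ hx hy; rw [mul_add]; exact add_mem hx hy
      · intro c x _ hx; rw [mul_smul_comm]; exact Submodule.smul_mem _ _ hx
    have h3 := add_mem h1 h2
    convert h3 using 1
    have e : (2⁻¹ * ((s:ℤ):K) * (((s:ℤ):K) - 1)) = ((s.choose 2 : ℕ) : K) := by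
      rw [Nat.cast_choose_two, Int.cast_natCast]; ring
    rw [e]
    simp only [smul_V, map_add, map_sub, map_mul, cV]
    ring
end part6
end Jk

namespace Jk
section part7
variable {K : Type} [Field K] [CharZero K]

structure JK (a : K) (J : Multiset ℕ+ → V K) : Prop where
  ha : a ≠ 0
  tr : ∀ x y : ℤ, a * x = y → x = 0 ∧ y = 0
  aniso : ∀ f, hl a f f = 0 → f = 0
  orth : ∀ l m, l ≠ m → hl a (J l) (J m) = 0
  tri : ∀ l (σ : Multiset ℕ), hl a (J l) (gm a σ) ≠ 0 → mle σ (nu l)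
  norm : ∀ l, MvPolynomial.coeff (Finsupp.single 1 (S 0 (nu l))) (J l) = 1

variable {a : K} {J : Multiset ℕ+ → V K}

lemma hl_pm (a : K) (l) (f : V K) : hl a (pm l) f = zl a (Multiset.toFinsupp l) * MvPolynomial.coeff (Multiset.toFinsupp l) f := by
  rw [pm, hl_monomial]

lemma hl_span_zero (a : K) (f : V K) (s : Set (V K)) (h : ∀ g ∈ s, hl a f g = 0) {x : V K} (hx : x ∈ Submodule.span K s) : hl a f x = 0 := by
  refine Submodule.span_induction (p := fun x _ => hl a f x = 0) ?_ ?_ ?_ ?_ hx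
  · exact h
  · simp
  · intro x y _ _ h1 h2; rw [map_add, h1, h2, add_zero]
  · intro c x _ h1; rw [map_smul, h1, smul_zero]

lemma JK.Hm (h : JK a J) (l) : Hm (S 0 (nu l)) (J l) := by
  rw [Hm_iff]
  intro m hm
  obtain ⟨l', rfl⟩ := toFinsupp_surj m
  rw [wtN_toFinsupp] at hm
  have h1 : hl a (J l) (pm l') = 0 := by
    refine hl_span_zero a (J l) _ ?_ (pm_Wn a h.ha l')
    rintro g ⟨σ, h2, rfl⟩
    by_contra h3
    exact hm (h2 ▸ (h.tri l σ h3).1)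
  rw [hl_comm, hl_pm] at h1
  exact (mul_eq_zero.mp h1).resolve_left (zl_ne a h.ha _)
lemma JK.ne (h : JK a J) (l) : J l ≠ 0 := by
  intro h0; have := h.norm l; rw [h0] at this; simp at this
lemma JK.sq (h : JK a J) (l) : hl a (J l) (J l) ≠ 0 := fun h0 => h.ne l (h.aniso _ h0)

lemma JK.hl_sum (h : JK a J) {n : ℕ} (c : PP n → K) (l : PP n) : hl a (J l.1) (∑ m, c m • J m.1) = c l * hl a (J l.1) (J l.1) := by
  rw [map_sum, Finset.sum_eq_single l]
  · rw [map_smul, smul_eq_mul]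
  · intro b _ hb
    rw [map_smul, h.orth _ _ (fun h2 => hb (Subtype.ext h2.symm)), smul_zero]
  · simp

lemma JK.pm_mem (h : JK a J) (l) : pm l ∈ Submodule.span K (Set.range J) := by
  obtain ⟨n, hn⟩ : ∃ n, S 0 (nu l) = n := ⟨_, rfl⟩
  let T : (PP n → K) →ₗ[K] (PP n → K) :=
    { toFun := fun c m => MvPolynomial.coeff (Multiset.toFinsupp m.1) (∑ l, c l • J l.1)
      map_add' := by
        intro x y; funext m
        simp only [Pi.add_apply, add_smul, Finset.sum_add_distrib, MvPolynomial.coeff_add]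
      map_smul' := by
        intro x y; funext m
        simp only [Pi.smul_apply, smul_assoc, ← Finset.smul_sum, MvPolynomial.coeff_smul, RingHom.id_apply] }
  have hH : ∀ c : PP n → K, Jk.Hm n (∑ l, c l • J l.1) := fun c =>
    Hm_sum _ _ (fun l _ => Hm_smul _ (by have := h.Hm l.1; rwa [l.2] at this))
  have hT : Function.Injective T := by
    rw [← LinearMap.ker_eq_bot, LinearMap.ker_eq_bot']
    intro c hc
    have h0 : ∑ l, c l • J l.1 = 0 := by
      rw [Hm_expand (hH c)]
      refine Finset.sum_eq_zero fun m _ => ?_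
      have : T c m = 0 := by rw [hc]; rfl
      change MvPolynomial.coeff (Multiset.toFinsupp m.1) (∑ l, c l • J l.1) = 0 at this
      rw [this, zero_smul]
    funext l
    have h1 := h.hl_sum c l
    rw [h0, map_zero] at h1
    exact (mul_eq_zero.mp h1.symm).resolve_right (h.sq _)
  have hS := LinearMap.injective_iff_surjective.mp hT
  obtain ⟨c, hc⟩ := hS (fun m => if m.1 = l then 1 else 0)
  have : pm l = ∑ l, c l • J l.1 := by
    rw [Hm_expand (hH c)]
    rw [Finset.sum_eq_single (⟨l, hn⟩ : PP n)]
    · have := congrFun hc ⟨l, hn⟩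
      change MvPolynomial.coeff (Multiset.toFinsupp l) (∑ l, c l • J l.1) = _ at this
      rw [this]; simp
    · intro b _ hb
      have := congrFun hc b
      change MvPolynomial.coeff (Multiset.toFinsupp b.1) (∑ l, c l • J l.1) = _ at this
      rw [this, if_neg (fun h2 => hb (Subtype.ext h2)), zero_smul]
    · simp
  rw [this]
  exact sum_mem fun l _ => Submodule.smul_mem _ _ (Submodule.subset_span ⟨_, rfl⟩)
lemma JK.span (h : JK a J) (f : V K) : f ∈ Submodule.span K (Set.range J) := by
  induction f using MvPolynomial.induction_on' with
  | add p q hp hq => exact add_mem hp hq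
  | monomial u c =>
    obtain ⟨l, rfl⟩ := toFinsupp_surj u
    rw [show MvPolynomial.monomial (Multiset.toFinsupp l) c = c • pm (K := K) l by simp [pm, MvPolynomial.smul_monomial]]
    exact Submodule.smul_mem _ _ (h.pm_mem l)
lemma JK.ext0 (h : JK a J) {f : V K} (hf : ∀ l, hl a f (J l) = 0) : f = 0 := by
  apply hl_nondeg a h.ha
  intro g
  rw [hl_comm]
  refine hl_span_zero a f _ ?_ (h.span g)
  rintro _ ⟨l, rfl⟩; exact hf l
lemma JK.ext (h : JK a J) {f g : V K} (hf : ∀ l, hl a f (J l) = hl a g (J l)) : f = g := by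
  rw [← sub_eq_zero]; apply h.ext0; intro l; rw [map_sub, LinearMap.sub_apply, hf, sub_self]
lemma JK.expand (h : JK a J) {n : ℕ} {f : V K} (hf : Jk.Hm n f) : f = ∑ l : PP n, (hl a f (J l.1) / hl a (J l.1) (J l.1)) • J l.1 := by
  apply h.ext
  intro m
  by_cases hm : S 0 (nu m) = n
  · rw [hl_comm a (∑ l : PP n, _), h.hl_sum (fun l : PP n => hl a f (J l.1) / hl a (J l.1) (J l.1)) ⟨m, hm⟩]
    exact (div_mul_cancel₀ _ (h.sq m)).symm
  · rw [hl_Hm a hf (h.Hm m) (fun h2 => hm h2.symm), hl_Hm a (Hm_sum _ _ (fun l _ => Hm_smul _ (by have := h.Hm l.1; rwa [l.2] at this))) (h.Hm m) (fun h2 => hm h2.symm)]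

/-- L5 -/
lemma JK.mem (h : JK a J) (l) : J l ∈ Submodule.span K {f | ∃ σ : Multiset ℕ+, mle (nu l) (nu σ) ∧ f = gm a (nu σ)} := by
  obtain ⟨n, hn⟩ : ∃ n, S 0 (nu l) = n := ⟨_, rfl⟩
  let Φ : (PP n → K) →ₗ[K] (PP n → K) :=
    { toFun := fun c m => hl a (J m.1) (∑ l, c l • gm a (nu l.1))
      map_add' := by
        intro x y; funext m
        simp only [Pi.add_apply, add_smul, Finset.sum_add_distrib, map_add]
      map_smul' := by
        intro x y; funext m
        simp only [Pi.smul_apply, smul_assoc, ← Finset.smul_sum, map_smul, RingHom.id_apply] }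
  have hΦ : Function.Injective Φ := by
    rw [LinearMap.injective_iff_surjective, ← LinearMap.range_eq_top, eq_top_iff]
    intro d _
    have hrep : ∀ m : PP n, ∃ c : PP n → K, J m.1 = ∑ l, c l • gm a (nu l.1) := by
      intro m
      have h1 : J m.1 ∈ Wn a n := Hm_Wn a h.ha (by have := h.Hm m.1; rwa [m.2] at this)
      have h2 : J m.1 ∈ Submodule.span K (Set.range (fun l : PP n => gm a (nu l.1))) := by
        refine Submodule.span_mono ?_ h1
        rintro _ ⟨σ, h3, rfl⟩
        obtain ⟨l', h4, h5⟩ := gm_strip a σ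
        exact ⟨⟨l', by rw [h4, h3]⟩, h5.symm⟩
      obtain ⟨c, hc⟩ := (Submodule.mem_span_range_iff_exists_fun K).mp h2
      exact ⟨c, hc.symm⟩
    choose c hc using hrep
    refine ⟨∑ m, (d m / hl a (J m.1) (J m.1)) • c m, ?_⟩
    have e : ∀ m m', Φ (c m) m' = if m' = m then hl a (J m.1) (J m.1) else 0 := by
      intro m m'
      change hl a (J m'.1) (∑ l, c m l • gm a (nu l.1)) = _
      rw [← hc]
      split_ifs with h2
      · rw [h2]
      · exact h.orth _ _ (fun h3 => h2 (Subtype.ext h3))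
    rw [map_sum]
    funext m'
    rw [Finset.sum_apply, Finset.sum_eq_single m']
    · rw [map_smul, Pi.smul_apply, e, if_pos rfl, smul_eq_mul, div_mul_cancel₀ _ (h.sq _)]
    · intro b _ hb
      rw [map_smul, Pi.smul_apply, e, if_neg hb.symm, smul_zero]
    · simp
  let I := {σ : PP n // mle (nu l) (nu σ.1)}
  have hz : ∀ (κ σ : PP n), mle (nu l) (nu σ.1) → ¬ mle (nu l) (nu κ.1) → hl a (J κ.1) (gm a (nu σ.1)) = 0 := by
    intro κ σ h1 h2
    by_contra h3
    exact h2 (mle_trans h1 (h.tri _ _ h3))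
  let Ψ : (I → K) →ₗ[K] (I → K) :=
    { toFun := fun c m => hl a (J m.1.1) (∑ l, c l • gm a (nu l.1.1))
      map_add' := by
        intro x y; funext m
        simp only [Pi.add_apply, add_smul, Finset.sum_add_distrib, map_add]
      map_smul' := by
        intro x y; funext m
        simp only [Pi.smul_apply, smul_assoc, ← Finset.smul_sum, map_smul, RingHom.id_apply] }
  have hsum : ∀ c : I → K, ∑ σ : PP n, (if hσ : mle (nu l) (nu σ.1) then c ⟨σ, hσ⟩ else 0) • gm a (nu σ.1) = ∑ σ : I, c σ • gm a (nu σ.1.1) := by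
    intro c
    symm
    refine Finset.sum_of_injOn (fun σ : I => σ.1) (Subtype.val_injective.injOn) (by simp) ?_ ?_
    · intro σ _ hσ
      rw [dif_neg, zero_smul]
      intro h2; exact hσ ⟨⟨σ, h2⟩, by simp, rfl⟩
    · intro σ _
      rw [dif_pos σ.2]
  have hΨ : Function.Injective Ψ := by
    rw [← LinearMap.ker_eq_bot, LinearMap.ker_eq_bot']
    intro c hc
    have h0 : Φ (fun σ => if hσ : mle (nu l) (nu σ.1) then c ⟨σ, hσ⟩ else 0) = Φ 0 := by
      rw [map_zero]
      funext κ
      change hl a (J κ.1) (∑ σ : PP n, (if hσ : mle (nu l) (nu σ.1) then c ⟨σ, hσ⟩ else 0) • gm a (nu σ.1)) = 0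
      rw [hsum]
      by_cases hκ : mle (nu l) (nu κ.1)
      · exact congrFun hc ⟨κ, hκ⟩
      · rw [map_sum]
        exact Finset.sum_eq_zero fun σ _ => by rw [map_smul, hz κ σ.1 σ.2 hκ, smul_zero]
    have h1 := hΦ h0
    funext σ
    have h2 := congrFun h1 σ.1
    simpa [σ.2] using h2
  obtain ⟨c, hc⟩ := LinearMap.injective_iff_surjective.mp hΨ (fun m => hl a (J l) (J m.1.1))
  have : J l = ∑ σ : I, c σ • gm a (nu σ.1.1) := by
    apply h.ext
    intro κ
    have hH : Jk.Hm n (∑ σ : I, c σ • gm a (nu σ.1.1)) := Hm_sum _ _ fun σ _ => Hm_smul _ (by have := Hm_gm a h.ha (nu σ.1.1); rwa [σ.1.2] at this)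
    by_cases hκ : S 0 (nu κ) = n
    · rw [hl_comm a (∑ σ : I, _)]
      by_cases hκ2 : mle (nu l) (nu κ)
      · exact (congrFun hc ⟨⟨κ, hκ⟩, hκ2⟩).symm
      · rw [h.orth _ _ (fun h2 : l = κ => hκ2 (by rw [← h2]; exact mle_refl _)), map_sum]
        exact (Finset.sum_eq_zero fun σ _ => by rw [map_smul, hz ⟨κ, hκ⟩ σ.1 σ.2 hκ2, smul_zero]).symm
    · rw [hl_Hm a hH (h.Hm κ) (fun h2 => hκ h2.symm), hl_Hm a (h.Hm l) (h.Hm κ) (fun h2 => hκ (by rw [← h2, hn]))]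
  rw [this]
  exact sum_mem fun σ _ => Submodule.smul_mem _ _ (Submodule.subset_span ⟨_, σ.2, rfl⟩)

lemma JK.supp (h : JK a J) {f : V K} {κ} (hf : hl a f (J κ) ≠ 0) : ∃ σ : Multiset ℕ+, mle (nu κ) (nu σ) ∧ hl a f (gm a (nu σ)) ≠ 0 := by
  by_contra h0
  push Not at h0
  apply hf
  refine hl_span_zero a f _ ?_ (h.mem κ)
  rintro _ ⟨σ, h1, rfl⟩
  exact h0 σ h1

lemma JK.diag (h : JK a J) (l) : hl a (J l) (gm a (nu l)) ≠ 0 := by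
  obtain ⟨σ, h1, h2⟩ := h.supp (h.sq l)
  rwa [← mle_antisymm h1 (h.tri _ _ h2)] at h2

lemma JK.Dop (h : JK a J) (l) : Dop a (J l) = ct a (nu l) • J l := by
  have h1 : ∀ l κ, hl a (Jk.Dop a (J l)) (J κ) ≠ 0 → mle (nu κ) (nu l) := by
    intro l κ h2
    obtain ⟨σ, h3, h4⟩ := h.supp h2
    rw [hl_Dop] at h4
    refine mle_trans h3 ?_
    by_contra h5
    apply h4
    have h6 := Dop_gm a h.ha (nu σ)
    have h7 : hl a (J l) (Jk.Dop a (gm a (nu σ)) - ct a (nu σ) • gm a (nu σ)) = 0 := by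
      refine hl_span_zero a _ _ ?_ h6
      rintro _ ⟨τ, h8, rfl⟩
      by_contra h9
      exact h5 (mle_trans h8.1 (h.tri _ _ h9))
    have h8 : hl a (J l) (gm a (nu σ)) = 0 := by
      by_contra h9; exact h5 (h.tri _ _ h9)
    rw [map_sub, map_smul, h8, smul_zero, sub_zero] at h7
    exact h7
  obtain ⟨e, he⟩ : ∃ e : K, Jk.Dop a (J l) = e • J l := by
    refine ⟨hl a (Jk.Dop a (J l)) (J l) / hl a (J l) (J l), ?_⟩
    apply h.ext
    intro κ
    rw [LinearMap.map_smul, LinearMap.smul_apply, smul_eq_mul]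
    by_cases hκ : l = κ
    · rw [← hκ, div_mul_cancel₀ _ (h.sq l)]
    · rw [h.orth _ _ hκ, mul_zero]
      by_contra h2
      have h3 := h1 _ _ h2
      rw [hl_Dop, hl_comm] at h2
      exact hκ (mle_antisymm (h1 _ _ h2) h3)
  have h2 : hl a (Jk.Dop a (J l)) (gm a (nu l)) = ct a (nu l) * hl a (J l) (gm a (nu l)) := by
    rw [hl_Dop]
    have h7 : hl a (J l) (Jk.Dop a (gm a (nu l)) - ct a (nu l) • gm a (nu l)) = 0 := by
      refine hl_span_zero a _ _ ?_ (Dop_gm a h.ha (nu l))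
      rintro _ ⟨τ, h8, rfl⟩
      by_contra h9
      exact mlt_not h8 (h.tri _ _ h9)
    rwa [map_sub, map_smul, sub_eq_zero, smul_eq_mul] at h7
  rw [he, LinearMap.map_smul, LinearMap.smul_apply, smul_eq_mul] at h2
  rw [he, mul_right_cancel₀ (h.diag l) h2]

lemma JK.ct_inj (h : JK a J) {l m : Multiset ℕ} (c d : ℤ) (he : ct a l = ct a m + a * c + d) : (npp l : ℤ) = npp m + c := by
  have := (h.tr (npp l - npp m - c) (nn l - nn m + d) (by
    rw [ct, ct] at he; push_cast; linear_combination he)).1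
  omega

lemma JK.Tn_gt (h : JK a J) (κ : Multiset ℕ+) (n : ℤ) (hn : ∀ x ∈ κ, ((x:ℕ):ℤ) < n) (hn0 : 0 < n) : Tn n (J κ) = 0 := by
  lift n to ℕ using hn0.le
  apply h.ext0
  intro l
  by_contra h0
  obtain ⟨σ, h1, h2⟩ := h.supp h0
  rw [← hl_gz a h.ha, ← gm_cons] at h2
  have h3 := (h.tri _ _ h2).2 (n - 1)
  rw [S_cons, S_zero_max (n-1) (nu κ)] at h3
  · omega
  · intro x hx
    obtain ⟨y, hy, rfl⟩ := Multiset.mem_map.mp hx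
    have := hn y hy; omega

lemma mle_cancel {s : ℕ} {l m : Multiset ℕ} (h : mle (s ::ₘ l) (s ::ₘ m)) : mle l m := by
  refine ⟨by simpa using h.1, fun t => by simpa using h.2 t⟩
lemma nu_max {s : ℕ+} {l : Multiset ℕ+} (h : ∀ x ∈ l, x ≤ s) : ∀ x ∈ nu l, x ≤ (s:ℕ) := by
  intro x hx
  obtain ⟨y, hy, rfl⟩ := Multiset.mem_map.mp hx
  exact h y hy

lemma JK.strip (h : JK a J) (s : ℕ+) (l : Multiset ℕ+) (hs : ∀ x ∈ l, x ≤ s) : ∃ γ : K, γ ≠ 0 ∧ Tn (s:ℕ) (J (s ::ₘ l)) = γ • J l := by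
  set f := Tn (K := K) (s:ℕ) (J (s ::ₘ l)) with hf
  have hgt : ∀ m : ℤ, (((s:ℕ+):ℕ):ℤ) < m → Tn m (J (s ::ₘ l)) = 0 := by
    intro m hm
    apply h.Tn_gt
    · intro x hx
      rcases Multiset.mem_cons.mp hx with rfl | hx
      · exact hm
      · have : (x:ℕ) ≤ s := hs x hx
        omega
    · omega
  have hD : Jk.Dop a f = (ct a (nu l) - S 0 (nu l)) • f + Ed f := by
    have h1 := Tn_Dop a h.ha (J (s ::ₘ l)) (s:ℕ) ((s:ℕ)+1) (by push_cast; omega)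
    rw [strip0 a h.ha s _ hgt, h.Dop, map_smul, nu_cons, ct_cons a _ _ (nu_max hs), ← hf, Nat.cast_choose_two] at h1
    simp only [smul_V, Int.cast_natCast] at h1 ⊢
    have e : cV (a * (((s:ℕ):K) * (((s:ℕ):K) - 1) / 2) - (S 0 (nu l) : K) + ct a (nu l)) = cV (a * (2⁻¹ * ((s:ℕ):K) * (((s:ℕ):K) - 1))) + cV (ct a (nu l) - (S 0 (nu l) : K)) := by
      rw [cV, cV, cV, ← map_add]; congr 1; ring
    rw [e] at h1
    linear_combination -h1
  have h1 : ∀ ν, hl a f (J ν) ≠ 0 → ν = l := by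
    intro ν h2
    obtain ⟨σ, h3, h4⟩ := h.supp h2
    rw [hf, ← hl_gz a h.ha, ← gm_cons] at h4
    have h5 := h.tri _ _ h4
    rw [nu_cons] at h5
    have h6 := mle_trans h3 (mle_cancel h5)
    apply npp_strict' h6
    have h7 : hl a (Jk.Dop a f) (J ν) = ct a (nu ν) * hl a f (J ν) := by
      rw [hl_Dop, h.Dop, map_smul, smul_eq_mul]
    have h8 : hl a (Ed f) (J ν) = S 0 (nu ν) * hl a f (J ν) := by
      rw [hl_Ed, h.Hm, map_smul, smul_eq_mul]
    rw [hD, map_add, LinearMap.add_apply, h8, LinearMap.map_smul, LinearMap.smul_apply, smul_eq_mul, ← add_mul, h6.1] at h7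
    have h9 := mul_right_cancel₀ h2 h7
    have := h.ct_inj (l := nu ν) (m := nu l) 0 0 (by push_cast; linear_combination -h9)
    omega
  refine ⟨hl a f (J l) / hl a (J l) (J l), ?_, ?_⟩
  · have h2 : hl a f (gm a (nu l)) ≠ 0 := by
      rw [hf, ← hl_gz a h.ha, ← gm_cons, ← nu_cons]; exact h.diag _
    intro h3
    apply h2
    have h4 : hl a f (J l) = 0 := by
      rcases div_eq_zero_iff.mp h3 with h5 | h5
      · exact h5
      · exact absurd h5 (h.sq l)
    have : f = 0 := by
      apply h.ext0
      intro ν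
      by_contra h5
      rw [h1 ν h5] at h5; exact h5 h4
    rw [this]; simp
  · apply h.ext
    intro ν
    rw [LinearMap.map_smul, LinearMap.smul_apply, smul_eq_mul]
    by_cases hν : l = ν
    · rw [← hν, div_mul_cancel₀ _ (h.sq l)]
    · rw [h.orth _ _ hν, mul_zero]
      by_contra h5
      exact hν (h1 ν h5).symm
end part7
end Jk

namespace Jk
section part8
variable {K : Type} [Field K] [CharZero K]
variable {a : K} {J : Multiset ℕ+ → V K}

lemma JK.top (h : JK a J) (m : ℕ+) (l : Multiset ℕ+) (hm : ∀ x ∈ l, x ≤ m) : ∃ γ : K, γ ≠ 0 ∧ ∀ (f : V K) (n : ℕ), Jk.Hm n f →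
    (∀ κ, hl a f (J κ) ≠ 0 → ∀ x ∈ κ, x ≤ m) → hl a (Tn (m:ℕ) f) (J l) = γ * hl a f (J (m ::ₘ l)) := by
  obtain ⟨γ, hγ, hT⟩ := h.strip m l hm
  refine ⟨γ * hl a (J l) (J l) / hl a (J (m ::ₘ l)) (J (m ::ₘ l)), div_ne_zero (mul_ne_zero hγ (h.sq l)) (h.sq _), ?_⟩
  intro f n hf hs
  have e : Tn (m:ℕ) f = ∑ κ : PP n, (hl a f (J κ.1) / hl a (J κ.1) (J κ.1)) • Tn (m:ℕ) (J κ.1) := by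
    conv_lhs => rw [h.expand hf]
    simp only [map_sum, map_smul]
  have hz : ∀ κ : PP n, κ.1 ≠ m ::ₘ l → hl a ((hl a f (J κ.1) / hl a (J κ.1) (J κ.1)) • Tn (m:ℕ) (J κ.1)) (J l) = 0 := by
    intro κ hκ
    rw [LinearMap.map_smul, LinearMap.smul_apply]
    by_cases h0 : hl a f (J κ.1) = 0
    · rw [h0, zero_div, zero_smul]
    have h1 := hs _ h0
    by_cases h2 : m ∈ κ.1
    · obtain ⟨ρ, hρ⟩ := Multiset.exists_cons_of_mem h2
      have h3 : ∀ x ∈ ρ, x ≤ m := fun x hx => h1 x (by rw [hρ]; exact Multiset.mem_cons_of_mem hx)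
      obtain ⟨γ', _, hT'⟩ := h.strip m ρ h3
      rw [hρ, hT', LinearMap.map_smul, LinearMap.smul_apply, h.orth ρ l, smul_zero, smul_zero]
      rintro rfl; exact hκ hρ
    · rw [h.Tn_gt κ.1]
      · simp
      · intro x hx
        have h3 : x < m := lt_of_le_of_ne (h1 x hx) (by rintro rfl; exact h2 hx)
        have : (x:ℕ) < m := h3
        omega
      · have := m.pos; omega
  rw [e, map_sum, LinearMap.sum_apply]
  by_cases hn : S 0 (nu (m ::ₘ l)) = n
  · rw [Finset.sum_eq_single (⟨m ::ₘ l, hn⟩ : PP n)]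
    · show hl a ((hl a f (J (m ::ₘ l)) / hl a (J (m ::ₘ l)) (J (m ::ₘ l))) • Tn (m:ℕ) (J (m ::ₘ l))) (J l) = _
      rw [hT, LinearMap.map_smul, LinearMap.smul_apply, LinearMap.map_smul, LinearMap.smul_apply, smul_eq_mul, smul_eq_mul]
      ring
    · intro κ _ hκ
      exact hz κ (fun h2 => hκ (Subtype.ext h2))
    · simp
  · rw [hl_Hm a hf (h.Hm _) (fun h2 => hn h2.symm), mul_zero]
    refine Finset.sum_eq_zero fun κ _ => hz κ ?_
    intro h2; exact hn (by rw [← h2]; exact κ.2)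

lemma pd_gm (a : K) (ha : a ≠ 0) (σ : Multiset ℕ) : a • pd 1 (gm a σ) ∈ Submodule.span K {f | ∃ x ρ, σ = x ::ₘ ρ ∧ 1 ≤ x ∧ f = gm a ((x-1) ::ₘ ρ)} := by
  induction σ using Multiset.induction with
  | empty => simp
  | cons s σ ih =>
    rw [gm_cons, Derivation.leibniz, smul_add, smul_eq_mul, smul_eq_mul, ← mul_smul_comm, ← mul_smul_comm]
    apply add_mem
    · refine Submodule.span_induction (p := fun x _ => gz a s * x ∈ Submodule.span K {f | ∃ x ρ, s ::ₘ σ = x ::ₘ ρ ∧ 1 ≤ x ∧ f = gm a ((x-1) ::ₘ ρ)}) ?_ ?_ ?_ ?_ ih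
      · rintro _ ⟨x, ρ, rfl, hx, rfl⟩
        exact Submodule.subset_span ⟨x, s ::ₘ ρ, Multiset.cons_swap _ _ _, hx, by rw [Multiset.cons_swap, gm_cons a s]⟩
      · simp
      · intro x y _ _ hx hy; rw [mul_add]; exact add_mem hx hy
      · intro c x _ hx; rw [mul_smul_comm]; exact Submodule.smul_mem _ _ hx
    · have := pd_gz a ha 1 one_pos s
      rw [Nat.cast_one, mul_one] at this
      rw [this]
      rcases Nat.eq_zero_or_pos s with rfl | hs
      · rw [gz_neg _ _ (by simp), mul_zero]; exact zero_mem _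
      · apply Submodule.subset_span
        refine ⟨s, σ, rfl, hs, ?_⟩
        rw [gm_cons, mul_comm, Nat.cast_sub hs]

lemma JK.deg1 (h : JK a J) {l κ} (hne : hl a (pN K 1 * J l) (J κ) ≠ 0) : S 0 (nu κ) = S 0 (nu l) + 1 := by
  by_contra h0
  exact hne (hl_Hm a (Hm_mul (Hm_pN 1) (h.Hm l)) (h.Hm κ) (by omega))
lemma JK.low (h : JK a J) {l κ} (hne : hl a (pN K 1 * J l) (J κ) ≠ 0) : mle (1 ::ₘ nu l) (nu κ) := by
  by_contra h0
  apply hne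
  have hp : pN K 1 = a • gz a 1 := by
    have := gz_rec a h.ha 1 1 le_rfl
    simpa [gz_zero] using this.symm
  rw [hp, smul_mul_assoc, LinearMap.map_smul, LinearMap.smul_apply, hl_comm]
  have h1 : hl a (J κ) (gz a 1 * J l) = 0 := by
    rw [hl_gz a h.ha]
    refine hl_span_zero a _ _ ?_ (h.mem l)
    rintro _ ⟨σ, h2, rfl⟩
    have := hl_gz a h.ha (J κ) 1 (gm a (nu σ))
    rw [← this]
    by_contra h3
    have h4 := gm_cons a 1 (nu σ)
    rw [Nat.cast_one] at h4
    rw [← h4] at h3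
    exact h0 (mle_trans (mle_cons 1 h2) (h.tri _ _ h3))
  rw [h1, smul_zero]
lemma JK.up (h : JK a J) {l κ} (hne : hl a (pN K 1 * J l) (J κ) ≠ 0) (s : ℕ) (hs : ∀ x ∈ nu l, x ≤ s) (t : ℕ) : S t (nu κ) ≤ S t (nu l) + if t ≤ s then 1 else 0 := by
  obtain ⟨σ, h1, h2⟩ := h.supp hne
  rw [hl_pN, Nat.cast_one, mul_one] at h2
  by_contra h0
  apply h2
  refine hl_span_zero a _ _ ?_ (pd_gm a h.ha (nu σ))
  rintro _ ⟨x, ρ, h3, h4, rfl⟩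
  by_contra h5
  have h6 := h.tri _ _ h5
  have h7 := h6.2 t
  have h8 := h1.2 t
  have h9 := h6.2 s
  rw [h3] at h8
  rw [S_zero_max s _ hs] at h9
  simp only [S_cons] at h7 h8 h9
  split_ifs at h0 <;> omega
lemma JK.hlVd (h : JK a J) (l κ) : a * hl a (Vd 1 (J l)) (J κ) = (ct a (nu κ) - ct a (nu l)) * hl a (pN K 1 * J l) (J κ) := by
  have h1 := congrArg (fun f => hl a f (J κ)) (Dop_p1 a h.ha (J l))
  simp only [map_add, LinearMap.add_apply] at h1
  rw [hl_Dop, h.Dop, h.Dop, mul_smul_comm, map_smul, LinearMap.map_smul, LinearMap.smul_apply, LinearMap.map_smul, LinearMap.smul_apply] at h1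
  simp only [smul_eq_mul] at h1
  linear_combination -h1

lemma Hm_Vd (n k : ℕ) {f : V K} (hf : Hm n f) : Hm (n + k) (Vd k f) := by
  rw [Hm, Ed_Vd, hf, Derivation.map_smul, smul_V, smul_V]; push_cast; simp only [cV, map_add, map_natCast]; ring

lemma JK.pieri (h : JK a J) (l : Multiset ℕ+) : ∀ κ, hl a (pN K 1 * J l) (J κ) ≠ 0 → ∃ j, addbox l κ j := by
  induction l using ms_induct' with
  | h0 =>
    intro κ hne
    have h1 := h.deg1 hne
    rw [nu_zero, S_zero] at h1
    refine ⟨0, fun i => ?_⟩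
    rw [nu_zero, hh_zero]
    cases i with
    | zero =>
      have := S_succ 0 (nu κ)
      have h2 := S_zero_of 1 (nu κ) (by omega)
      simp only [zero_add] at this
      simp; omega
    | succ i => rw [hh_zero_of (i+1) _ (by omega)]; simp
  | hc s l hs ih =>
    have hs' := nu_max hs
    have hsl : ∀ x ∈ nu (s ::ₘ l), x ≤ (s:ℕ) := by
      rw [nu_cons]; intro x hx
      rcases Multiset.mem_cons.mp hx with rfl | hx
      · exact le_rfl
      · exact hs' x hx
    obtain ⟨γ, hγ, hT⟩ := h.strip s l hs
    have hTgt : ∀ n : ℤ, ((s:ℕ):ℤ) < n → Tn n (J (s ::ₘ l)) = 0 := by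
      intro n hn
      apply h.Tn_gt
      · intro x hx
        have := hsl x (Multiset.mem_map_of_mem _ hx)
        omega
      · omega
    have hpos := s.pos
    have hHm := h.Hm (s ::ₘ l)
    have hle : ∀ κ, hl a (pN K 1 * J (s ::ₘ l)) (J κ) ≠ 0 → ∀ x ∈ κ, x ≤ s + 1 := by
      intro κ hne x hx
      have h1 := h.up hne s hsl (s+1)
      rw [S_zero_max (s+1) _ (fun x hx => (hsl x hx).trans (Nat.le_succ _)), if_neg (by omega)] at h1
      have h2 := max_of_S _ _ (Nat.le_zero.mp h1) x (Multiset.mem_map_of_mem _ hx)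
      rw [← PNat.coe_le_coe]; simpa using h2
    have hC1 : ∀ κ, hl a (pN K 1 * J (s ::ₘ l)) (J κ) ≠ 0 → κ = (s+1) ::ₘ l ∨ ∀ x ∈ κ, x ≤ s := by
      intro κ hne
      by_cases hmem : (s+1) ∈ κ
      · left
        obtain ⟨ν, rfl⟩ := Multiset.exists_cons_of_mem hmem
        obtain ⟨γ', hγ', htop⟩ := h.top (s+1) ν (fun x hx => hle _ hne x (Multiset.mem_cons_of_mem hx))
        have h1 := htop (pN K 1 * J (s ::ₘ l)) _ (Hm_mul (Hm_pN 1) hHm) hle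
        rw [Tn_mul _ 1 one_pos, hTgt _ (by simp)] at h1
        rw [show (((s+1:ℕ+):ℕ):ℤ) - ((1:ℕ):ℤ) = ((s:ℕ):ℤ) by simp, hT, mul_zero, zero_add, LinearMap.map_smul, LinearMap.smul_apply] at h1
        by_contra h2
        rw [h.orth l ν (by rintro rfl; exact h2 rfl), smul_zero] at h1
        exact mul_ne_zero hγ' hne h1.symm
      · right
        intro x hx
        have h1 := hle κ hne x hx
        have h2 : x ≠ s + 1 := by rintro rfl; exact hmem hx
        exact PNat.lt_add_one_iff.mp (lt_of_le_of_ne h1 h2)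
    have hctp : ct a (nu ((s+1) ::ₘ l)) = ct a (nu (s ::ₘ l)) + a * (s:ℕ) := by
      rw [nu_cons, nu_cons, ct_cons _ _ _ hs', ct_cons, PNat.add_coe, PNat.one_coe, Nat.cast_choose_two, Nat.cast_choose_two]
      · push_cast; ring
      · intro x hx; have := hs' x hx; simp; omega
    intro κ hne
    rcases hC1 κ hne with rfl | hκ
    · refine ⟨s, fun i => ?_⟩
      rw [nu_cons, nu_cons, hh_cons, hh_cons, PNat.add_coe, PNat.one_coe]
      split_ifs <;> omega
    by_cases hκp : κ = (s+1) ::ₘ l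
    · have h1 := hκ (s+1) (by rw [hκp]; exact Multiset.mem_cons_self _ _)
      have h2 : ((s + 1 : ℕ+) : ℕ) ≤ s := h1
      rw [PNat.add_coe, PNat.one_coe] at h2
      omega
    have hdeg := h.deg1 hne
    have hsmem : s ∈ κ := by
      by_contra h0
      have h1 := (h.low hne).2 (s - 1)
      rw [S_zero_max ((s:ℕ)-1) (nu κ), nu_cons, S_cons, S_cons] at h1
      · omega
      · intro x hx
        obtain ⟨y, hy, rfl⟩ := Multiset.mem_map.mp hx
        have h2 : y < s := lt_of_le_of_ne (hκ y hy) (by rintro rfl; exact h0 hy)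
        have h3 : (y:ℕ) < s := h2
        omega
    obtain ⟨ν, rfl⟩ := Multiset.exists_cons_of_mem hsmem
    have hν : ∀ x ∈ ν, x ≤ s := fun x hx => hκ x (Multiset.mem_cons_of_mem hx)
    have hmlep : mle (nu (s ::ₘ ν)) (nu ((s+1) ::ₘ l)) := by
      refine ⟨?_, fun t => ?_⟩
      · rw [hdeg, nu_cons, nu_cons, S_cons, S_cons, PNat.add_coe, PNat.one_coe]; omega
      · have h1 := h.up hne s hsl t
        refine h1.trans ?_
        rw [nu_cons, nu_cons, S_cons, S_cons, PNat.add_coe, PNat.one_coe]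
        split_ifs <;> omega
    have hδ : ct a (nu (s ::ₘ ν)) - ct a (nu (s ::ₘ l)) - a * (s:ℕ) ≠ 0 := by
      intro h0
      apply hκp
      apply npp_strict' hmlep
      have := h.ct_inj (l := nu (s ::ₘ ν)) (m := nu ((s+1) ::ₘ l)) 0 0 (by rw [hctp]; push_cast; linear_combination h0)
      omega
    set f2 := a • Vd 1 (J (s ::ₘ l)) - (a * (s:ℕ)) • (pN K 1 * J (s ::ₘ l)) with hf2
    have hlf2 : ∀ κ, hl a f2 (J κ) = (ct a (nu κ) - ct a (nu (s ::ₘ l)) - a * (s:ℕ)) * hl a (pN K 1 * J (s ::ₘ l)) (J κ) := by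
      intro κ
      rw [hf2, map_sub, LinearMap.sub_apply, LinearMap.map_smul, LinearMap.smul_apply, LinearMap.map_smul, LinearMap.smul_apply, smul_eq_mul, smul_eq_mul, h.hlVd]
      ring
    have hHf2 : Jk.Hm (S 0 (nu (s ::ₘ l)) + 1) f2 := by
      refine Hm_sub (Hm_smul _ (Hm_Vd _ 1 hHm)) (Hm_smul _ ?_)
      rw [mul_comm]; exact Hm_mul hHm (Hm_pN 1)
    obtain ⟨γ', hγ', htop⟩ := h.top s ν hν
    have h1 := htop f2 _ hHf2 (by
      intro κ h2
      rw [hlf2] at h2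
      rcases hC1 κ (right_ne_zero_of_mul h2) with rfl | h3
      · exfalso; apply left_ne_zero_of_mul h2; rw [hctp]; ring
      · exact h3)
    rw [hlf2] at h1
    have h1' := mul_ne_zero hγ' (mul_ne_zero hδ hne)
    rw [← h1] at h1'
    by_cases hx : hl a (pN K 1 * J l) (J ν) = 0
    swap
    · obtain ⟨j, hj⟩ := ih ν hx
      refine ⟨j, fun i => ?_⟩
      rw [nu_cons, nu_cons, hh_cons, hh_cons, hj i]; omega
    have hR : hl a (Vd 1 (J l)) (J ν) = 0 := by
      have := h.hlVd l ν
      rw [hx, mul_zero] at this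
      exact (mul_eq_zero.mp this).resolve_left h.ha
    set fm := Tn (K := K) (((s:ℕ):ℤ) - 1) (J (s ::ₘ l)) with hfm
    have hTf2 : hl a (Tn (s:ℕ) f2) (J ν) = - (a * hl a fm (J ν)) := by
      have e : Tn (s:ℕ) f2 = (a * γ) • Vd 1 (J l) - (a * (s:ℕ) * γ) • (pN K 1 * J l) - a • fm := by
        rw [hf2, map_sub, map_smul, map_smul, Tn_Vd _ 1 one_pos, Tn_mul _ 1 one_pos, hT, Derivation.map_smul, Nat.cast_one, show (((s:ℕ):ℤ) - ((1:ℕ):ℤ)) = ((s:ℕ):ℤ) - 1 by simp, ← hfm]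
        simp only [smul_V, Int.cast_natCast, Nat.cast_one]
        simp only [map_mul, map_sub, cV, map_one]
        ring
      rw [e, map_sub, map_sub, LinearMap.sub_apply, LinearMap.sub_apply, LinearMap.map_smul, LinearMap.smul_apply, LinearMap.map_smul, LinearMap.smul_apply, LinearMap.map_smul, LinearMap.smul_apply, hR, hx]
      simp
    rw [hTf2] at h1'
    have hy : hl a fm (J ν) ≠ 0 := by
      intro h0; apply h1'; rw [h0]; simp
    obtain ⟨r, hr⟩ : ∃ r : ℕ, (s:ℕ) = r + 1 := ⟨s - 1, by omega⟩
    have hrz : ((s:ℕ):ℤ) - 1 = (r:ℤ) := by omega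
    have hsdeg : S 0 (nu ν) = S 0 (nu l) + 1 := by
      rw [nu_cons, nu_cons, S_cons, S_cons] at hdeg; omega
    have hfac : ct a (nu ν) = ct a (nu l) + a * (r:ℤ) + ((1:ℤ):K) := by
      have h2 := Tn_Dop a h.ha (J (s ::ₘ l)) r (r+1) (by push_cast; omega)
      rw [strip1 a h.ha r _ (by intro m hm; apply hTgt; omega), h.Dop, map_smul, nu_cons, ct_cons _ _ _ hs', ← hrz, ← hfm, hrz, Int.cast_natCast, Nat.cast_choose_two] at h2
      rw [show ((r:ℤ) + 1) = ((s:ℕ):ℤ) by omega, hT] at h2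
      rw [← smul_V, ← smul_V, mul_smul_comm] at h2
      have h3 := congrArg (fun f => hl a f (J ν)) h2
      simp only [Derivation.map_smul, map_add, map_sub, LinearMap.add_apply, LinearMap.sub_apply, LinearMap.map_smul, LinearMap.smul_apply, hR, hx, smul_zero, sub_zero, add_zero] at h3
      rw [hl_Dop, hl_Ed, h.Dop, h.Hm, map_smul, map_smul, hsdeg, hr] at h3
      simp only [smul_eq_mul] at h3
      apply mul_right_cancel₀ hy
      push_cast at h3 ⊢
      linear_combination -h3
    have hnpp := h.ct_inj _ _ hfac
    obtain ⟨σ, h3, h4⟩ := h.supp hy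
    rw [hfm, hrz, ← hl_gz a h.ha, ← gm_cons] at h4
    have h5 := mle_trans (mle_cons r h3) (h.tri _ _ h4)
    have h6 := npp_strict h5 (by
      rw [nu_cons, npp_cons, npp_cons, hr, Nat.choose_succ_succ' r 1, Nat.choose_one_right, one_add_one_eq_two]; omega)
    refine ⟨r, fun i => ?_⟩
    have h7 := h6 i
    have h8 := h6 (i+1)
    rw [nu_cons, S_cons, S_cons] at h7 h8
    rw [S_succ i (nu ν), S_succ i (nu l)] at h7
    rw [nu_cons, nu_cons, hh_cons, hh_cons]
    split_ifs <;> omega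
end part8
end Jk

namespace Jk
section part9
variable {K : Type} [Field K] [CharZero K]

def bb1 (a u : K) : Module.End K (V K) := -(u • (pd 1).toLinearMap + (Ld 1).toLinearMap)
lemma bb1_apply (a u : K) (f : V K) : bb1 a u f = -(u • pd 1 f + Ld 1 f) := rfl
def bq (a u : K) : Module.End K (V K) := bb1 a u * Dop a - Dop a * bb1 a u
lemma bq_apply (a u : K) (f : V K) : bq a u f = bb1 a u (Dop a f) - Dop a (bb1 a u f) := rfl
def bb (a u : K) : ℕ → Module.End K (V K)
  | 0 => 0
  | 1 => bb1 a u
  | (n+2) => ((n:K)+1)⁻¹ • (bb a u (n+1) * bq a u - bq a u * bb a u (n+1))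
lemma bb_succ (a u : K) (n : ℕ) (hn : 1 ≤ n) (f : V K) : bb a u (n+1) f = (n:K)⁻¹ • (bb a u n (bq a u f) - bq a u (bb a u n f)) := by
  obtain ⟨m, rfl⟩ : ∃ m, n = m + 1 := ⟨n - 1, by omega⟩
  rw [bb]; push_cast; rfl
lemma hl_B1 (a u : K) (ha : a ≠ 0) (f x : V K) : hl a f (bb1 a u x) = - hl a (B1 a u f) x := by
  have e : B1 a u f = (u / a) • (pN K 1 * f) + Vd 1 f := rfl
  rw [e, bb1_apply, map_neg, map_add, map_add, LinearMap.add_apply, hl_Vd, LinearMap.map_smul, LinearMap.map_smul, LinearMap.smul_apply, hl_pN, map_smul]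
  simp only [smul_eq_mul]
  push_cast
  field_simp
lemma hl_bq (a u : K) (ha : a ≠ 0) (f x : V K) : hl a f (bq a u x) = - hl a (Qop a u f) x := by
  have e : Qop a u f = Dop a (B1 a u f) - B1 a u (Dop a f) := rfl
  rw [e, bq_apply, map_sub, map_sub, LinearMap.sub_apply, hl_B1 a u ha f, ← hl_Dop a (B1 a u f), ← hl_Dop a f (bb1 a u x), hl_B1 a u ha (Dop a f)]; ring
lemma hl_bb (a u : K) (ha : a ≠ 0) (n : ℕ) (hn : 1 ≤ n) : ∀ (f x : V K), hl a f (bb a u n x) = (-1) ^ n * hl a (Bn a u n f) x := by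
  induction n, hn using Nat.le_induction with
  | base => intro f x; rw [Bn_one a u ha, bb, hl_B1 a u ha]; ring
  | succ n hn ih =>
    intro f x
    have hn0 : (n:K) ≠ 0 := Nat.cast_ne_zero.mpr (by omega)
    have e := congrArg (fun T : Module.End K (V K) => hl a (T f) x) (Bn_rec a u ha n)
    simp only [LinearMap.smul_apply, LinearMap.sub_apply, Module.End.mul_apply, map_sub, LinearMap.map_smul, smul_eq_mul] at e
    rw [bb_succ a u n hn, LinearMap.map_smul, map_sub, ih, hl_bq a u ha, hl_bq a u ha, ih, smul_eq_mul]
    rw [pow_succ]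
    field_simp
    linear_combination e

variable {a : K} {J : Multiset ℕ+ → V K}

/-- Lowering operators. -/
def Low (n : ℕ) (T : Module.End K (V K)) : Prop := ∀ f, T (Ed f) = Ed (T f) + (n:K) • T f
lemma neg_zero_of (f : V K) (c : ℤ) (hc : c < 0) (h : Ed f = (c:K) • f) : f = 0 := by
  ext m
  have h1 := congrArg (MvPolynomial.coeff m) h
  rw [coeff_Ed, MvPolynomial.coeff_smul, smul_eq_mul] at h1
  by_contra h2
  have h3 := mul_right_cancel₀ h2 h1
  have : ((wtN m : ℕ) : ℤ) = c := by exact_mod_cast h3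
  omega
lemma Low.Hm {n d : ℕ} {T : Module.End K (V K)} (hT : Low n T) {f : V K} (hf : Hm d f) (h : n ≤ d) : Jk.Hm (d - n) (T f) := by
  have := hT f
  rw [hf, map_smul] at this
  rw [Jk.Hm, Nat.cast_sub h, sub_smul, this, add_sub_cancel_right]
lemma Low.zero {n d : ℕ} {T : Module.End K (V K)} (hT : Low n T) {f : V K} (hf : Jk.Hm d f) (h : d < n) : T f = 0 := by
  have := hT f
  rw [hf, map_smul] at this
  apply neg_zero_of _ ((d:ℤ) - n) (by omega)
  push_cast
  rw [sub_smul, this, add_sub_cancel_right]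
lemma V_homog {P : V K → Prop} (hadd : ∀ f g, P f → P g → P (f + g)) (h : ∀ d f, Hm d f → P f) (f : V K) : P f := by
  induction f using MvPolynomial.induction_on' with
  | add p q hp hq => exact hadd p q hp hq
  | monomial u c =>
    obtain ⟨l, rfl⟩ := toFinsupp_surj u
    rw [show MvPolynomial.monomial (Multiset.toFinsupp l) c = c • pm (K := K) l by simp [pm, MvPolynomial.smul_monomial]]
    exact h _ _ (Hm_smul _ (Hm_pm l))

def LF (T : ℕ → Module.End K (V K)) : Prop := ∀ f, ∃ d, ∀ k, d ≤ k → T k f = 0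
lemma LF_of (T : ℕ → Module.End K (V K)) (h : ∀ d f, Hm d f → ∃ e, ∀ k, e ≤ k → T k f = 0) : LF T := by
  apply V_homog
  · rintro f g ⟨d1, h1⟩ ⟨d2, h2⟩
    refine ⟨max d1 d2, fun k hk => ?_⟩
    rw [map_add, h1 k (le_trans (le_max_left _ _) hk), h2 k (le_trans (le_max_right _ _) hk), add_zero]
  · exact h
lemma finsum_range {N : Type} [AddCommMonoid N] (T : ℕ → N) (M : ℕ) (h : ∀ k, M ≤ k → T k = 0) : ∑ᶠ k, T k = ∑ k ∈ Finset.range M, T k := by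
  apply finsum_eq_sum_of_support_subset
  intro k hk
  by_contra h2
  exact hk (h k (by simpa using h2))
def loc (T : ℕ → Module.End K (V K)) (h : LF T) : Module.End K (V K) where
  toFun f := ∑ᶠ k, T k f
  map_add' := by
    intro f g
    obtain ⟨d1, h1⟩ := h f
    obtain ⟨d2, h2⟩ := h g
    have l := le_max_left d1 d2
    have r := le_max_right d1 d2
    rw [finsum_range _ (max d1 d2) (fun k hk => h1 k (l.trans hk)), finsum_range _ (max d1 d2) (fun k hk => h2 k (r.trans hk)),
      finsum_range _ (max d1 d2) (fun k hk => by rw [map_add, h1 k (l.trans hk), h2 k (r.trans hk), add_zero])]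
    simp only [map_add, Finset.sum_add_distrib]
  map_smul' := by
    intro c f
    obtain ⟨d1, h1⟩ := h f
    rw [finsum_range _ d1 h1, finsum_range _ d1 (fun k hk => by rw [map_smul, h1 k hk, smul_zero])]
    simp only [map_smul, Finset.smul_sum, RingHom.id_apply]
lemma loc_apply {T : ℕ → Module.End K (V K)} (h : LF T) {f : V K} {M : ℕ} (hM : ∀ k, M ≤ k → T k f = 0) : loc T h f = ∑ k ∈ Finset.range M, T k f :=
  finsum_range _ M hM
lemma LF_low {T : ℕ → Module.End K (V K)} (h : ∀ n, Low n (T n)) : LF T :=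
  LF_of T (fun d f hf => ⟨d + 1, fun k hk => (h k).zero hf (by omega)⟩)

def LN (N : Module.End K (V K)) : Prop := ∀ f, ∃ d, ∀ k, d ≤ k → (N ^ k) f = 0
lemma LN.LF {N : Module.End K (V K)} (h : LN N) (t : K) : LF (fun k => (t ^ k * (k.factorial : K)⁻¹) • N ^ k) := by
  intro f
  obtain ⟨d, hd⟩ := h f
  exact ⟨d, fun k hk => by rw [LinearMap.smul_apply, hd k hk, smul_zero]⟩
lemma pow_add_app (N : Module.End K (V K)) (i j : ℕ) (f : V K) : (N ^ (i + j)) f = (N ^ i) ((N ^ j) f) := by rw [pow_add]; rfl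
lemma LN_loc {T : ℕ → Module.End K (V K)} (h : ∀ n, Low n (T n)) (h0 : T 0 = 0) (hLF : LF T) : LN (loc T hLF) := by
  have key : ∀ d f, Hm d f → ∀ k, d < k → ((loc T hLF) ^ k) f = 0 := by
    intro d
    induction d using Nat.strong_induction_on with
    | _ d ih =>
      intro f hf k hk
      obtain ⟨k, rfl⟩ : ∃ k', k = k' + 1 := ⟨k - 1, by omega⟩
      rw [pow_add_app, pow_one, loc_apply hLF (M := d + 1) (fun k hk => (h k).zero hf (by omega)), map_sum]
      refine Finset.sum_eq_zero fun n hn => ?_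
      have hn : n < d + 1 := by simpa using hn
      rcases Nat.eq_zero_or_pos n with rfl | hn0
      · rw [h0]; simp
      · exact ih (d - n) (by omega) _ ((h n).Hm hf (by omega)) k (by omega)
  refine V_homog ?_ ?_
  · rintro f g ⟨d1, h1⟩ ⟨d2, h2⟩
    refine ⟨max d1 d2, fun k hk => ?_⟩
    rw [map_add, h1 k (le_trans (le_max_left _ _) hk), h2 k (le_trans (le_max_right _ _) hk), add_zero]
  · exact fun d f hf => ⟨d + 1, fun k hk => key d f hf k (by omega)⟩

def ex (N : Module.End K (V K)) (h : LN N) (t : K) : Module.End K (V K) := loc _ (h.LF t)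
lemma ex_apply {N : Module.End K (V K)} (h : LN N) (t : K) {f : V K} {M : ℕ} (hM : ∀ k, M ≤ k → (N ^ k) f = 0) :
    ex N h t f = ∑ k ∈ Finset.range M, (t ^ k * (k.factorial : K)⁻¹) • (N ^ k) f := by
  rw [ex, loc_apply (h.LF t) (M := M) (fun k hk => by rw [LinearMap.smul_apply, hM k hk, smul_zero])]; rfl

lemma pow_comm_Y {N Y : Module.End K (V K)} {c : K} (hc : ∀ f, N (Y f) = Y (N f) + c • f) (k : ℕ) (f : V K) :
    (N ^ (k+1)) (Y f) = Y ((N ^ (k+1)) f) + (((k:K)+1) * c) • (N ^ k) f := by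
  induction k with
  | zero => simp [hc]
  | succ k ih =>
    have h : ∀ j g, (N ^ (j+1)) g = N ((N ^ j) g) := fun j g => by rw [add_comm, pow_add_app N 1 j, pow_one]
    rw [h (k+1), ih, map_add, hc, map_smul, ← h, ← h, add_assoc, ← add_smul]
    congr 2; push_cast; ring
lemma ex_Y {N Y : Module.End K (V K)} (h : LN N) {c : K} (hc : ∀ f, N (Y f) = Y (N f) + c • f) (f : V K) :
    ex N h 1 (Y f) = Y (ex N h 1 f) + c • ex N h 1 f := by
  obtain ⟨d1, h1⟩ := h f
  obtain ⟨d2, h2⟩ := h (Y f)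
  have l := le_max_left d1 d2
  have r := le_max_right d1 d2
  set M := max d1 d2
  rw [ex_apply h 1 (f := Y f) (M := M + 1) (fun k hk => h2 k (by omega))]
  rw [Finset.sum_range_succ']
  have hA := ex_apply h 1 (f := f) (M := M + 1) (fun k hk => h1 k (by omega))
  have hB := ex_apply h 1 (f := f) (M := M) (fun k hk => h1 k (by omega))
  rw [Finset.sum_range_succ'] at hA
  have e1 := congrArg Y hA
  have e2 := congrArg (fun z => c • z) hB
  beta_reduce at e2
  rw [e1, e2, map_add, map_sum]
  simp only [pow_comm_Y hc, smul_add, Finset.sum_add_distrib, Finset.smul_sum, map_smul, smul_smul]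
  have : ∀ k : ℕ, ((1:K) ^ (k+1) * ((k+1).factorial : K)⁻¹ * ((k + 1) * c)) = c * (1 ^ k * (k.factorial : K)⁻¹) := by
    intro k
    rw [Nat.factorial_succ]; push_cast
    have h3 : (k:K) + 1 ≠ 0 := by exact_mod_cast Nat.succ_ne_zero k
    have h4 : (k.factorial : K) ≠ 0 := by exact_mod_cast k.factorial_ne_zero
    field_simp; simp
  simp only [this]
  simp only [pow_zero, Module.End.one_apply]
  abel
lemma ex_one {N : Module.End K (V K)} (h : LN N) (t : K) {f : V K} (h0 : N f = 0) : ex N h t f = f := by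
  rw [ex_apply h t (M := 1)]
  · simp
  · intro k hk
    obtain ⟨k, rfl⟩ : ∃ k', k = k' + 1 := ⟨k - 1, by omega⟩
    rw [pow_add_app, pow_one, h0, map_zero]
lemma ex_add {N : Module.End K (V K)} (h : LN N) (s t : K) (f : V K) : ex N h s (ex N h t f) = ex N h (s + t) f := by
  obtain ⟨M, hM⟩ := h f
  rw [ex_apply h t hM, map_sum, ex_apply h (s+t) hM]
  have e : ∀ l, ex N h s ((N ^ l) f) = ∑ k ∈ Finset.range M, (s ^ k * (k.factorial : K)⁻¹) • (N ^ (k + l)) f := by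
    intro l
    rw [ex_apply h s (M := M) (fun k hk => by rw [← pow_add_app]; exact hM _ (by omega))]
    simp only [pow_add_app]
  simp only [map_smul, e, Finset.smul_sum, smul_smul]
  have e2 : ∀ n, (s + t) ^ n * (n.factorial : K)⁻¹ = ∑ x ∈ Finset.HasAntidiagonal.antidiagonal n, (t ^ x.1 * (x.1.factorial : K)⁻¹) * (s ^ x.2 * (x.2.factorial : K)⁻¹) := by
    intro n
    rw [add_comm s t, Commute.add_pow' (Commute.all t s), Finset.sum_mul]
    refine Finset.sum_congr rfl fun x hx => ?_
    rw [Finset.HasAntidiagonal.mem_antidiagonal] at hx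
    subst hx
    rw [nsmul_eq_mul, Nat.cast_choose K (Nat.le_add_right _ _), Nat.add_sub_cancel_left]
    have h4 : ((x.1+x.2).factorial : K) ≠ 0 := by exact_mod_cast Nat.factorial_ne_zero _
    field_simp
  simp only [e2, Finset.sum_smul]
  rw [← Finset.sum_product', Finset.sum_sigma']
  symm
  refine Finset.sum_of_injOn (fun x : (_ : ℕ) × ℕ × ℕ => x.2) ?_ ?_ ?_ ?_
  · rintro ⟨n, x⟩ hx ⟨m, y⟩ hy hxy
    simp only [Finset.coe_sigma, Set.mem_sigma_iff, Finset.mem_coe, Finset.HasAntidiagonal.mem_antidiagonal] at hx hy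
    simp only at hxy
    subst hxy
    obtain ⟨_, rfl⟩ := hx
    obtain ⟨_, rfl⟩ := hy
    rfl
  · rintro ⟨n, x⟩ hx
    simp only [Finset.coe_sigma, Set.mem_sigma_iff, Finset.mem_coe, Finset.HasAntidiagonal.mem_antidiagonal, Finset.mem_range, Finset.coe_product, Set.mem_prod] at hx ⊢
    omega
  · rintro ⟨x, y⟩ hx hn
    rw [hM, smul_zero]
    by_contra h2
    apply hn
    refine ⟨⟨x + y, x, y⟩, ?_, rfl⟩
    simp only [Finset.coe_sigma, Set.mem_sigma_iff, Finset.mem_coe, Finset.HasAntidiagonal.mem_antidiagonal, Finset.mem_range]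
    exact ⟨by omega, trivial⟩
  · rintro ⟨n, x⟩ hx
    simp only [Finset.mem_sigma, Finset.HasAntidiagonal.mem_antidiagonal] at hx
    simp only
    rw [← hx.2, add_comm x.1]
end part9
end Jk

namespace Jk
section part10
variable {K : Type} [Field K] [CharZero K] {a : K} {J : Multiset ℕ+ → V K}

lemma JK.li (h : JK a J) : LinearIndependent K J := by
  rw [linearIndependent_iff']
  intro s c hc i hi
  have h1 := congrArg (fun x => hl a x (J i)) hc
  simp only [map_sum, LinearMap.sum_apply, map_smul, LinearMap.smul_apply, map_zero, LinearMap.zero_apply, smul_eq_mul] at h1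
  rw [Finset.sum_eq_single i] at h1
  · exact (mul_eq_zero.mp h1).resolve_right (h.sq i)
  · intro b _ hb; rw [h.orth b i hb, mul_zero]
  · exact fun h2 => absurd hi h2
def JK.basis (h : JK a J) : Module.Basis (Multiset ℕ+) K (V K) := Module.Basis.mk h.li (fun f _ => h.span f)
lemma JK.basis_apply (h : JK a J) (l) : h.basis l = J l := by simp [JK.basis]
def JK.mk' (h : JK a J) {N : Type} [AddCommGroup N] [Module K N] (φ : Multiset ℕ+ → N) : V K →ₗ[K] N := h.basis.constr K φ
lemma JK.mk'_apply (h : JK a J) {N : Type} [AddCommGroup N] [Module K N] (φ : Multiset ℕ+ → N) (l) : h.mk' φ (J l) = φ l := by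
  rw [JK.mk', ← h.basis_apply, Module.Basis.constr_basis]
lemma JK.lext (h : JK a J) {N : Type} [AddCommGroup N] [Module K N] {S T : V K →ₗ[K] N} (e : ∀ l, S (J l) = T (J l)) (f : V K) : S f = T f := by
  have : S = T := h.basis.ext (fun l => by rw [h.basis_apply, e])
  rw [this]

def Wf (a : K) (s j k : ℕ) : K := ∏ i ∈ Finset.range k, (a * ((s:K) - j) + i)
def Ww (a : K) (s : ℕ) (l : Multiset ℕ+) : K := ∏ j ∈ Finset.range (S 0 (nu l)), Wf a s j (hh j (nu l))
lemma Ww_ge (a : K) (s : ℕ) (l : Multiset ℕ+) (N : ℕ) (h : S 0 (nu l) ≤ N) : Ww a s l = ∏ j ∈ Finset.range N, Wf a s j (hh j (nu l)) := by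
  rw [Ww]
  apply Finset.prod_subset
  · intro x hx; simp at hx ⊢; omega
  · intro x _ hx
    rw [hh_zero_of x _ (by simpa using hx)]; simp [Wf]
lemma Ww_box (a : K) (s : ℕ) {l m : Multiset ℕ+} {j : ℕ} (h : addbox l m j) : Ww a s m = Ww a s l * (a * ((s:K) - j) + hh j (nu l)) := by
  have h0 := (addbox_S0 h).1
  have hj : j < S 0 (nu m) := by
    by_contra h2
    have := hh_zero_of j (nu m) (by omega)
    rw [h j] at this; simp at this
  rw [Ww_ge a s l (S 0 (nu m)) (by omega), Ww]
  have : ∀ i, Wf a s i (hh i (nu m)) = Wf a s i (hh i (nu l)) * if i = j then (a * ((s:K) - j) + hh j (nu l)) else 1 := by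
    intro i
    rw [h i]
    by_cases hij : i = j
    · subst hij; simp only [if_true, Wf, Finset.prod_range_succ]
    · simp [hij]
  simp only [this, Finset.prod_mul_distrib]
  rw [Finset.prod_ite_eq', if_pos (by simpa using hj)]
lemma JK.Ww_ne (h : JK a J) (s : ℕ) (l : Multiset ℕ+) (hs : hh s (nu l) = 0) : Ww a s l ≠ 0 := by
  rw [Ww, Finset.prod_ne_zero_iff]
  intro j _
  rw [Wf, Finset.prod_ne_zero_iff]
  intro i hi h0
  have hi : i < hh j (nu l) := by simpa using hi
  have := (h.tr ((s:ℤ) - j) (-(i:ℤ)) (by push_cast; linear_combination h0)).1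
  have : s = j := by omega
  subst this; omega
lemma Ww_zero (a : K) (s : ℕ) (l : Multiset ℕ+) (hs : hh s (nu l) ≠ 0) : Ww a s l = 0 := by
  rw [Ww]
  apply Finset.prod_eq_zero (i := s)
  · by_contra h2
    exact hs (hh_zero_of s _ (by simpa using h2))
  · rw [Wf]
    apply Finset.prod_eq_zero (i := 0)
    · simp; omega
    · simp
def JK.Ko (h : JK a J) (s : ℕ) : Module.End K (V K) := h.mk' (fun l => Ww a s l • J l)
lemma JK.Ko_J (h : JK a J) (s : ℕ) (l) : h.Ko s (J l) = Ww a s l • J l := h.mk'_apply _ l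
lemma JK.hl_Ko (h : JK a J) (s : ℕ) (l) (f : V K) : hl a (J l) (h.Ko s f) = Ww a s l * hl a (J l) f := by
  have := h.lext (S := (hl a (J l)) ∘ₗ h.Ko s) (T := Ww a s l • hl a (J l)) (fun m => by
    rw [LinearMap.comp_apply, h.Ko_J, LinearMap.map_smul, LinearMap.smul_apply, smul_eq_mul, smul_eq_mul]
    by_cases hlm : l = m
    · rw [hlm]
    · rw [h.orth l m hlm]; simp) f
  simpa using this
lemma JK.Ko_Dop (h : JK a J) (s : ℕ) (f : V K) : h.Ko s (Jk.Dop a f) = Jk.Dop a (h.Ko s f) :=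
  h.lext (S := h.Ko s ∘ₗ Jk.Dop a) (T := Jk.Dop a ∘ₗ h.Ko s) (fun m => by
    rw [LinearMap.comp_apply, LinearMap.comp_apply, h.Dop, map_smul, h.Ko_J, map_smul, h.Dop, smul_smul, smul_smul, mul_comm]) f
lemma JK.Ed_Dop (h : JK a J) (f : V K) : Ed (Jk.Dop a f) = Jk.Dop a (Ed f) :=
  h.lext (S := Ed.toLinearMap ∘ₗ Jk.Dop a) (T := Jk.Dop a ∘ₗ Ed.toLinearMap) (fun m => by
    have hE : Ed (J m) = ((S 0 (nu m) : ℕ) : K) • J m := h.Hm m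
    show Ed (Jk.Dop a (J m)) = Jk.Dop a (Ed (J m))
    rw [h.Dop, Derivation.map_smul, hE, map_smul, h.Dop, smul_smul, smul_smul, mul_comm]) f
lemma JK.Ko_b1 (h : JK a J) (s : ℕ) (f : V K) : h.Ko s (bb1 a (-(a * s)) f) = pd 1 (h.Ko s f) := by
  have ha := h.ha
  refine h.lext (S := h.Ko s ∘ₗ bb1 a (-(a * s))) (T := (pd 1).toLinearMap ∘ₗ h.Ko s) (fun κ => ?_) f
  show h.Ko s (bb1 a (-(a * s)) (J κ)) = pd 1 (h.Ko s (J κ))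
  apply h.ext
  intro μ
  rw [hl_comm, hl_comm a _ (J μ), h.hl_Ko, hl_B1 a _ ha]
  have e1 : B1 a (-(a * s)) (J μ) = ((-(a * s)) / a) • (pN K 1 * J μ) + Vd 1 (J μ) := rfl
  have e2 := hl_pN a 1 (J μ) (h.Ko s (J κ))
  rw [h.Ko_J, LinearMap.map_smul, LinearMap.map_smul] at e2
  rw [h.Ko_J]
  have e3 := h.hlVd μ κ
  rw [e1, map_add, LinearMap.add_apply, map_smul, LinearMap.smul_apply]
  simp only [smul_eq_mul, Nat.cast_one, mul_one] at e2 ⊢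
  have e4 : Ww a s μ * (a * s - (ct a (nu κ) - ct a (nu μ))) * hl a (pN K 1 * J μ) (J κ) = Ww a s κ * hl a (pN K 1 * J μ) (J κ) := by
    by_cases h0 : hl a (pN K 1 * J μ) (J κ) = 0
    · rw [h0]; simp
    · obtain ⟨j, hj⟩ := h.pieri μ κ h0
      rw [addbox_ct a hj, Ww_box a s hj]; ring
  rw [show -(a * (s:K)) / a = -s by field_simp]
  apply mul_left_cancel₀ ha
  linear_combination e4 + e2 - Ww a s μ * e3
lemma JK.Ko_bq (h : JK a J) (s : ℕ) (f : V K) : h.Ko s (bq a (-(a * s)) f) = Ld 1 (h.Ko s f) := by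
  rw [bq_apply, map_sub, h.Ko_b1, h.Ko_Dop, h.Ko_Dop, h.Ko_b1, pd_Dop a h.ha]; ring
lemma JK.Ko_bb (h : JK a J) (s n : ℕ) (hn : 1 ≤ n) : ∀ f : V K, h.Ko s (bb a (-(a * s)) n f) = (n : K) • pd n (h.Ko s f) := by
  induction n, hn using Nat.le_induction with
  | base => intro f; rw [bb, h.Ko_b1]; simp
  | succ n hn ih =>
    intro f
    have hn0 : (n:K) ≠ 0 := Nat.cast_ne_zero.mpr (by omega)
    rw [bb_succ a _ n hn, map_smul, map_sub, ih, h.Ko_bq, h.Ko_bq, ih, pd_Ld n 1 (by omega), Derivation.map_smul, ← smul_sub, smul_smul, inv_mul_cancel₀ hn0, one_smul, add_sub_cancel_left, smul_V]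
    simp

lemma JK.Low_b1 (h : JK a J) (u : K) : Low 1 (bb1 a u) := by
  intro f
  rw [bb1_apply, bb1_apply, pd_Ed, Ed_Ld, map_neg, map_add, Derivation.map_smul]
  simp only [smul_V, Nat.cast_one, MvPolynomial.C_1]; ring
lemma JK.Low_bq (h : JK a J) (u : K) : Low 1 (bq a u) := by
  intro f
  rw [bq_apply, bq_apply, h.Low_b1 u, ← h.Ed_Dop, h.Low_b1 u, map_sub, map_add, ← h.Ed_Dop, map_smul, smul_sub]; abel
lemma JK.Low_bb (h : JK a J) (u : K) (n : ℕ) : Low n (bb a u n) := by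
  by_cases hn : 1 ≤ n
  swap
  · obtain rfl : n = 0 := by omega
    intro f; simp [bb]
  induction n, hn using Nat.le_induction with
  | base => rw [bb]; exact h.Low_b1 u
  | succ n hn ih =>
    intro f
    rw [bb_succ a _ n hn, bb_succ a _ n hn, h.Low_bq, ih, map_add, map_add, ih, h.Low_bq, Derivation.map_smul, map_sub, map_smul, map_smul]
    simp only [smul_V, Nat.cast_one, Nat.cast_add, MvPolynomial.C_1, map_add]; ring
def JK.NT (h : JK a J) (u : K) (n : ℕ) : Module.End K (V K) := (n:K)⁻¹ • bb a u n
lemma JK.NT_apply (h : JK a J) (u : K) (n : ℕ) (f) : h.NT u n f = (n:K)⁻¹ • bb a u n f := rfl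
lemma JK.Low_NT (h : JK a J) (u : K) (n : ℕ) : Low n (h.NT u n) := by
  intro f
  rw [h.NT_apply, h.NT_apply, h.Low_bb u n f, Derivation.map_smul, smul_add, smul_comm]
lemma JK.LF_NT (h : JK a J) (u : K) : LF (h.NT u) := LF_low (h.Low_NT u)
def JK.NN (h : JK a J) (u : K) : Module.End K (V K) := loc (h.NT u) (h.LF_NT u)
lemma JK.LN_NN (h : JK a J) (u : K) : LN (h.NN u) := LN_loc (h.Low_NT u) (by simp [JK.NT]) (h.LF_NT u)

def dT (K : Type) [Field K] (n : ℕ) : Module.End K (V K) := (pd n).toLinearMap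
lemma dT_apply (n : ℕ) (f : V K) : dT K n f = pd n f := rfl
lemma Low_dT (n : ℕ) : Low n (dT K n) := by
  intro f; rw [dT_apply, dT_apply, pd_Ed, smul_V]; simp
lemma LF_dT : LF (dT K) := LF_low Low_dT
def DD (K : Type) [Field K] [CharZero K] : Module.End K (V K) := loc (dT K) LF_dT
lemma pd_zero_apply (f : V K) : pd 0 f = 0 := by
  have : (pd 0 : Derivation K (V K) (V K)) = 0 := by
    ext i; rw [← pN_coe, pd_pN]; simp
  rw [this]; rfl
lemma LN_DD : LN (DD K) := LN_loc Low_dT (LinearMap.ext fun f => pd_zero_apply f) LF_dT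
lemma JK.Ko_NN (h : JK a J) (s : ℕ) (f : V K) : h.Ko s (h.NN (-(a * s)) f) = DD K (h.Ko s f) := by
  obtain ⟨d1, h1⟩ := h.LF_NT (-(a * s)) f
  obtain ⟨d2, h2⟩ := LF_dT (h.Ko s f)
  have l := le_max_left d1 d2
  have r := le_max_right d1 d2
  rw [JK.NN, DD, loc_apply _ (M := max d1 d2) (fun k hk => h1 k (by omega)), loc_apply _ (M := max d1 d2) (fun k hk => h2 k (by omega)), map_sum]
  refine Finset.sum_congr rfl fun n _ => ?_
  rcases Nat.eq_zero_or_pos n with rfl | hn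
  · rw [dT_apply, pd_zero_apply]; simp [JK.NT]
  · rw [h.NT_apply, map_smul, h.Ko_bb s n hn, dT_apply, smul_smul, inv_mul_cancel₀ (Nat.cast_ne_zero.mpr (by omega)), one_smul]
lemma JK.Ko_NN_pow (h : JK a J) (s k : ℕ) (f : V K) : h.Ko s ((h.NN (-(a * s)) ^ k) f) = (DD K ^ k) (h.Ko s f) := by
  induction k generalizing f with
  | zero => simp
  | succ k ih => rw [pow_succ, Module.End.mul_apply, ih, h.Ko_NN, pow_succ, Module.End.mul_apply]
lemma JK.Ko_ex (h : JK a J) (s : ℕ) (f : V K) : h.Ko s (ex _ (h.LN_NN (-(a * s))) 1 f) = ex _ LN_DD 1 (h.Ko s f) := by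
  obtain ⟨d1, h1⟩ := h.LN_NN (-(a * s)) f
  obtain ⟨d2, h2⟩ := LN_DD (h.Ko s f)
  have l := le_max_left d1 d2
  have r := le_max_right d1 d2
  rw [ex_apply _ _ (M := max d1 d2) (fun k hk => h1 k (by omega)), ex_apply _ _ (M := max d1 d2) (fun k hk => h2 k (by omega)), map_sum]
  simp only [map_smul, h.Ko_NN_pow]
lemma DD_pN (j : ℕ) (hj : 0 < j) (f : V K) : DD K (pN K j * f) = pN K j * DD K f + f := by
  obtain ⟨d1, h1⟩ := LF_dT f
  obtain ⟨d2, h2⟩ := LF_dT (pN K j * f)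
  have l := le_max_left d1 d2
  have r := le_max_right d1 d2
  have e : ∀ n, dT K n (pN K j * f) = pN K j * dT K n f + if n = j then f else 0 := by
    intro n
    rw [dT_apply, dT_apply, Derivation.leibniz, pd_pN]
    by_cases hnj : n = j
    · subst hnj; simp [hj]
    · simp [hnj]
  rw [DD, loc_apply _ (M := max d1 d2 + j + 1) (fun k hk => h1 k (by omega)), loc_apply _ (M := max d1 d2 + j + 1) (fun k hk => h2 k (by omega)), Finset.mul_sum]
  simp only [e, Finset.sum_add_distrib]
  rw [Finset.sum_ite_eq', if_pos (by simp)]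
lemma ex_DD (f : V K) : ex _ (LN_DD (K := K)) 1 f = Polynomial.eval 1 (U f) := by
  induction f using V_ind_prop with
  | h1 c =>
    rw [ex_one, U_C]; · simp
    rw [DD, loc_apply _ (M := 0)]; · simp
    intro k _
    rw [dT_apply, show cV c = c • (1 : V K) by rw [smul_V, mul_one], Derivation.map_smul, Derivation.map_one_eq_zero, smul_zero]
  | hadd f g hf hg => rw [map_add, hf, hg, map_add, Polynomial.eval_add]
  | hp j f hf =>
    have := ex_Y (Y := LinearMap.mulLeft K (pN K j)) (LN_DD (K := K)) (c := 1) (fun f => by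
      simp only [LinearMap.mulLeft_apply, one_smul]; exact DD_pN j j.2 f) f
    simp only [LinearMap.mulLeft_apply, one_smul] at this
    rw [this, U_mul (j:ℕ) j.pos, hf, Polynomial.eval_add, Polynomial.eval_mul, Polynomial.eval_mul]
    simp
end part10
end Jk

namespace Jk
section part11
variable {K : Type} [Field K] [CharZero K] {a : K} {J : Multiset ℕ+ → V K}

lemma cV_two : cV (2:K) = 2 := map_ofNat _ 2
lemma cV_nat (n : ℕ) : cV (n:K) = n := map_natCast _ n
lemma b1_p1 (a u : K) (f : V K) : bb1 a u (pN K 1 * f) = pN K 1 * bb1 a u f - u • f := by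
  rw [bb1_apply, bb1_apply, Derivation.leibniz, Derivation.leibniz, pd_pN, Ld_pN]
  simp only [smul_V, smul_eq_mul]; simp; ring
lemma b1_Vd (a u : K) (f : V K) : bb1 a u (Vd 1 f) = Vd 1 (bb1 a u f) - (2:K) • Ed f := by
  rw [bb1_apply, bb1_apply, pd_Vd, Ld_Vd, map_neg, map_add, Derivation.map_smul]
  simp only [smul_V, cV_two]; ring
lemma bq_p1 (a u : K) (ha : a ≠ 0) (f : V K) : bq a u (pN K 1 * f) = pN K 1 * bq a u f - (2 * a) • Ed f := by
  rw [bq_apply, bq_apply, Dop_p1 a ha, map_add, b1_p1, b1_p1, map_sub, Dop_p1 a ha, map_smul, map_smul, b1_Vd]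
  simp only [smul_V, map_mul, cV_two]; ring
lemma JK.bb_p1 (h : JK a J) (u : K) (n : ℕ) (hn : 1 ≤ n) : ∀ f : V K, bb a u (n+1) (pN K 1 * f) = pN K 1 * bb a u (n+1) f - (a * (n+1)) • bb a u n f := by
  induction n, hn using Nat.le_induction with
  | base =>
    intro f
    rw [bb_succ a u 1 le_rfl, bb_succ a u 1 le_rfl, bq_p1 a u h.ha, bb, b1_p1, map_sub, b1_p1, map_sub, map_smul, map_smul, bq_p1 a u h.ha, h.Low_b1 u]
    simp only [smul_V, map_mul, map_add, cV_two, Nat.cast_one, map_one, inv_one]; ring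
  | succ n hn ih =>
    intro f
    have hn1 : ((n+1:ℕ):K) ≠ 0 := Nat.cast_ne_zero.mpr (by omega)
    have e := bb_succ a u n hn f
    have hn0 : (n:K) ≠ 0 := Nat.cast_ne_zero.mpr (by omega)
    have e' : bb a u n (bq a u f) - bq a u (bb a u n f) = (n:K) • bb a u (n+1) f := by rw [e, smul_smul, mul_inv_cancel₀ hn0, one_smul]
    have e2 := sub_eq_iff_eq_add.mp e'
    rw [bb_succ a u (n+1) (by omega), bb_succ a u (n+1) (by omega), bq_p1 a u h.ha, map_sub, ih, ih, map_sub, map_smul, map_smul, bq_p1 a u h.ha, h.Low_bb u (n+1), e2]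
    have e3 : cV ((n+1:ℕ):K)⁻¹ * ((n:V K) + 1) = 1 := by
      rw [show ((n:V K) + 1) = cV ((n+1:ℕ):K) by simp, ← map_mul, inv_mul_cancel₀ hn1, map_one]
    simp only [smul_V, map_mul, map_add, cV_nat, cV_two, map_one, Nat.cast_add, Nat.cast_one] at e3 ⊢
    linear_combination (-(cV a * ((n:V K) + 2) * (bb a u (n+1)) f)) * e3
def Yo (a : K) : Module.End K (V K) := Ed.toLinearMap + a⁻¹ • LinearMap.mulLeft K (pN K 1)
lemma Yo_apply (a : K) (f : V K) : Yo a f = Ed f + a⁻¹ • (pN K 1 * f) := rfl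
lemma JK.NN_Y (h : JK a J) (s : ℕ) (f : V K) : h.NN (-(a * s)) (Yo a f) = Yo a (h.NN (-(a * s)) f) + (s:K) • f := by
  have ha := h.ha
  set u := -(a * s) with hu
  obtain ⟨d1, h1⟩ := h.LF_NT u f
  obtain ⟨d2, h2⟩ := h.LF_NT u (Yo a f)
  have l := le_max_left d1 d2
  have r := le_max_right d1 d2
  set M := max d1 d2
  have z : ∀ g, h.NT u 0 g = 0 := fun g => by simp [JK.NT]
  rw [JK.NN, loc_apply _ (M := M + 1 + 1) (fun k hk => h1 k (by omega)), loc_apply _ (M := M + 1 + 1) (fun k hk => h2 k (by omega))]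
  rw [Finset.sum_range_succ' _ (M+1), z, add_zero, Finset.sum_range_succ' _ (M+1), z, add_zero, Finset.sum_range_succ', Finset.sum_range_succ']
  have e0 : h.NT u (0+1) (Yo a f) = Yo a (h.NT u (0+1) f) + (s:K) • f + bb a u 1 f := by
    rw [h.NT_apply, h.NT_apply, Yo_apply, Yo_apply, bb, map_add, h.Low_b1 u, map_smul, b1_p1, hu]
    have : cV a⁻¹ * cV a = 1 := by rw [← map_mul, inv_mul_cancel₀ ha, map_one]
    simp only [smul_V, map_mul, map_add, map_neg]; simp
    linear_combination (s:V K) * f * this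
  have e1 : ∀ n, h.NT u (n+1+1) (Yo a f) = Yo a (h.NT u (n+1+1) f) + bb a u (n+1+1) f - bb a u (n+1) f := by
    intro n
    rw [h.NT_apply, h.NT_apply, Yo_apply, Yo_apply, map_add, h.Low_bb u, map_smul, h.bb_p1 u (n+1) (by omega)]
    have t1 : cV a⁻¹ * cV a = 1 := by rw [← map_mul, inv_mul_cancel₀ ha, map_one]
    have hn1 : ((n+1+1:ℕ):K) ≠ 0 := Nat.cast_ne_zero.mpr (by omega)
    have t2 : cV ((n+1+1:ℕ):K)⁻¹ * ((n:V K) + 1 + 1) = 1 := by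
      rw [show ((n:V K) + 1 + 1) = cV ((n+1+1:ℕ):K) by simp, ← map_mul, inv_mul_cancel₀ hn1, map_one]
    rw [Derivation.map_smul]
    simp only [smul_V, map_mul, map_add, cV_nat, cV_two, map_one, Nat.cast_add, Nat.cast_one] at t2 ⊢
    linear_combination (bb a u (n+1+1) f - cV a⁻¹ * cV a * bb a u (n+1) f) * t2 - bb a u (n+1) f * t1
  have e2 : bb a u (M+1) f = 0 := by
    have := h1 (M+1) (by omega)
    rw [h.NT_apply] at this
    exact (smul_eq_zero.mp this).resolve_left (inv_ne_zero (Nat.cast_ne_zero.mpr (by omega)))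
  have e3 := Finset.sum_range_sub (fun n => bb a u (n+1) f) M
  rw [e0]
  simp only [e1]
  rw [map_add, map_sum]
  simp only [add_sub_assoc, Finset.sum_add_distrib]
  rw [e3, e2, zero_add]
  abel

def ev (a : K) (J : Multiset ℕ+ → V K) (l : Multiset ℕ+) : V K →ₗ[K] K :=
  ∑ k ∈ Finset.range (S 0 (nu l) + 1), ((a ^ k * k.factorial)⁻¹ : K) • ((hl a).flip (J l) ∘ₗ LinearMap.mulLeft K (pN K 1 ^ k))
lemma ev_def (a : K) (J : Multiset ℕ+ → V K) (l) (f : V K) : ev a J l f = ∑ k ∈ Finset.range (S 0 (nu l) + 1), (a ^ k * k.factorial)⁻¹ * hl a (pN K 1 ^ k * f) (J l) := by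
  simp [ev, LinearMap.sum_apply]
lemma Hm_p1pow (k : ℕ) {d : ℕ} {f : V K} (hf : Hm d f) : Hm (k + d) (pN K 1 ^ k * f) := by
  induction k with
  | zero => simpa using hf
  | succ k ih =>
    rw [pow_succ', mul_assoc, show k + 1 + d = 1 + (k + d) by ring]
    exact Hm_mul (Hm_pN 1) ih
lemma JK.ev_Hm (h : JK a J) (l) (k : ℕ) {d : ℕ} {f : V K} (hf : Jk.Hm d f) (hk : k + d = S 0 (nu l)) : ev a J l f = (a ^ k * k.factorial)⁻¹ * hl a (pN K 1 ^ k * f) (J l) := by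
  rw [ev_def, Finset.sum_eq_single k]
  · intro b _ hb
    rw [hl_Hm a (Hm_p1pow b hf) (h.Hm l) (by omega), mul_zero]
  · intro h2; simp at h2; omega
lemma JK.ev_gt (h : JK a J) (l) {d : ℕ} {f : V K} (hf : Jk.Hm d f) (hk : S 0 (nu l) < d) : ev a J l f = 0 := by
  rw [ev_def]
  refine Finset.sum_eq_zero fun b _ => ?_
  rw [hl_Hm a (Hm_p1pow b hf) (h.Hm l) (by omega), mul_zero]
lemma JK.ev_p1 (h : JK a J) (l) {d : ℕ} {f : V K} (hf : Jk.Hm d f) : ev a J l (pN K 1 * f) = a * ((S 0 (nu l) : K) - d) * ev a J l f := by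
  have h1 : Jk.Hm (1 + d) (pN K 1 * f) := Hm_mul (Hm_pN 1) hf
  have ha := h.ha
  by_cases hd : S 0 (nu l) < d
  · rw [h.ev_gt l hf hd, h.ev_gt l h1 (by omega), mul_zero]
  by_cases hd1 : S 0 (nu l) = d
  · rw [h.ev_gt l h1 (by omega), hd1, sub_self, mul_zero, zero_mul]
  obtain ⟨k, hk⟩ : ∃ k, k + 1 + d = S 0 (nu l) := ⟨S 0 (nu l) - d - 1, by omega⟩
  rw [h.ev_Hm l (k+1) hf hk, h.ev_Hm l k h1 (by omega), ← hk, ← mul_assoc, ← pow_succ, Nat.factorial_succ, pow_succ a]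
  have h3 : (k:K) + 1 ≠ 0 := by exact_mod_cast Nat.succ_ne_zero k
  have h4 : (k.factorial : K) ≠ 0 := by exact_mod_cast k.factorial_ne_zero
  push_cast
  field_simp
  ring
lemma JK.ev_Y (h : JK a J) (l) (f : V K) : ev a J l (Yo a f) = (S 0 (nu l) : K) * ev a J l f := by
  refine V_homog (P := fun f => ev a J l (Yo a f) = (S 0 (nu l) : K) * ev a J l f) ?_ ?_ f
  · intro f g hf hg; rw [map_add, map_add, hf, hg, map_add]; ring
  · intro d f hf
    have ha := h.ha
    rw [Yo_apply, map_add, map_smul, h.ev_p1 l hf, hf, map_smul, smul_eq_mul, smul_eq_mul]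
    field_simp; ring
lemma pow_p1 (n : ℕ) : (pN K 1 ^ n : V K) = MvPolynomial.monomial (Finsupp.single 1 n) 1 := by
  rw [show pN K 1 = MvPolynomial.X (1:ℕ+) from pN_coe 1, MvPolynomial.X_pow_eq_monomial]
lemma zl_single (a : K) (n : ℕ) : zl a (Finsupp.single 1 n) = n.factorial * a ^ n := by
  rw [zl, Finsupp.prod_single_index]; · simp
  simp
lemma JK.ev_one (h : JK a J) (l) : ev a J l 1 = 1 := by
  have ha := h.ha
  rw [h.ev_Hm l (S 0 (nu l)) Hm_one (by omega), mul_one, pow_p1, hl_monomial, h.norm, zl_single]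
  have h4 : ((S 0 (nu l)).factorial : K) ≠ 0 := by exact_mod_cast Nat.factorial_ne_zero _
  simp only [one_mul, mul_one]
  field_simp
lemma JK.chain (h : JK a J) (l) (k : ℕ) : ∀ μ, hl a (pN K 1 ^ k * J μ) (J l) ≠ 0 → ∀ j, hh j (nu μ) ≤ hh j (nu l) := by
  induction k with
  | zero =>
    intro μ hne j
    by_cases e : μ = l
    · rw [e]
    · exact absurd (h.orth μ l e) (by simpa using hne)
  | succ k ih =>
    intro μ hne j
    have h1 : Jk.Hm (1 + S 0 (nu μ)) (pN K 1 * J μ) := Hm_mul (Hm_pN 1) (h.Hm μ)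
    rw [pow_succ, mul_assoc, h.expand h1, Finset.mul_sum, map_sum, LinearMap.sum_apply] at hne
    obtain ⟨κ, _, hκ⟩ := Finset.exists_ne_zero_of_sum_ne_zero hne
    rw [mul_smul_comm, map_smul, LinearMap.smul_apply, smul_eq_mul] at hκ
    have hκ1 := left_ne_zero_of_mul hκ
    have hκ2 := right_ne_zero_of_mul hκ
    obtain ⟨i, hi⟩ := h.pieri μ κ (fun h0 => hκ1 (by rw [h0, zero_div]))
    have := ih κ hκ2 j
    rw [hi j] at this; omega
lemma JK.ev_chain (h : JK a J) (l μ) (hne : ev a J l (J μ) ≠ 0) : ∀ j, hh j (nu μ) ≤ hh j (nu l) := by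
  rw [ev_def] at hne
  obtain ⟨k, _, hk⟩ := Finset.exists_ne_zero_of_sum_ne_zero hne
  exact h.chain l k μ (right_ne_zero_of_mul hk)

lemma JK.ev_unique (h : JK a J) (ρ) (χ : V K →ₗ[K] K) (hY : ∀ f, χ (Yo a f) = (S 0 (nu ρ) : K) * χ f) (h1 : χ 1 = 1)
    (hgt : ∀ κ, S 0 (nu ρ) < S 0 (nu κ) → χ (J κ) = 0) (heq : ∀ κ, S 0 (nu κ) = S 0 (nu ρ) → κ ≠ ρ → χ (J κ) = 0) (f : V K) : χ f = ev a J ρ f := by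
  have ha := h.ha
  set c := χ (J ρ) / hl a (J ρ) (J ρ) with hc
  have key : ∀ k d, k + d = S 0 (nu ρ) → ∀ f, Jk.Hm d f → χ f = c * ev a J ρ f := by
    intro k
    induction k with
    | zero =>
      intro d hd f hf
      obtain rfl : d = S 0 (nu ρ) := by omega
      rw [h.ev_Hm ρ 0 hf (by omega)]
      conv_lhs => rw [h.expand hf]
      rw [map_sum, Finset.sum_eq_single ⟨ρ, rfl⟩]
      · rw [map_smul, hc, smul_eq_mul]; simp; ring
      · intro κ _ hκ
        rw [map_smul, heq κ.1 κ.2 (fun e => hκ (Subtype.ext e)), smul_zero]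
      · intro h2; exact absurd (Finset.mem_univ _) h2
    | succ k ih =>
      intro d hd f hf
      have e1 := ih (1 + d) (by omega) _ (Hm_mul (Hm_pN 1) hf)
      have e2 := h.ev_p1 ρ hf
      have e3 := hY f
      rw [Yo_apply, map_add, map_smul, hf, map_smul, smul_eq_mul, smul_eq_mul] at e3
      rw [e1, e2, ← hd] at e3
      have h3 : (k:K) + 1 ≠ 0 := by exact_mod_cast Nat.succ_ne_zero k
      push_cast at e3
      apply mul_left_cancel₀ h3
      field_simp at e3
      linear_combination -e3
  have hc1 : c = 1 := by
    have := key (S 0 (nu ρ)) 0 (by omega) 1 Hm_one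
    rw [h1, h.ev_one] at this; simpa using this.symm
  refine V_homog (P := fun f => χ f = ev a J ρ f) ?_ ?_ f
  · intro f g hf hg; rw [map_add, map_add, hf, hg]
  · intro d f hf
    by_cases hd : d ≤ S 0 (nu ρ)
    · rw [key (S 0 (nu ρ) - d) d (by omega) f hf, hc1, one_mul]
    · rw [h.ev_gt ρ hf (by omega), h.expand hf, map_sum]
      refine Finset.sum_eq_zero fun κ _ => ?_
      rw [map_smul, hgt κ.1 (by rw [κ.2]; omega), smul_zero]

lemma Tn_Ed (f : V K) : ∀ n : ℤ, Tn n (Ed f) = Ed (Tn n f) + cV (n:K) * Tn n f := by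
  induction f using V_ind_prop with
  | h1 c =>
    intro n
    have e : Ed (cV c) = 0 := by rw [show cV c = c • (1 : V K) by rw [smul_V, mul_one], Derivation.map_smul, Derivation.map_one_eq_zero, smul_zero]
    rw [e, map_zero, Tn_Cc]
    split_ifs with hn
    · subst hn; rw [e]; simp
    · simp
  | hadd f g hf hg => intro n; rw [map_add, map_add, hf, hg, map_add, map_add]; ring
  | hp j f hf =>
    intro n
    have e1 : Ed (pN K j * f) = pN K j * Ed f + ((j:ℕ):K) • (pN K j * f) := by
      rw [Derivation.leibniz, Ed_pN, smul_V, cV_nat]; simp; ring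
    have e2 : Ed (pN K j * Tn n f) = pN K j * Ed (Tn n f) + ((j:ℕ):K) • (pN K j * Tn n f) := by
      rw [Derivation.leibniz, Ed_pN, smul_V, cV_nat]; simp; ring
    rw [e1, map_add, map_smul, Tn_mul n (j:ℕ) j.pos, Tn_mul n (j:ℕ) j.pos, hf, hf, map_add, e2]
    simp only [smul_V]
    push_cast
    simp only [map_sub]
    ring
lemma Hm_Tn (m : ℕ) (f : V K) (d : ℕ) (hf : Hm (d + m) f) : Hm d (Tn m f) := by
  have h1 : Low m (Tn (K := K) m) := by
    intro f; rw [Tn_Ed, smul_V]; simp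
  simpa using h1.Hm hf (by omega)
lemma JK.row (h : JK a J) (s : ℕ+) (l : Multiset ℕ+) (hs : ∀ x ∈ l, x ≤ s) (f : V K) :
    ev a J l (ex _ (h.LN_NN (-(a * (s:ℕ)))) 1 f) = ev a J (s ::ₘ l) f := by
  have hnu : nu (s ::ₘ l) = (s:ℕ) ::ₘ nu l := by simp [nu]
  have hS : S 0 (nu (s ::ₘ l)) = s + S 0 (nu l) := by rw [hnu]; simp [S]
  set ψ : V K →ₗ[K] K := h.mk' (fun μ => ev a J l (J μ) / Ww a s μ) with hψ
  have hψJ : ∀ μ, ψ (J μ) = ev a J l (J μ) / Ww a s μ := fun μ => h.mk'_apply _ μ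
  have hhs : hh s (nu l) = 0 := hh_max _ _ (nu_max hs)
  have hevψ : ∀ x, ev a J l x = ψ (h.Ko s x) := fun x => h.lext (S := ev a J l) (T := ψ ∘ₗ h.Ko s) (fun μ => by
    rw [LinearMap.comp_apply, h.Ko_J, map_smul, hψJ, smul_eq_mul]
    by_cases hW : Ww a s μ = 0
    · rw [hW, zero_mul]
      by_contra hne
      have h1 := h.ev_chain l μ hne s
      exact h.Ww_ne s μ (by omega) hW
    · field_simp) x
  have hψgt : ∀ d x, Jk.Hm d x → S 0 (nu l) < d → ψ x = 0 := by
    intro d x hx hd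
    rw [h.expand hx, map_sum]
    refine Finset.sum_eq_zero fun κ _ => ?_
    rw [map_smul, hψJ, h.ev_gt l (h.Hm κ.1) (by rw [κ.2]; omega), zero_div, smul_zero]
  have hφ : ∀ κ, ev a J l (ex _ (h.LN_NN (-(a * (s:ℕ)))) 1 (J κ)) ≠ 0 → S 0 (nu l) + s ≤ S 0 (nu κ) → κ = s ::ₘ l := by
    intro κ hne hle
    rw [hevψ, h.Ko_ex, h.Ko_J, map_smul, map_smul, smul_eq_mul] at hne
    have hW := left_ne_zero_of_mul hne
    have h2 := right_ne_zero_of_mul hne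
    have hκs : hh s (nu κ) = 0 := by by_contra h0; exact hW (Ww_zero a s κ h0)
    have hmax : ∀ x ∈ κ, (x:ℕ) ≤ s := by
      intro x hx
      by_contra hx2
      rw [hh, Multiset.countP_eq_zero] at hκs
      exact hκs x (by rw [nu]; exact Multiset.mem_map_of_mem _ hx) (by omega)
    rw [ex_DD, U_expand s (J κ) (fun m hm => h.Tn_gt κ m (fun x hx => lt_of_le_of_lt (by exact_mod_cast hmax x hx) hm) (by omega)), Polynomial.eval_finsetSum, map_sum] at h2
    obtain ⟨m, hm, h3⟩ := Finset.exists_ne_zero_of_sum_ne_zero h2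
    have hm : m ≤ s := by simp at hm; omega
    simp only [Polynomial.eval_mul, Polynomial.eval_pow, Polynomial.eval_X, Polynomial.eval_C, one_pow, one_mul] at h3
    have hT : Jk.Hm (S 0 (nu κ) - m) (Tn m (J κ)) := Hm_Tn m _ _ (by rw [Nat.sub_add_cancel (by omega)]; exact h.Hm κ)
    have hms : S 0 (nu κ) - m ≤ S 0 (nu l) := by
      by_contra h0; exact h3 (hψgt _ _ hT (by omega))
    obtain rfl : m = s := by omega
    have hmem : s ∈ κ := by
      by_contra h0
      apply h3
      rw [h.Tn_gt κ _ _ (by exact_mod_cast s.pos), map_zero]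
      intro x hx
      have := hmax x hx
      have : (x:ℕ) ≠ s := fun e => h0 (by rw [← PNat.coe_injective e]; exact hx)
      omega
    obtain ⟨l', rfl⟩ := Multiset.exists_cons_of_mem hmem
    obtain ⟨γ, hγ, e⟩ := h.strip s l' (fun x hx => by exact_mod_cast hmax x (Multiset.mem_cons_of_mem hx))
    rw [e, map_smul, hψJ, smul_eq_mul] at h3
    have h4 : ev a J l (J l') ≠ 0 := fun h0 => h3 (by rw [h0]; simp)
    have h5 := h.ev_chain l l' h4
    have hS' : S 0 (nu (s ::ₘ l')) = s + S 0 (nu l') := by simp [nu, S]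
    have hSS : S 0 (nu l') = S 0 (nu l) := by omega
    congr 1
    apply hh_ext
    intro j
    have e1 := S0_hh (nu l') (S 0 (nu l) + j + 1) (by omega)
    have e2 := S0_hh (nu l) (S 0 (nu l) + j + 1) (by omega)
    have e3 := e1.symm.trans (hSS.trans e2)
    exact ((Finset.sum_eq_sum_iff_of_le (fun i _ => h5 i)).mp e3) j (by simp)
  refine h.ev_unique (s ::ₘ l) (ev a J l ∘ₗ ex _ (h.LN_NN (-(a * (s:ℕ)))) 1) ?_ ?_ ?_ ?_ f
  · intro f
    rw [LinearMap.comp_apply, LinearMap.comp_apply, ex_Y _ (h.NN_Y s), map_add, h.ev_Y, map_smul, hS, smul_eq_mul]; push_cast; ring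
  · rw [LinearMap.comp_apply, ex_one, h.ev_one]
    rw [JK.NN, loc_apply _ (M := 1) (fun k hk => (h.Low_NT _ k).zero Hm_one (by omega))]
    simp [JK.NT]
  · intro κ hκ
    by_contra h0
    have := hφ κ h0 (by omega)
    rw [this] at hκ; omega
  · intro κ hκ hne
    by_contra h0
    exact hne (hφ κ h0 (by omega))
end part11
end Jk

namespace Jk
section part12
variable {K : Type} [Field K] [CharZero K] {a : K} {J : Multiset ℕ+ → V K}

/-- Sum over words of length `n` with `ℓ` letters `w` and `n - ℓ` letters `w Λ`. -/
def Wd (a : K) : ℕ → ℕ → Module.End K (M K)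
  | 0, 0 => 1
  | 0, _ + 1 => 0
  | n + 1, 0 => w * Lam a * Wd a n 0
  | n + 1, ℓ + 1 => w * Lam a * Wd a n (ℓ + 1) + w * Wd a n ℓ
lemma Wd_gt (a : K) (n : ℕ) : ∀ ℓ, n < ℓ → Wd a n ℓ = 0 := by
  induction n with
  | zero => intro ℓ hℓ; obtain ⟨k, rfl⟩ : ∃ k, ℓ = k + 1 := ⟨ℓ - 1, by omega⟩; rw [Wd]
  | succ n ih =>
    intro ℓ hℓ; obtain ⟨k, rfl⟩ : ∃ k, ℓ = k + 1 := ⟨ℓ - 1, by omega⟩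
    rw [Wd, ih _ (by omega), ih _ (by omega)]; simp
lemma Wd_diag (a : K) (n : ℕ) : Wd a n n = w ^ n := by
  induction n with
  | zero => rw [Wd]; simp
  | succ n ih => rw [Wd, Wd_gt a n _ (by omega), ih, pow_succ']; simp
lemma Xu_pow (a u : K) (n : ℕ) : (Xu a u) ^ n = ∑ ℓ ∈ Finset.range (n + 1), u ^ ℓ • Wd a n ℓ := by
  induction n with
  | zero => simp [Wd]
  | succ n ih =>
    rw [pow_succ', ih, Xu, Finset.sum_range_succ' _ (n + 1)]
    simp only [Wd, smul_add, Finset.sum_add_distrib]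
    rw [mul_add, add_mul, mul_smul_comm, mul_one, smul_mul_assoc, Finset.mul_sum, Finset.mul_sum, Finset.smul_sum]
    simp only [mul_smul_comm, smul_smul, ← pow_succ']
    rw [Finset.sum_range_succ' _ n]
    rw [Finset.sum_range_succ (fun x => u ^ (x + 1) • (w * Lam a * Wd a n (x + 1))) n, Wd_gt a n (n+1) (by omega)]
    simp only [mul_zero, smul_zero, add_zero]
    abel
def Bcg (a : K) (n ℓ : ℕ) : Module.End K (V K) := a⁻¹ • (Tht ∘ₗ (Wd a n ℓ : Module.End K (M K)) ∘ₗ iot)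
lemma Bcg_gt (a : K) (n ℓ : ℕ) (h : n < ℓ) : Bcg a n ℓ = 0 := by rw [Bcg, Wd_gt a n ℓ h]; simp
lemma Bcg_diag (a : K) (n : ℕ) (f : V K) : Bcg a n n f = a⁻¹ • (pN K n * f) := by
  have e : ∀ n, ((w : Module.End K (M K)) ^ n) (Polynomial.C f) = Polynomial.X ^ n * Polynomial.C f := by
    intro n
    induction n with
    | zero => simp
    | succ n ih =>
      rw [pow_succ', Module.End.mul_apply, ih, pow_succ', mul_assoc]; rfl
  rw [Bcg, Wd_diag]
  show a⁻¹ • Tht ((w ^ n : Module.End K (M K)) (Polynomial.C f)) = _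
  rw [e, Tht_apply]
lemma Bn_Bcg (a u : K) (n : ℕ) (f : V K) : Bn a u n f = ∑ ℓ ∈ Finset.range (n + 1), u ^ ℓ • Bcg a n ℓ f := by
  have : Bn a u n f = a⁻¹ • Tht (((Xu a u) ^ n : Module.End K (M K)) (iot f)) := rfl
  rw [this, Xu_pow, LinearMap.sum_apply, map_sum, Finset.smul_sum]
  refine Finset.sum_congr rfl fun ℓ _ => ?_
  rw [LinearMap.smul_apply, map_smul, smul_comm]; rfl
def bm (a : K) (n ℓ : ℕ) (μ ρ : Multiset ℕ+) : K := MvPolynomial.coeff (Multiset.toFinsupp μ) (Bcg a n ℓ (pm ρ))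
lemma poly0 (I : Set K) (hI : I.Infinite) (N : ℕ) (x : ℕ → K) (h : ∀ u ∈ I, ∑ ℓ ∈ Finset.range N, u ^ ℓ * x ℓ = 0) (ℓ : ℕ) (hℓ : ℓ < N) : x ℓ = 0 := by
  set p : Polynomial K := ∑ ℓ ∈ Finset.range N, Polynomial.C (x ℓ) * Polynomial.X ^ ℓ with hp
  have h0 : p = 0 := by
    apply Polynomial.eq_zero_of_infinite_isRoot
    refine hI.mono fun u hu => ?_
    show Polynomial.eval u p = 0
    rw [hp, Polynomial.eval_finsetSum, ← h u hu]
    refine Finset.sum_congr rfl fun i _ => ?_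
    rw [Polynomial.eval_mul, Polynomial.eval_C, Polynomial.eval_pow, Polynomial.eval_X, mul_comm]
  have h1 := congrArg (fun q => Polynomial.coeff q ℓ) h0
  simp only [hp, Polynomial.finsetSum_coeff, Polynomial.coeff_C_mul_X_pow, Polynomial.coeff_zero] at h1
  rw [Finset.sum_ite_eq, if_pos (by simpa using hℓ)] at h1
  exact h1

def ee (a : K) (μ : Multiset ℕ+) : V K := (zl a (Multiset.toFinsupp μ))⁻¹ • pm μ
lemma Hm_ee (μ) : Hm (S 0 (nu μ)) (ee a μ) := Hm_smul _ (Hm_pm μ)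
lemma hl_ee (ha : a ≠ 0) (μ) (f : V K) : hl a f (ee a μ) = MvPolynomial.coeff (Multiset.toFinsupp μ) f := by
  rw [ee, map_smul, hl_comm, hl_pm, smul_eq_mul, inv_mul_cancel_left₀ (zl_ne a ha _)]
lemma coeff_pm (ρ μ : Multiset ℕ+) : MvPolynomial.coeff (Multiset.toFinsupp μ) (pm (K := K) ρ) = if ρ = μ then 1 else 0 := by
  rw [pm, MvPolynomial.coeff_monomial]; simp
lemma pm_ee (ha : a ≠ 0) (ρ μ) : hl a (pm ρ) (ee a μ) = if ρ = μ then 1 else 0 := by rw [hl_ee ha, coeff_pm]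
lemma cE_ext (ha : a ≠ 0) {x y : V K} (h : ∀ ρ, hl a (pm ρ) x = hl a (pm ρ) y) : x = y := by
  ext m
  obtain ⟨l, rfl⟩ := toFinsupp_surj m
  have := h l
  rw [hl_pm, hl_pm] at this
  exact mul_left_cancel₀ (zl_ne a ha _) this
lemma e_ext (ha : a ≠ 0) {N : Type} [AddCommGroup N] [Module K N] {S T : V K →ₗ[K] N} (h : ∀ μ, S (ee a μ) = T (ee a μ)) (f : V K) : S f = T f := by
  have : S = T := by
    refine (MvPolynomial.basisMonomials ℕ+ K).ext fun m => ?_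
    obtain ⟨l, rfl⟩ := toFinsupp_surj m
    have := h l
    rw [ee, map_smul, map_smul] at this
    have := smul_right_injective N (inv_ne_zero (zl_ne a ha _)) this
    simpa [pm] using this
  rw [this]
def mkE (a : K) {N : Type} [AddCommGroup N] [Module K N] (φ : Multiset ℕ+ → N) : V K →ₗ[K] N :=
  (MvPolynomial.basisMonomials ℕ+ K).constr K (fun m => zl a m • φ (Finsupp.toMultiset m))
lemma mkE_ee (ha : a ≠ 0) {N : Type} [AddCommGroup N] [Module K N] (φ : Multiset ℕ+ → N) (μ) : mkE a φ (ee a μ) = φ μ := by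
  rw [ee, map_smul, mkE]
  have : pm (K := K) μ = MvPolynomial.basisMonomials ℕ+ K (Multiset.toFinsupp μ) := by simp [pm]
  rw [this, Module.Basis.constr_basis, smul_smul, inv_mul_cancel₀ (zl_ne a ha _), one_smul]; simp
lemma JK.bm_zero (h : JK a J) (n ℓ : ℕ) (hn : 1 ≤ n) (μ ρ) (hd : S 0 (nu μ) ≠ S 0 (nu ρ) + n) : bm a n ℓ μ ρ = 0 := by
  have ha := h.ha
  by_cases hℓ : n < ℓ
  · rw [bm, Bcg_gt a n ℓ hℓ]; simp
  refine poly0 Set.univ Set.infinite_univ (n+1) (fun ℓ => bm a n ℓ μ ρ) (fun u _ => ?_) ℓ (by omega)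
  have e1 : ∑ ℓ ∈ Finset.range (n+1), u ^ ℓ * bm a n ℓ μ ρ = MvPolynomial.coeff (Multiset.toFinsupp μ) (Bn a u n (pm ρ)) := by
    rw [Bn_Bcg, MvPolynomial.coeff_sum]; rfl
  rw [e1, ← hl_ee ha]
  have e2 := hl_bb a u ha n hn (pm ρ) (ee a μ)
  have e3 : hl a (pm ρ) (bb a u n (ee a μ)) = 0 := by
    by_cases hle : n ≤ S 0 (nu μ)
    · exact hl_Hm a (Hm_pm ρ) ((h.Low_bb u n).Hm (Hm_ee μ) hle) (by omega)
    · rw [(h.Low_bb u n).zero (Hm_ee μ) (by omega), map_zero]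
  rw [e3] at e2
  exact (mul_eq_zero.mp e2.symm).resolve_left (by simp)
lemma PPfin (n : ℕ) : {l : Multiset ℕ+ | S 0 (nu l) = n}.Finite :=
  @Set.toFinite _ {l : Multiset ℕ+ | S 0 (nu l) = n} (inferInstanceAs (Finite (PP n)))
lemma JK.bm_fin1 (h : JK a J) (n ℓ : ℕ) (hn : 1 ≤ n) (μ) : {ρ | bm a n ℓ μ ρ ≠ 0}.Finite := by
  refine (PPfin (S 0 (nu μ) - n)).subset fun ρ hρ => ?_
  by_contra h2
  exact hρ (h.bm_zero n ℓ hn μ ρ (fun e => h2 (by show S 0 (nu ρ) = _; omega)))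
lemma JK.bm_fin2 (h : JK a J) (n ℓ : ℕ) (hn : 1 ≤ n) (ρ) : {μ | bm a n ℓ μ ρ ≠ 0}.Finite := by
  refine (PPfin (S 0 (nu ρ) + n)).subset fun μ hμ => ?_
  by_contra h2
  exact hμ (h.bm_zero n ℓ hn μ ρ h2)
lemma bm_diag (ha : a ≠ 0) (ℓ : ℕ+) (π ρ) : bm a ℓ ℓ π ρ = if π = ℓ ::ₘ ρ then a⁻¹ else 0 := by
  rw [bm, Bcg_diag, ← pm_cons, MvPolynomial.coeff_smul, coeff_pm]
  by_cases e : π = ℓ ::ₘ ρ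
  · simp [e]
  · rw [if_neg (fun h => e h.symm), if_neg e, smul_zero]
lemma bm_gt (n ℓ : ℕ) (hn : n < ℓ) (π ρ) : bm a n ℓ π ρ = 0 := by rw [bm, Bcg_gt a n ℓ hn]; simp

def bl (a : K) (n ℓ : ℕ) : Module.End K (V K) := mkE a (fun μ => (-1) ^ n • ∑ᶠ ρ, bm a n ℓ μ ρ • ee a ρ)
lemma bl_ee (ha : a ≠ 0) (n ℓ : ℕ) (μ) : bl a n ℓ (ee a μ) = (-1:K) ^ n • ∑ᶠ ρ, bm a n ℓ μ ρ • ee a ρ := by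
  rw [bl, mkE_ee ha]
  rcases Nat.even_or_odd n with hn | hn <;> simp [hn.neg_one_pow]
lemma finsum_lin {N N' ι : Type} [AddCommGroup N] [Module K N] [AddCommGroup N'] [Module K N'] (T : N →ₗ[K] N') (c : ι → K) (v : ι → N) (hc : {i | c i ≠ 0}.Finite) :
    T (∑ᶠ i, c i • v i) = ∑ᶠ i, c i • T (v i) := by
  rw [finsum_eq_sum_of_support_subset (s := hc.toFinset), finsum_eq_sum_of_support_subset (s := hc.toFinset), map_sum]
  · simp only [map_smul]
  · intro i hi; simp at hi ⊢; exact fun h => hi.1 h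
  · intro i hi; simp at hi ⊢; exact fun h => hi.1 h
lemma cE_finsum (ha : a ≠ 0) (c : Multiset ℕ+ → K) (hc : {i | c i ≠ 0}.Finite) (ρ) : hl a (pm ρ) (∑ᶠ π, c π • ee a π) = c ρ := by
  rw [finsum_lin _ _ _ hc, finsum_eq_single _ ρ]
  · rw [pm_ee ha]; simp
  · intro x hx; rw [pm_ee ha, if_neg (fun e => hx e.symm), smul_zero]
lemma JK.bb_bl (h : JK a J) (u : K) (n : ℕ) (hn : 1 ≤ n) (f : V K) : bb a u n f = ∑ ℓ ∈ Finset.range (n+1), u ^ ℓ • bl a n ℓ f := by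
  have ha := h.ha
  have := e_ext ha (S := bb a u n) (T := ∑ ℓ ∈ Finset.range (n+1), u ^ ℓ • bl a n ℓ) (fun μ => ?_) f
  · rw [this, LinearMap.sum_apply]; rfl
  apply cE_ext ha
  intro ρ
  rw [hl_bb a u ha n hn, hl_ee ha, Bn_Bcg, LinearMap.sum_apply, map_sum, MvPolynomial.coeff_sum, Finset.mul_sum]
  refine Finset.sum_congr rfl fun ℓ _ => ?_
  rw [LinearMap.smul_apply, map_smul, bl_ee ha, map_smul, cE_finsum ha _ (h.bm_fin1 n ℓ hn μ), MvPolynomial.coeff_smul]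
  simp only [smul_eq_mul, bm]; ring
lemma JK.bb_unif (h : JK a J) (f : V K) : ∃ M, ∀ u k, M ≤ k → bb a u k f = 0 := by
  refine V_homog (P := fun f => ∃ M, ∀ u k, M ≤ k → bb a u k f = 0) ?_ ?_ f
  · rintro f g ⟨d1, h1⟩ ⟨d2, h2⟩
    refine ⟨max d1 d2, fun u k hk => ?_⟩
    rw [map_add, h1 u k (le_trans (le_max_left _ _) hk), h2 u k (le_trans (le_max_right _ _) hk), add_zero]
  · exact fun d f hf => ⟨d + 1, fun u k hk => (h.Low_bb u k).zero hf (by omega)⟩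
def nl (a : K) (M ℓ : ℕ) (f : V K) : V K := ∑ n ∈ Finset.range M, (n:K)⁻¹ • bl a n ℓ f
lemma bl_gt (ha : a ≠ 0) (n ℓ : ℕ) (hn : n < ℓ) (f : V K) : bl a n ℓ f = 0 :=
  e_ext ha (S := bl a n ℓ) (T := 0) (fun μ => by rw [bl_ee ha]; simp [bm_gt n ℓ hn]) f
lemma JK.NN_nl (h : JK a J) (u : K) (M : ℕ) (f : V K) (hM : ∀ k, M ≤ k → bb a u k f = 0) : h.NN u f = ∑ ℓ ∈ Finset.range M, u ^ ℓ • nl a M ℓ f := by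
  rw [JK.NN, loc_apply _ (M := M) (fun k hk => by rw [h.NT_apply, hM k hk, smul_zero])]
  simp only [nl, Finset.smul_sum]
  rw [Finset.sum_comm]
  refine Finset.sum_congr rfl fun n hn => ?_
  have hn : n < M := by simpa using hn
  rw [h.NT_apply]
  rcases Nat.eq_zero_or_pos n with rfl | hn0
  · simp
  · rw [h.bb_bl u n hn0, Finset.smul_sum]
    rw [Finset.sum_subset (s₂ := Finset.range M)]
    · exact Finset.sum_congr rfl fun ℓ _ => smul_comm _ _ _
    · intro x hx; simp at hx ⊢; omega
    · intro x _ hx; rw [bl_gt h.ha n x (by simp at hx; omega)]; simp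

lemma JK.rows (h : JK a J) (s : ℕ+) (l : Multiset ℕ+) (hs : ∀ x ∈ l, x ≤ s) (j : ℕ) : ∀ f : V K,
    ev a J l (ex _ (h.LN_NN (-(a * (s:ℕ)))) (j:K) f) = ev a J (Multiset.replicate j s + l) f := by
  induction j with
  | zero =>
    intro f
    obtain ⟨d, hd⟩ := h.LN_NN (-(a * (s:ℕ))) f
    rw [ex_apply _ _ (M := d + 1) (fun k hk => hd k (by omega)), Finset.sum_range_succ']
    simp
  | succ j ih =>
    intro f
    rw [Nat.cast_succ, ← ex_add, ih, h.row s, Multiset.replicate_succ, Multiset.cons_add]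
    intro x hx
    rw [Multiset.mem_add] at hx
    rcases hx with hx | hx
    · rw [Multiset.eq_of_mem_replicate hx]
    · exact hs x hx
def exP (N : Module.End K (V K)) (φ : V K →ₗ[K] K) (M : ℕ) (f : V K) : Polynomial K := ∑ k ∈ Finset.range M, Polynomial.C ((k.factorial : K)⁻¹ * φ ((N ^ k) f)) * Polynomial.X ^ k
lemma exP_eval {N : Module.End K (V K)} (hN : LN N) (φ : V K →ₗ[K] K) {M : ℕ} {f : V K} (hM : ∀ k, M ≤ k → (N ^ k) f = 0) (t : K) : φ (ex N hN t f) = (exP N φ M f).eval t := by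
  rw [ex_apply hN t hM, map_sum, exP, Polynomial.eval_finsetSum]
  refine Finset.sum_congr rfl fun k _ => ?_
  rw [map_smul]; simp; ring
lemma exP_coeff (N : Module.End K (V K)) (φ : V K →ₗ[K] K) (M : ℕ) (f : V K) (k : ℕ) (hk : k < M) : (exP N φ M f).coeff k = (k.factorial : K)⁻¹ * φ ((N ^ k) f) := by
  rw [exP]
  simp only [Polynomial.finsetSum_coeff, Polynomial.coeff_C_mul_X_pow]
  rw [Finset.sum_ite_eq, if_pos (by simpa using hk)]
lemma JK.leib (h : JK a J) (s : ℕ+) (l : Multiset ℕ+) (hs : ∀ x ∈ l, x ≤ s) (x y z : V K) (hz : ∀ l, ev a J l z = ev a J l x * ev a J l y) :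
    ev a J l (h.NN (-(a * (s:ℕ))) z) = ev a J l (h.NN (-(a * (s:ℕ))) x) * ev a J l y + ev a J l x * ev a J l (h.NN (-(a * (s:ℕ))) y) := by
  set N := h.NN (-(a * (s:ℕ))) with hN
  have hL : LN N := h.LN_NN _
  obtain ⟨d1, h1⟩ := hL x
  obtain ⟨d2, h2⟩ := hL y
  obtain ⟨d3, h3⟩ := hL z
  obtain ⟨M, hM1, hM2, hM3, hM⟩ : ∃ M, d1 ≤ M ∧ d2 ≤ M ∧ d3 ≤ M ∧ 2 ≤ M := ⟨d1 + d2 + d3 + 2, by omega, by omega, by omega, by omega⟩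
  have e : exP N (ev a J l) M z = exP N (ev a J l) M x * exP N (ev a J l) M y := by
    rw [← sub_eq_zero]
    apply Polynomial.eq_zero_of_infinite_isRoot
    refine (Set.infinite_range_of_injective (Nat.cast_injective (R := K))).mono ?_
    rintro _ ⟨j, rfl⟩
    show Polynomial.eval _ _ = 0
    rw [Polynomial.eval_sub, Polynomial.eval_mul, ← exP_eval hL _ (fun k hk => h1 k (by omega)), ← exP_eval hL _ (fun k hk => h2 k (by omega)), ← exP_eval hL _ (fun k hk => h3 k (by omega))]
    rw [h.rows s l hs, h.rows s l hs, h.rows s l hs, hz, sub_self]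
  have e1 := congrArg (fun p => Polynomial.coeff p 1) e
  simp only [Polynomial.mul_coeff_one] at e1
  rw [exP_coeff _ _ _ _ _ (by omega), exP_coeff _ _ _ _ _ (by omega), exP_coeff _ _ _ _ _ (by omega), exP_coeff _ _ _ _ _ (by omega), exP_coeff _ _ _ _ _ (by omega)] at e1
  simp at e1
  rw [e1]; ring

lemma JK.ev_inj (h : JK a J) (x : V K) (hx : ∀ l, ev a J l x = 0) : x = 0 := by
  apply h.ext0
  have key : ∀ n, ∀ l, S 0 (nu l) = n → hl a x (J l) = 0 := by
    intro n
    induction n using Nat.strong_induction_on with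
    | _ n ih =>
      intro l hl'
      have c0 : ∀ k d y, Jk.Hm d y → d < n + k → hl a (pN K 1 ^ k * x) y = 0 := by
        intro k
        induction k with
        | zero =>
          intro d y hy hd
          rw [pow_zero, one_mul, h.expand hy, map_sum]
          exact Finset.sum_eq_zero fun κ _ => by rw [map_smul, ih d (by omega) κ.1 κ.2, smul_zero]
        | succ k ihk =>
          intro d y hy hd
          rw [pow_succ', mul_assoc, hl_pN, map_smul]
          have hL := Low_dT (K := K) 1
          rcases Nat.eq_zero_or_pos d with rfl | hd0
          · have : pd 1 y = 0 := hL.zero hy (by omega)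
            rw [this]; simp
          · have : Jk.Hm (d - 1) (pd 1 y) := hL.Hm hy (by omega)
            rw [ihk (d-1) _ this (by omega), smul_zero]
      have e := hx l
      rw [ev_def, Finset.sum_range_succ', Finset.sum_eq_zero, zero_add] at e
      · simpa using e
      · intro k _
        rw [c0 (k+1) n _ (by rw [← hl']; exact h.Hm l) (by omega), mul_zero]
  exact fun l => key _ l rfl

structure SC (a : K) (J : Multiset ℕ+ → V K) (g : Multiset ℕ+ → Multiset ℕ+ → Multiset ℕ+ → K) : Prop where
  fin : ∀ μ ν, {π | g π μ ν ≠ 0}.Finite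
  mul : ∀ μ ν l, ev a J l (ee a μ) * ev a J l (ee a ν) = ∑ᶠ π, g π μ ν * ev a J l (ee a π)
def st (a : K) (g : Multiset ℕ+ → Multiset ℕ+ → Multiset ℕ+ → K) (μ ν : Multiset ℕ+) : V K := ∑ᶠ π, g π μ ν • ee a π
variable {g : Multiset ℕ+ → Multiset ℕ+ → Multiset ℕ+ → K}
lemma SC.ev_st (hg : SC a J g) (μ ν l) : ev a J l (st a g μ ν) = ev a J l (ee a μ) * ev a J l (ee a ν) := by
  rw [st, finsum_lin _ _ _ (hg.fin μ ν), hg.mul]; rfl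
lemma SC.nl_st (hg : SC a J g) (h : JK a J) (μ ν) (ℓ : ℕ) : ∃ M0, ∀ M, M0 ≤ M → nl a M ℓ (st a g μ ν) =
    ∑ n ∈ Finset.range M, ((n:K)⁻¹ * (-1) ^ n) • (∑ᶠ μ', bm a n ℓ μ μ' • st a g μ' ν + ∑ᶠ ν', bm a n ℓ ν ν' • st a g μ ν') := by
  have ha := h.ha
  obtain ⟨d1, h1⟩ := h.bb_unif (ee a μ)
  obtain ⟨d2, h2⟩ := h.bb_unif (ee a ν)
  obtain ⟨d3, h3⟩ := h.bb_unif (st a g μ ν)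
  refine ⟨d1 + d2 + d3 + ℓ + 1, fun M hM => ?_⟩
  rw [← sub_eq_zero]
  apply h.ev_inj
  intro l
  have key : ev a J l (nl a M ℓ (st a g μ ν)) - (ev a J l (nl a M ℓ (ee a μ)) * ev a J l (ee a ν) + ev a J l (ee a μ) * ev a J l (nl a M ℓ (ee a ν))) = 0 := by
    obtain ⟨s0, hs0⟩ : ∃ s0 : ℕ, ∀ x ∈ l, (x:ℕ) ≤ s0 := by
      refine ⟨S 0 (nu l), fun x hx => ?_⟩
      have : (x:ℕ) ∈ nu l := Multiset.mem_map_of_mem _ hx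
      exact Multiset.single_le_sum (fun _ _ => Nat.zero_le _) _ (by simpa [S] using this)
    refine poly0 (Set.range (fun j : ℕ => -(a * ((s0 + j + 1 : ℕ):K)))) (Set.infinite_range_of_injective ?_) M
      (fun ℓ => ev a J l (nl a M ℓ (st a g μ ν)) - (ev a J l (nl a M ℓ (ee a μ)) * ev a J l (ee a ν) + ev a J l (ee a μ) * ev a J l (nl a M ℓ (ee a ν)))) ?_ ℓ (by omega)
    · intro i j hij
      have h5 := mul_left_cancel₀ ha (neg_injective hij)
      have : s0 + i + 1 = s0 + j + 1 := by exact_mod_cast h5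
      omega
    · rintro _ ⟨j, rfl⟩
      set u := -(a * ((s0 + j + 1 : ℕ):K)) with hu
      have e := h.leib ⟨s0 + j + 1, by omega⟩ l (fun x hx => by
        have := hs0 x hx
        exact (PNat.coe_le_coe _ _).mp (by show (x:ℕ) ≤ s0 + j + 1; omega)) (ee a μ) (ee a ν) (st a g μ ν) (fun l => hg.ev_st μ ν l)
      rw [PNat.mk_coe, ← hu, h.NN_nl u M _ (fun k hk => h1 u k (by omega)), h.NN_nl u M _ (fun k hk => h2 u k (by omega)), h.NN_nl u M _ (fun k hk => h3 u k (by omega))] at e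
      simp only [map_sum, map_smul, smul_eq_mul] at e
      simp only [mul_sub, mul_add, Finset.sum_sub_distrib, Finset.sum_add_distrib]
      rw [e, Finset.sum_mul, Finset.mul_sum]
      rw [sub_eq_zero]
      congr 1
      · exact Finset.sum_congr rfl fun i _ => by ring
      · exact Finset.sum_congr rfl fun i _ => by ring
  rw [map_sub, ← key]
  congr 1
  simp only [nl, map_sum, map_smul, smul_eq_mul, bl_ee ha, map_add]
  rw [Finset.sum_mul, Finset.mul_sum, ← Finset.sum_add_distrib]
  refine Finset.sum_congr rfl fun n _ => ?_
  rcases Nat.eq_zero_or_pos n with rfl | hn0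
  · simp
  rw [finsum_lin _ _ _ (h.bm_fin1 n ℓ hn0 μ), finsum_lin _ _ _ (h.bm_fin1 n ℓ hn0 ν), finsum_lin _ _ _ (h.bm_fin1 n ℓ hn0 μ), finsum_lin _ _ _ (h.bm_fin1 n ℓ hn0 ν)]
  simp only [hg.ev_st, smul_eq_mul]
  have e1 : ∑ᶠ i, bm a n ℓ μ i * (ev a J l (ee a i) * ev a J l (ee a ν)) = (∑ᶠ i, bm a n ℓ μ i * ev a J l (ee a i)) * ev a J l (ee a ν) := by
    have := finsum_lin (LinearMap.mulRight K (ev a J l (ee a ν))) (bm a n ℓ μ) (fun i => ev a J l (ee a i)) (h.bm_fin1 n ℓ hn0 μ)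
    simpa using this.symm
  have e2 : ∑ᶠ i, bm a n ℓ ν i * (ev a J l (ee a μ) * ev a J l (ee a i)) = ev a J l (ee a μ) * (∑ᶠ i, bm a n ℓ ν i * ev a J l (ee a i)) := by
    have := finsum_lin (LinearMap.mulLeft K (ev a J l (ee a μ))) (bm a n ℓ ν) (fun i => ev a J l (ee a i)) (h.bm_fin1 n ℓ hn0 ν)
    simpa using this.symm
  rw [e1, e2]; ring
lemma SC.cE_st (hg : SC a J g) (ha : a ≠ 0) (μ ν ρ) : hl a (pm ρ) (st a g μ ν) = g ρ μ ν := cE_finsum ha (fun π => g π μ ν) (hg.fin μ ν) ρ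
lemma SC.main (hg : SC a J g) (h : JK a J) (μ ν) (ℓ : ℕ) : ∃ M0, ∀ M, M0 ≤ M → ∀ ρ,
    ∑ n ∈ Finset.Icc 1 M, ((-1:K) ^ n / n) * (∑ᶠ μ', bm a n ℓ μ μ' * g ρ μ' ν + ∑ᶠ ν', bm a n ℓ ν ν' * g ρ μ ν')
    = ∑ n ∈ Finset.Icc 1 M, ((-1:K) ^ n / n) * ∑ᶠ π, bm a n ℓ π ρ * g π μ ν := by
  have ha := h.ha
  obtain ⟨M0, hM0⟩ := hg.nl_st h μ ν ℓ
  refine ⟨M0, fun M hM ρ => ?_⟩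
  have e := congrArg (hl a (pm ρ)) (hM0 (M+1) (by omega))
  rw [nl, map_sum, map_sum] at e
  have hI : Finset.range (M+1) = insert 0 (Finset.Icc 1 M) := by ext x; simp; omega
  rw [hI, Finset.sum_insert (by simp), Finset.sum_insert (by simp)] at e
  simp only [Nat.cast_zero, inv_zero, zero_smul, map_zero, zero_add, zero_mul] at e
  refine Eq.trans (Finset.sum_congr rfl ?_) (e.symm.trans (Finset.sum_congr rfl ?_))
  · intro n hn
    have hn : 1 ≤ n := (Finset.mem_Icc.mp hn).1
    rw [map_smul, map_add, finsum_lin _ _ _ (h.bm_fin1 n ℓ hn μ), finsum_lin _ _ _ (h.bm_fin1 n ℓ hn ν)]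
    simp only [hg.cE_st ha, smul_eq_mul]
    rw [div_eq_inv_mul]
  · intro n hn
    have hn : 1 ≤ n := (Finset.mem_Icc.mp hn).1
    rw [map_smul, st, finsum_lin _ _ _ (hg.fin μ ν), finsum_lin _ _ _ (hg.fin μ ν)]
    have e2 : ∀ π, g π μ ν • hl a (pm ρ) (bl a n ℓ (ee a π)) = g π μ ν • ((-1:K) ^ n * bm a n ℓ π ρ) := by
      intro π
      rw [bl_ee ha, map_smul, cE_finsum ha _ (h.bm_fin1 n ℓ hn π), smul_eq_mul ((-1:K)^n)]
    simp only [e2]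
    have e3 := finsum_lin (LinearMap.mulLeft K ((-1:K)^n)) (fun π => g π μ ν) (fun π => bm a n ℓ π ρ) (hg.fin μ ν)
    simp only [LinearMap.mulLeft_apply] at e3
    rw [← e3, div_eq_inv_mul, smul_eq_mul, mul_assoc]
    simp only [smul_eq_mul, mul_comm]
end part12
end Jk

namespace Jk
section part13
variable {K : Type} [Field K] [CharZero K] {a : K} {J : Multiset ℕ+ → V K} {g : Multiset ℕ+ → Multiset ℕ+ → Multiset ℕ+ → K}

lemma S0_cons (x : ℕ+) (l : Multiset ℕ+) : S 0 (nu (x ::ₘ l)) = x + S 0 (nu l) := by simp [S, nu]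
lemma S0_zero : S 0 (nu 0) = 0 := by simp [S, nu]
lemma S0_eq_zero (l : Multiset ℕ+) (h : S 0 (nu l) = 0) : l = 0 := by
  induction l using Multiset.induction with
  | empty => rfl
  | cons x l _ => rw [S0_cons] at h; have := x.pos; omega

/-- The truncated equation between coefficient families. -/
def Eqn (a : K) (D : Multiset ℕ+ → Multiset ℕ+ → Multiset ℕ+ → K) (M ℓ : ℕ) (ρ μ ν : Multiset ℕ+) : Prop :=
    ∑ n ∈ Finset.Icc 1 M, ((-1:K) ^ n / n) * (∑ᶠ μ', bm a n ℓ μ μ' * D ρ μ' ν + ∑ᶠ ν', bm a n ℓ ν ν' * D ρ μ ν')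
    = ∑ n ∈ Finset.Icc 1 M, ((-1:K) ^ n / n) * ∑ᶠ π, bm a n ℓ π ρ * D π μ ν
lemma JK.step (h : JK a J) {D : Multiset ℕ+ → Multiset ℕ+ → Multiset ℕ+ → K} {M : ℕ} (ℓ : ℕ+) (ρ μ ν : Multiset ℕ+) (hE : Eqn a D M ℓ ρ μ ν) (hM : ℓ ≤ M)
    (A1 : ∀ μ', S 0 (nu μ') + ℓ ≤ S 0 (nu μ) → D ρ μ' ν = 0) (A2 : ∀ ν', S 0 (nu ν') + ℓ ≤ S 0 (nu ν) → D ρ μ ν' = 0)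
    (B : ∀ π, ℓ + S 0 (nu ρ) < S 0 (nu π) → D π μ ν = 0) : D (ℓ ::ₘ ρ) μ ν = 0 := by
  have ha := h.ha
  rw [Eqn, Finset.sum_eq_zero, Finset.sum_eq_single_of_mem (ℓ:ℕ)] at hE
  · rw [finsum_eq_single _ (ℓ ::ₘ ρ)] at hE
    · rw [bm_diag ha, if_pos rfl] at hE
      have e1 : ((-1:K) ^ (ℓ:ℕ) / (ℓ:ℕ)) ≠ 0 := div_ne_zero (by simp) (by simp)
      have := (mul_eq_zero.mp hE.symm).resolve_left e1
      exact (mul_eq_zero.mp this).resolve_left (inv_ne_zero ha)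
    · intro π hπ; rw [bm_diag ha, if_neg hπ, zero_mul]
  · exact Finset.mem_Icc.mpr ⟨ℓ.pos, hM⟩
  · intro m hm hmℓ
    rw [finsum_eq_zero_of_forall_eq_zero, mul_zero]
    intro π
    by_cases h1 : m < ℓ
    · rw [bm_gt m ℓ h1, zero_mul]
    · by_cases h2 : S 0 (nu π) = S 0 (nu ρ) + m
      · rw [B π (by omega), mul_zero]
      · rw [h.bm_zero m ℓ (Finset.mem_Icc.mp hm).1 _ _ h2, zero_mul]
  · intro m hm
    rw [finsum_eq_zero_of_forall_eq_zero, finsum_eq_zero_of_forall_eq_zero, add_zero, mul_zero]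
    all_goals
      intro μ'
      by_cases h1 : m < ℓ
      · rw [bm_gt m ℓ h1, zero_mul]
    · by_cases h2 : S 0 (nu ν) = S 0 (nu μ') + m
      · rw [A2 μ' (by omega), mul_zero]
      · rw [h.bm_zero m ℓ (Finset.mem_Icc.mp hm).1 _ _ h2, zero_mul]
    · by_cases h2 : S 0 (nu μ) = S 0 (nu μ') + m
      · rw [A1 μ' (by omega), mul_zero]
      · rw [h.bm_zero m ℓ (Finset.mem_Icc.mp hm).1 _ _ h2, zero_mul]
lemma Eqn_trunc (h : JK a J) {D : Multiset ℕ+ → Multiset ℕ+ → Multiset ℕ+ → K} {M k : ℕ} (ℓ : ℕ) (ρ μ ν : Multiset ℕ+) (hE : Eqn a D M ℓ ρ μ ν) (hM : k ≤ M)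
    (A1 : ∀ μ', S 0 (nu μ') + k < S 0 (nu μ) → D ρ μ' ν = 0) (A2 : ∀ ν', S 0 (nu ν') + k < S 0 (nu ν) → D ρ μ ν' = 0)
    (B : ∀ π, k + S 0 (nu ρ) < S 0 (nu π) → D π μ ν = 0) : Eqn a D k ℓ ρ μ ν := by
  rw [Eqn] at hE ⊢
  have hs : Finset.Icc 1 k ⊆ Finset.Icc 1 M := Finset.Icc_subset_Icc_right hM
  rw [Finset.sum_subset hs, Finset.sum_subset hs, hE]
  all_goals
    intro m hm hm'
    obtain ⟨hm1, hm2⟩ := Finset.mem_Icc.mp hm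
    have hk : k < m := by
      by_contra hc
      exact hm' (Finset.mem_Icc.mpr ⟨hm1, by omega⟩)
  · rw [finsum_eq_zero_of_forall_eq_zero, mul_zero]
    intro π
    by_cases h2 : S 0 (nu π) = S 0 (nu ρ) + m
    · rw [B π (by omega), mul_zero]
    · rw [h.bm_zero m ℓ hm1 _ _ h2, zero_mul]
  · rw [finsum_eq_zero_of_forall_eq_zero, finsum_eq_zero_of_forall_eq_zero, add_zero, mul_zero]
    all_goals intro μ'
    · by_cases h2 : S 0 (nu ν) = S 0 (nu μ') + m
      · rw [A2 μ' (by omega), mul_zero]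
      · rw [h.bm_zero m ℓ hm1 _ _ h2, zero_mul]
    · by_cases h2 : S 0 (nu μ) = S 0 (nu μ') + m
      · rw [A1 μ' (by omega), mul_zero]
      · rw [h.bm_zero m ℓ hm1 _ _ h2, zero_mul]
lemma Eqn_sub (h : JK a J) {D D' : Multiset ℕ+ → Multiset ℕ+ → Multiset ℕ+ → K} {M : ℕ} (ℓ : ℕ) (ρ μ ν : Multiset ℕ+) (hE : Eqn a D M ℓ ρ μ ν) (hE' : Eqn a D' M ℓ ρ μ ν) :
    Eqn a (fun x y z => D x y z - D' x y z) M ℓ ρ μ ν := by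
  rw [Eqn] at *
  have key : ∀ (c x y : Multiset ℕ+ → K), {i | c i ≠ 0}.Finite → ∑ᶠ i, c i * (x i - y i) = ∑ᶠ i, c i * x i - ∑ᶠ i, c i * y i := by
    intro c x y hc
    simp only [mul_sub]
    refine finsum_sub_distrib (hc.subset ?_) (hc.subset ?_)
    · intro i hi; exact left_ne_zero_of_mul hi
    · intro i hi; exact left_ne_zero_of_mul hi
  have e := congrArg₂ (fun x y => x - y) hE hE'
  simp only [← Finset.sum_sub_distrib, ← mul_sub] at e
  refine Eq.trans (Finset.sum_congr rfl fun m hm => ?_) (e.trans (Finset.sum_congr rfl fun m hm => ?_))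
  · have hm := (Finset.mem_Icc.mp hm).1
    rw [key _ _ _ (h.bm_fin1 m ℓ hm μ), key _ _ _ (h.bm_fin1 m ℓ hm ν)]; ring
  · have hm := (Finset.mem_Icc.mp hm).1
    rw [key _ _ _ (h.bm_fin2 m ℓ hm ρ)]
lemma ee_zero : ee a 0 = 1 := by simp [ee, zl, pm]
lemma ee_ev0 (h : JK a J) (μ) : ev a J 0 (ee a μ) = if μ = 0 then 1 else 0 := by
  by_cases hμ : μ = 0
  · subst hμ; rw [ee_zero, h.ev_one]; simp
  · rw [if_neg hμ]
    have : 0 < S 0 (nu μ) := Nat.pos_of_ne_zero fun e => hμ (S0_eq_zero μ e)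
    exact h.ev_gt 0 (Hm_ee μ) (by rw [S0_zero]; exact this)
lemma SC.empty (hg : SC a J g) (h : JK a J) (μ ν) : g 0 μ ν = if μ = 0 ∧ ν = 0 then 1 else 0 := by
  have e := hg.mul μ ν 0
  rw [finsum_eq_single _ 0] at e
  · simp only [ee_ev0 h] at e
    rw [if_pos trivial, mul_one] at e
    rw [← e]
    clear e; split_ifs <;> simp_all
  · intro π hπ; rw [ee_ev0 h, if_neg hπ, mul_zero]
lemma SC.vanish (hg : SC a J g) (h : JK a J) : ∀ T μ ν, S 0 (nu μ) + S 0 (nu ν) = T → ∀ π, T < S 0 (nu π) → g π μ ν = 0 := by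
  intro T
  induction T using Nat.strong_induction_on with
  | _ T ih =>
    intro μ ν hT
    obtain ⟨B, hB⟩ : ∃ B, ∀ π, B ≤ S 0 (nu π) → g π μ ν = 0 := by
      obtain ⟨B, hB⟩ := ((hg.fin μ ν).image (fun π => S 0 (nu π))).bddAbove
      refine ⟨B + 1, fun π hπ => ?_⟩
      by_contra hc
      have : S 0 (nu π) ≤ B := hB ⟨π, hc, rfl⟩
      omega
    have key : ∀ d π, B ≤ S 0 (nu π) + d → T < S 0 (nu π) → g π μ ν = 0 := by
      intro d
      induction d with
      | zero => intro π h1 _; exact hB π h1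
      | succ d ihd =>
        intro π h1 h2
        rcases Multiset.empty_or_exists_mem π with rfl | ⟨ℓ, hℓ⟩
        · rw [S0_zero] at h2; omega
        obtain ⟨ρ, rfl⟩ := Multiset.exists_cons_of_mem hℓ
        have hp := ℓ.pos
        rw [S0_cons] at h1 h2
        obtain ⟨M0, hM0⟩ := hg.main h μ ν ℓ
        refine h.step ℓ ρ μ ν (hM0 (M0 + ℓ) (by omega) ρ) (by omega) ?_ ?_ ?_
        · intro μ' hμ'; exact ih _ (by omega) μ' ν rfl ρ (by omega)
        · intro μ' hμ'; exact ih _ (by omega) μ μ' rfl ρ (by omega)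
        · intro π hπ; exact ihd π (by omega) (by omega)
    exact fun π hπ => key B π (by omega) hπ
theorem SC.uniq (hg : SC a J g) (h : JK a J) (n : ℕ) (G : Multiset ℕ+ → Multiset ℕ+ → Multiset ℕ+ → K)
    (hH0 : ∀ π μ ν, S 0 (nu μ) + S 0 (nu ν) < S 0 (nu π) → G π μ ν = 0)
    (hH1 : ∀ μ ν, G 0 μ ν = if μ = 0 ∧ ν = 0 then 1 else 0)
    (hHeq : ∀ ℓ k : ℕ, 1 ≤ ℓ → ℓ ≤ k → k ≤ n + ℓ → ∀ ρ μ ν, S 0 (nu μ) + S 0 (nu ν) = S 0 (nu ρ) + k → Eqn a G k ℓ ρ μ ν) :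
    ∀ π μ ν, S 0 (nu μ) + S 0 (nu ν) ≤ S 0 (nu π) + n → G π μ ν = g π μ ν := by
  have key : ∀ T μ ν, S 0 (nu μ) + S 0 (nu ν) = T → ∀ π, T ≤ S 0 (nu π) + n → G π μ ν - g π μ ν = 0 := by
    intro T
    induction T using Nat.strong_induction_on with
    | _ T ih =>
      intro μ ν hT
      have key : ∀ d π, T + 1 ≤ S 0 (nu π) + d → T ≤ S 0 (nu π) + n → G π μ ν - g π μ ν = 0 := by
        intro d
        induction d with
        | zero =>
          intro π h1 _
          rw [hH0 π μ ν (by omega), hg.vanish h T μ ν hT π (by omega), sub_zero]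
        | succ d ihd =>
          intro π h1 h2
          by_cases hlt : T < S 0 (nu π)
          · exact ihd π (by omega) h2
          rcases Multiset.empty_or_exists_mem π with rfl | ⟨ℓ, hℓ⟩
          · rw [hH1, hg.empty h, sub_self]
          obtain ⟨ρ, rfl⟩ := Multiset.exists_cons_of_mem hℓ
          have hp := ℓ.pos
          rw [S0_cons] at h1 h2 hlt
          obtain ⟨k, hk⟩ : ∃ k, T = S 0 (nu ρ) + k := ⟨T - S 0 (nu ρ), by omega⟩
          obtain ⟨M0, hM0⟩ := hg.main h μ ν ℓ
          have hE1 : Eqn a g k ℓ ρ μ ν := by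
            refine Eqn_trunc h ℓ ρ μ ν (hM0 (M0 + k) (by omega) ρ) (by omega) ?_ ?_ ?_
            · intro μ' hμ'; exact hg.vanish h _ _ _ rfl ρ (by omega)
            · intro μ' hμ'; exact hg.vanish h _ _ _ rfl ρ (by omega)
            · intro π hπ; exact hg.vanish h _ _ _ rfl π (by omega)
          have hE := Eqn_sub h ℓ ρ μ ν (hHeq ℓ k hp (by omega) (by omega) ρ μ ν (by omega)) hE1
          refine h.step ℓ ρ μ ν hE (by omega) ?_ ?_ ?_
          · intro μ' hμ'; exact ih _ (by omega) μ' ν rfl ρ (by omega)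
          · intro μ' hμ'; exact ih _ (by omega) μ μ' rfl ρ (by omega)
          · intro π hπ; exact ihd π (by omega) (by omega)
      exact fun π hπ => key (T+1) π (by omega) hπ
  exact fun π μ ν hπ => sub_eq_zero.mp (key _ μ ν rfl π hπ)
end part13
end Jk

namespace Jk
section part14

def Ry : SymA →ₐ[F] PY := MvPolynomial.rename Sum.inl
/-- embedding of `M F` into `PY`, `X^k * f ↦ y_k f`. -/
def psi : M F →ₗ[F] PY := bld (fun k => LinearMap.mulLeft F (yv k) ∘ₗ Ry.toLinearMap)
lemma psi_apply (k : ℕ) (f : SymA) : psi (Polynomial.X ^ k * Polynomial.C f) = yv k * Ry f := by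
  rw [psi, bld_apply]; rfl
lemma pd_fin (f : PY) : {v | MvPolynomial.pderiv v f ≠ 0}.Finite := by
  refine f.vars.finite_toSet.subset fun v hv => ?_
  by_contra hc
  exact hv (MvPolynomial.pderiv_eq_zero_of_notMem_vars hc)
lemma pd_fin' {ι : Type} (φ : ι → ℕ+ ⊕ ℕ) (hφ : Function.Injective φ) (f : PY) : {i | MvPolynomial.pderiv (φ i) f ≠ 0}.Finite :=
  Set.Finite.preimage hφ.injOn (pd_fin f)
lemma fs_add {ι : Type} (A : ι → PY →ₗ[F] PY) (hA : ∀ f, {i | A i f ≠ 0}.Finite) (f g : PY) : ∑ᶠ i, A i (f + g) = ∑ᶠ i, A i f + ∑ᶠ i, A i g := by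
  simp only [map_add]
  exact finsum_add_distrib (hA f) (hA g)
lemma inj1 : Function.Injective (fun i : ℕ+ => (Sum.inr (i:ℕ) : ℕ+ ⊕ ℕ)) := fun i j h => PNat.coe_injective (Sum.inr_injective h)
lemma inj2 : Function.Injective (fun i : ℕ+ => (Sum.inr ((i:ℕ) - 1) : ℕ+ ⊕ ℕ)) := fun i j h => by
  have h1 := Sum.inr_injective h
  have := i.pos; have := j.pos
  exact PNat.coe_injective (by omega)
lemma inj3 (i : ℕ+) : Function.Injective (fun j : ℕ+ => (Sum.inr ((i:ℕ) + (j:ℕ) - 1) : ℕ+ ⊕ ℕ)) := fun j j' h => by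
  have h1 := Sum.inr_injective h
  have := i.pos
  exact PNat.coe_injective (by omega)
abbrev pdl (v : ℕ+ ⊕ ℕ) : PY →ₗ[F] PY := (MvPolynomial.pderiv v).toLinearMap
lemma Yplus_add (f g : PY) : Yplus (f + g) = Yplus f + Yplus g := by
  refine fs_add (fun j => LinearMap.mulLeft F (yv (j+1)) ∘ₗ pdl (Sum.inr j)) (fun f => ?_) f g
  refine (pd_fin' Sum.inr Sum.inr_injective f).subset fun i hi => ?_
  exact right_ne_zero_of_mul hi
lemma ThetaY_add (f g : PY) : ThetaY (f + g) = ThetaY f + ThetaY g := by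
  refine fs_add (fun j : ℕ+ => LinearMap.mulLeft F (pv j) ∘ₗ pdl (Sum.inr j)) (fun f => ?_) f g
  refine (pd_fin' _ inj1 f).subset fun i hi => ?_
  exact right_ne_zero_of_mul hi
def G1 (f : PY) : PY := (∑ᶠ i : ℕ+, ∑ᶠ j : ℕ+, ((j : ℕ) : F) •
      (yv ((i : ℕ) + (j : ℕ)) *
        MvPolynomial.pderiv (Sum.inl j) (MvPolynomial.pderiv (Sum.inr ((i : ℕ) - 1)) f)))
def G2 (f : PY) : PY := (∑ᶠ i : ℕ+, ∑ᶠ j : ℕ+,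
      yv (i : ℕ) * pv j * MvPolynomial.pderiv (Sum.inr ((i : ℕ) + (j : ℕ) - 1)) f)
def G3 (f : PY) : PY := (∑ᶠ i : ℕ+, ((i : ℕ) : F) •
      (yv ((i : ℕ) + 1) * MvPolynomial.pderiv (Sum.inr (i : ℕ)) f))
lemma G3_add (f g : PY) : G3 (f + g) = G3 f + G3 g := by
  refine fs_add (fun j : ℕ+ => ((j:ℕ):F) • (LinearMap.mulLeft F (yv ((j:ℕ)+1)) ∘ₗ pdl (Sum.inr j))) (fun f => ?_) f g
  refine (pd_fin' _ inj1 f).subset fun i hi => ?_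
  intro hc
  apply hi
  show ((i:ℕ):F) • (yv ((i:ℕ)+1) * MvPolynomial.pderiv (Sum.inr (i:ℕ)) f) = 0
  rw [hc]; simp
lemma G2_add (f g : PY) : G2 (f + g) = G2 f + G2 g := by
  have h1 : ∀ (i : ℕ+) (f : PY), {j : ℕ+ | yv (i : ℕ) * pv j * MvPolynomial.pderiv (Sum.inr ((i : ℕ) + (j : ℕ) - 1)) f ≠ 0}.Finite := fun i f =>
    (pd_fin' _ (inj3 i) f).subset fun j hj => right_ne_zero_of_mul hj
  have h2 : ∀ f : PY, {i : ℕ+ | ∑ᶠ j : ℕ+, yv (i : ℕ) * pv j * MvPolynomial.pderiv (Sum.inr ((i : ℕ) + (j : ℕ) - 1)) f ≠ 0}.Finite := by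
    intro f
    obtain ⟨B, hB⟩ := ((pd_fin' Sum.inr Sum.inr_injective f)).bddAbove
    refine (Set.finite_Iic (Nat.succPNat B)).subset fun i hi => ?_
    by_contra hc
    apply hi
    refine finsum_eq_zero_of_forall_eq_zero fun j => ?_
    have h3 : MvPolynomial.pderiv (Sum.inr ((i : ℕ) + (j : ℕ) - 1)) f = 0 := by
      by_contra h4
      have := hB h4
      apply hc
      have := j.pos
      exact (PNat.coe_le_coe _ _).mp (by rw [Nat.succPNat_coe]; omega)
    rw [h3, mul_zero]
  have e : ∀ i : ℕ+, ∑ᶠ j : ℕ+, yv (i : ℕ) * pv j * MvPolynomial.pderiv (Sum.inr ((i : ℕ) + (j : ℕ) - 1)) (f + g) =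
      ∑ᶠ j : ℕ+, yv (i : ℕ) * pv j * MvPolynomial.pderiv (Sum.inr ((i : ℕ) + (j : ℕ) - 1)) f + ∑ᶠ j : ℕ+, yv (i : ℕ) * pv j * MvPolynomial.pderiv (Sum.inr ((i : ℕ) + (j : ℕ) - 1)) g := by
    intro i
    simp only [map_add, mul_add]
    exact finsum_add_distrib (h1 i f) (h1 i g)
  rw [G2]
  simp only [e]
  exact finsum_add_distrib (h2 f) (h2 g)
lemma G1_add (f g : PY) : G1 (f + g) = G1 f + G1 g := by
  have h1 : ∀ (i : ℕ+) (f : PY), {j : ℕ+ | ((j : ℕ) : F) • (yv ((i : ℕ) + (j : ℕ)) * MvPolynomial.pderiv (Sum.inl j) f) ≠ 0}.Finite := fun i f =>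
    (pd_fin' Sum.inl Sum.inl_injective f).subset fun j hj hc => hj (by rw [hc]; simp)
  have h2 : ∀ f : PY, {i : ℕ+ | ∑ᶠ j : ℕ+, ((j : ℕ) : F) • (yv ((i : ℕ) + (j : ℕ)) * MvPolynomial.pderiv (Sum.inl j) (MvPolynomial.pderiv (Sum.inr ((i : ℕ) - 1)) f)) ≠ 0}.Finite := by
    intro f
    refine (pd_fin' _ inj2 f).subset fun i hi hc => hi ?_
    refine finsum_eq_zero_of_forall_eq_zero fun j => ?_
    rw [hc]; simp
  have e : ∀ i : ℕ+, ∑ᶠ j : ℕ+, ((j : ℕ) : F) • (yv ((i : ℕ) + (j : ℕ)) * MvPolynomial.pderiv (Sum.inl j) (MvPolynomial.pderiv (Sum.inr ((i : ℕ) - 1)) (f + g))) =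
      ∑ᶠ j : ℕ+, ((j : ℕ) : F) • (yv ((i : ℕ) + (j : ℕ)) * MvPolynomial.pderiv (Sum.inl j) (MvPolynomial.pderiv (Sum.inr ((i : ℕ) - 1)) f)) + ∑ᶠ j : ℕ+, ((j : ℕ) : F) • (yv ((i : ℕ) + (j : ℕ)) * MvPolynomial.pderiv (Sum.inl j) (MvPolynomial.pderiv (Sum.inr ((i : ℕ) - 1)) g)) := by
    intro i
    simp only [map_add, mul_add, smul_add]
    exact finsum_add_distrib (h1 i _) (h1 i _)
  rw [G1]
  simp only [e]
  exact finsum_add_distrib (h2 f) (h2 g)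
lemma GammaY_eq (f : PY) : GammaY f = alpha • G1 f + G2 f + (alpha - 1) • G3 f := rfl
lemma GammaY_add (f g : PY) : GammaY (f + g) = GammaY f + GammaY g := by
  simp only [GammaY_eq, G1_add, G2_add, G3_add, smul_add]; abel
/-! evaluation on the image of psi -/
lemma pdr_y (j k : ℕ) (f : SymA) : MvPolynomial.pderiv (Sum.inr j) (yv k * Ry f) = if j = k then Ry f else 0 := by
  have h0 : MvPolynomial.pderiv (Sum.inr j : ℕ+ ⊕ ℕ) (Ry f) = 0 := by
    apply MvPolynomial.pderiv_eq_zero_of_notMem_vars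
    intro hc
    have := MvPolynomial.vars_rename (Sum.inl : ℕ+ → ℕ+ ⊕ ℕ) f hc
    simp at this
  rw [Derivation.leibniz, h0, smul_zero, zero_add, yv, MvPolynomial.pderiv_X, smul_eq_mul]
  by_cases h : j = k
  · subst h; simp
  · rw [if_neg h, Pi.single_eq_of_ne (fun e => h (Sum.inr_injective e).symm), mul_zero]
lemma pdl_R (j : ℕ+) (f : SymA) : MvPolynomial.pderiv (Sum.inl j) (Ry f) = Ry (pd (j:ℕ) f) := by
  rw [pd_coe]
  exact MvPolynomial.pderiv_rename Sum.inl_injective j f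
lemma Yplus_y (k : ℕ) (f : SymA) : Yplus (yv k * Ry f) = yv (k+1) * Ry f := by
  rw [Yplus, finsum_eq_single _ k]
  · rw [pdr_y, if_pos rfl]
  · intro j hj; rw [pdr_y, if_neg hj, mul_zero]
lemma pnat_single {A : Type} [AddCommMonoid A] (φ : ℕ → A) (h0 : φ 0 = 0) (k : ℕ) (hk : ∀ j, j ≠ k → φ j = 0) : ∑ᶠ i : ℕ+, φ i = φ k := by
  rcases Nat.eq_zero_or_pos k with rfl | h
  · rw [h0]; exact finsum_eq_zero_of_forall_eq_zero fun i => hk _ (by simp)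
  · lift k to ℕ+ using h
    exact finsum_eq_single _ k (fun j hj => hk _ (fun e => hj (PNat.coe_injective e)))
lemma pnat_sum {A : Type} [AddCommMonoid A] (φ : ℕ → A) (N : ℕ) (hN : ∀ j, N ≤ j → φ (j + 1) = 0) : ∑ᶠ i : ℕ+, φ i = ∑ n ∈ Finset.range N, φ (n+1) := by
  rw [finsum_eq_sum_of_support_subset (s := (Finset.range N).image Nat.succPNat), Finset.sum_image]
  · rfl
  · intro x _ y _ h; exact Nat.succPNat_injective h
  · intro i hi
    rw [Finset.coe_image]
    refine ⟨(i:ℕ) - 1, ?_, ?_⟩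
    · by_contra hc
      apply hi
      have := hN ((i:ℕ)-1) (by simpa using hc)
      rwa [Nat.sub_add_cancel i.pos] at this
    · apply PNat.coe_injective; have := i.pos; simp; omega
lemma ThetaY_y (k : ℕ) (f : SymA) : ThetaY (yv k * Ry f) = Ry (pN F k * f) := by
  have e : ∀ i : ℕ+, pv i * MvPolynomial.pderiv (Sum.inr (i : ℕ)) (yv k * Ry f) = (fun n => if n = k then Ry (pN F n * f) else 0) (i:ℕ) := by
    intro i
    rw [pdr_y]
    by_cases h : (i:ℕ) = k
    · simp only [h, if_true]
      rw [← h, pN_coe, map_mul]; congr 1; simp [Ry, pv]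
    · simp [h]
  rw [ThetaY]
  simp only [e]
  rw [pnat_single (fun n => if n = k then Ry (pN F n * f) else 0) _ k]
  · simp
  · intro j hj; simp [hj]
  · simp
lemma G3_y (k : ℕ) (f : SymA) : G3 (yv k * Ry f) = (k:F) • (yv (k+1) * Ry f) := by
  have e : ∀ i : ℕ+, ((i : ℕ) : F) • (yv ((i : ℕ) + 1) * MvPolynomial.pderiv (Sum.inr (i : ℕ)) (yv k * Ry f)) = (fun n : ℕ => (n:F) • (if n = k then yv (n+1) * Ry f else 0)) (i:ℕ) := by
    intro i
    rw [pdr_y]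
    by_cases h : (i:ℕ) = k
    · simp only [h, if_true]
    · simp [h]
  rw [G3]
  simp only [e]
  rw [pnat_single (fun n : ℕ => (n:F) • (if n = k then yv (n+1) * Ry f else 0)) _ k]
  · simp
  · intro j hj; simp [hj]
  · simp
lemma G2_y (k : ℕ) (f : SymA) : G2 (yv k * Ry f) = psi (Polynomial.X * (cc k * Polynomial.C f)) := by
  have e : ∀ i : ℕ+, ∑ᶠ j : ℕ+, yv (i : ℕ) * pv j * MvPolynomial.pderiv (Sum.inr ((i : ℕ) + (j : ℕ) - 1)) (yv k * Ry f) = (fun n => yv n * Ry (pN F (k + 1 - n) * f)) (i:ℕ) := by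
    intro i
    have := i.pos
    have e2 : ∀ j : ℕ+, yv (i : ℕ) * pv j * MvPolynomial.pderiv (Sum.inr ((i : ℕ) + (j : ℕ) - 1)) (yv k * Ry f) = (fun n => if n = k + 1 - (i:ℕ) then yv i * Ry (pN F n * f) else 0) (j:ℕ) := by
      intro j
      have := j.pos
      rw [pdr_y]
      by_cases h : (i:ℕ) + j - 1 = k
      · have h' : (j:ℕ) = k + 1 - i := by omega
        rw [if_pos h]; simp only [h', if_true]
        rw [← h', pN_coe, map_mul, mul_assoc]; congr 2; simp [Ry, pv]
      · have h' : (j:ℕ) ≠ k + 1 - i := by omega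
        simp [h, h']
    simp only [e2]
    rw [pnat_single (fun n => if n = k + 1 - (i:ℕ) then yv i * Ry (pN F n * f) else 0) _ (k + 1 - i)]
    · simp
    · intro j hj; simp [hj]
    · simp
  rw [G2]
  simp only [e]
  rw [pnat_sum (fun n => yv n * Ry (pN F (k + 1 - n) * f)) (k+1), cc, ← Finset.sum_range_reflect, Finset.Nat.sum_antidiagonal_eq_sum_range_succ (fun x y => Polynomial.C (pN F x) * Polynomial.X ^ y), Finset.sum_mul, Finset.mul_sum, map_sum]
  · refine Finset.sum_congr rfl fun n hn => ?_
    have hn : n < k + 1 := by simpa using hn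
    have e1 : Polynomial.X * (Polynomial.C (pN F n) * Polynomial.X ^ (k - n) * Polynomial.C f) = Polynomial.X ^ (k - n + 1) * Polynomial.C (pN F n * f) := by
      rw [map_mul]; ring
    rw [e1, psi_apply]
    have e3 : k + 1 - 1 - n + 1 = k - n + 1 := by omega
    have e4 : k + 1 - (k - n + 1) = n := by omega
    simp only [e3, e4]
  · intro j hj
    have : k + 1 - (j + 1) = 0 := by omega
    simp [this]
lemma psi_gen (g : M F) (N : ℕ) (hN : ∀ j, N ≤ j → g.coeff j = 0) (k : ℕ) : psi (Polynomial.X ^ k * g) = ∑ n ∈ Finset.range N, yv (k + n) * Ry (g.coeff n) := by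
  have : g = ∑ n ∈ Finset.range N, Polynomial.X ^ n * Polynomial.C (g.coeff n) := by
    ext1 j
    simp only [Polynomial.finsetSum_coeff, Polynomial.coeff_X_pow_mul', Polynomial.coeff_C]
    by_cases hj : j < N
    · rw [Finset.sum_eq_single_of_mem j (by simpa using hj)]
      · simp
      · intro b _ hb
        split_ifs <;> first | rfl | omega
    · rw [hN j (by omega), Finset.sum_eq_zero]
      intro b hb
      have hb : b < N := by simpa using hb
      split_ifs <;> first | rfl | omega
  conv_lhs => rw [this]
  rw [Finset.mul_sum, map_sum]
  refine Finset.sum_congr rfl fun n _ => ?_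
  rw [← mul_assoc, ← pow_add, psi_apply]
lemma G1_y (k : ℕ) (f : SymA) : alpha • G1 (yv k * Ry f) = psi (Polynomial.X ^ (k+1) * dA alpha f) := by
  set N := (dA alpha f).natDegree with hN
  have hz : ∀ j, N < j → (dA alpha f).coeff j = 0 := fun j hj => Polynomial.coeff_eq_zero_of_natDegree_lt hj
  rw [psi_gen _ (N + 1) (fun j hj => hz j (by omega)), Finset.sum_range_succ']
  have e0 : (dA alpha f).coeff 0 = 0 := by rw [coeff_dA]; simp
  rw [e0, map_zero, mul_zero, add_zero, G1, finsum_eq_single _ (Nat.succPNat k)]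
  · simp only [Nat.succPNat_coe, Nat.succ_sub_one, pdr_y, if_true, pdl_R]
    rw [pnat_sum (fun j : ℕ => (j:F) • (yv (k.succ + j) * Ry (pd j f))) N]
    · rw [Finset.smul_sum]
      refine Finset.sum_congr rfl fun n _ => ?_
      rw [coeff_dA, map_smul, mul_smul_comm, smul_smul]
    · intro j hj
      have := hz (j+1) (by omega)
      rw [coeff_dA] at this
      have : pd (j+1) f = 0 := (smul_eq_zero.mp this).resolve_left (mul_ne_zero RatFunc.X_ne_zero (by exact_mod_cast Nat.succ_ne_zero j))
      simp only [this, map_zero, mul_zero, smul_zero]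
  · intro i hi
    refine finsum_eq_zero_of_forall_eq_zero fun j => ?_
    rw [pdr_y, if_neg]
    · simp
    · intro hc
      apply hi
      apply PNat.coe_injective
      have := i.pos
      simp; omega
lemma Yplus_psi (g : M F) : Yplus (psi g) = psi (w g) := by
  induction g using Polynomial.induction_on' with
  | add p q hp hq => rw [map_add, Yplus_add, hp, hq, map_add, map_add]
  | monomial n f =>
    rw [← Polynomial.C_mul_X_pow_eq_monomial, mul_comm, psi_apply, Yplus_y, w_apply, ← mul_assoc, ← pow_succ', psi_apply]
lemma GammaY_psi (g : M F) : GammaY (psi g) = psi (w (Lam alpha g)) := by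
  induction g using Polynomial.induction_on' with
  | add p q hp hq => rw [map_add, GammaY_add, hp, hq, map_add, map_add, map_add]
  | monomial n f =>
    rw [← Polynomial.C_mul_X_pow_eq_monomial, mul_comm, psi_apply, GammaY_eq, G1_y, G2_y, G3_y]
    rw [Lam, LinearMap.add_apply, LinearMap.add_apply, LinearMap.smul_apply, Aop_apply, Cop_apply, th_apply]
    rw [map_add, map_add, map_add, map_add, map_smul, map_smul]
    have e1 : w (Polynomial.X ^ n * dA alpha f) = Polynomial.X ^ (n+1) * dA alpha f := by rw [w_apply, pow_succ', mul_assoc]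
    have e2 : w (cc n * Polynomial.C f) = Polynomial.X * (cc n * Polynomial.C f) := rfl
    have e3 : w ((n : M F) * (Polynomial.X ^ n * Polynomial.C f)) = (n:F) • (Polynomial.X ^ (n+1) * Polynomial.C f) := by
      rw [w_apply, pow_succ', Nat.cast_smul_eq_nsmul, nsmul_eq_mul]; ring
    rw [e1, e2, e3, map_smul, psi_apply]
lemma ThetaY_psi (g : M F) : dropY (ThetaY (psi g)) = Tht g := by
  induction g using Polynomial.induction_on' with
  | add p q hp hq => rw [map_add, ThetaY_add, map_add, hp, hq, map_add]
  | monomial n f =>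
    rw [← Polynomial.C_mul_X_pow_eq_monomial, mul_comm, psi_apply, ThetaY_y, Tht_apply, Ry, dropY, MvPolynomial.aeval_rename]
    exact MvPolynomial.aeval_X_left_apply _
def wdo : List Bool → Module.End F (M F)
  | [] => 1
  | b :: l => (if b then w else w * Lam alpha) * wdo l
lemma wordOp_psi (l : List Bool) (g : M F) : wordOp l (psi g) = psi (wdo l g) := by
  induction l with
  | nil => rfl
  | cons b l ih =>
    rw [wordOp, ih, wdo]
    cases b
    · simp only [Bool.false_eq_true, if_false]; rw [GammaY_psi]; rfl
    · simp only [if_true]; rw [Yplus_psi]; rfl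
lemma wdo_sum (n : ℕ) : ∀ ℓ, ∑ s ∈ Finset.univ.filter (fun s : Fin n → Bool => (Finset.univ.filter fun i => s i = true).card = ℓ), wdo (List.ofFn s) = Wd alpha n ℓ := by
  induction n with
  | zero =>
    intro ℓ
    cases ℓ with
    | zero => simp [Wd, wdo]
    | succ ℓ => simp [Wd]
  | succ n ih =>
    intro ℓ
    have e : ∀ f : (Fin (n+1) → Bool) → Module.End F (M F), ∑ s, f s = ∑ s : Fin n → Bool, f (Fin.cons true s) + ∑ s : Fin n → Bool, f (Fin.cons false s) := by
      intro f
      rw [← (Fin.consEquiv (fun _ => Bool)).sum_comp, Fintype.sum_prod_type, Fintype.sum_bool]; rfl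
    have hc : ∀ (b : Bool) (s : Fin n → Bool), (Finset.univ.filter fun i => (Fin.cons b s : Fin (n+1) → Bool) i = true).card = (if b = true then 1 else 0) + (Finset.univ.filter fun i => s i = true).card := by
      intro b s
      rw [Finset.card_filter, Finset.card_filter, Fin.sum_univ_succ]; simp
    have hl : ∀ (b : Bool) (s : Fin n → Bool), wdo (List.ofFn (Fin.cons b s : Fin (n+1) → Bool)) = (if b then w else w * Lam alpha) * wdo (List.ofFn s) := by
      intro b s
      rw [List.ofFn_succ]; simp [wdo]
    rw [Finset.sum_filter, e]
    simp only [hc, hl, if_true, Bool.false_eq_true, if_false, zero_add]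
    cases ℓ with
    | zero =>
      rw [Finset.sum_eq_zero (fun s _ => if_neg (by omega)), zero_add, Wd, ← ih, Finset.sum_filter, Finset.mul_sum]
      exact Finset.sum_congr rfl fun s _ => by split_ifs <;> simp
    | succ ℓ =>
      rw [Wd, ← ih, ← ih, Finset.sum_filter, Finset.sum_filter, Finset.mul_sum, Finset.mul_sum, add_comm]
      refine congrArg₂ _ (Finset.sum_congr rfl fun s _ => by split_ifs <;> simp) (Finset.sum_congr rfl fun s _ => ?_)
      have : 1 + (Finset.univ.filter fun i => s i = true).card = ℓ + 1 ↔ (Finset.univ.filter fun i => s i = true).card = ℓ := by omega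
      simp only [this]
      split_ifs <;> simp
lemma Bc_eq (n ℓ : ℕ) (f : SymA) : Bc n ℓ f = Bcg alpha n ℓ f := by
  have e1 : alpha⁻¹ • (yv 0 * MvPolynomial.rename Sum.inl f) = psi (alpha⁻¹ • iot f) := by
    have := psi_apply 0 f
    rw [pow_zero, one_mul] at this
    rw [map_smul, iot_apply, this]; rfl
  rw [Bc, e1]
  simp only [wordOp_psi]
  rw [← map_sum, ← LinearMap.sum_apply, wdo_sum, ThetaY_psi, map_smul, map_smul]; rfl
end part14
end Jk

namespace Jk
section part15

lemma toExp_eq (l : JPartition) : toExp l = Multiset.toFinsupp l := by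
  ext i
  rw [toExp, Finsupp.finsetSum_apply, Multiset.toFinsupp_apply]
  simp only [Finsupp.single_apply]
  rw [Finset.sum_ite_eq']
  split_ifs with h
  · rfl
  · exact (Multiset.count_eq_zero.mpr (by simpa using h)).symm
lemma pPow_eq (l : JPartition) : pPow l = pm l := by
  induction l using Multiset.induction with
  | empty => simp [pPow, pm]
  | cons x l ih => rw [pm_cons, ← ih, pN_coe]; simp [pPow]
lemma psize_eq (l : JPartition) : psize l = S 0 (nu l) := by simp [psize, S, nu]
lemma zalpha_eq (m : Exp) : zalpha m = zl alpha m := by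
  rw [zalpha, zl, Finsupp.prod, Finsupp.prod, Finsupp.sum, map_prod, ← Finset.prod_pow_eq_pow_sum, ← Finset.prod_mul_distrib]
  refine Finset.prod_congr rfl fun i _ => ?_
  rw [map_mul, map_pow, map_natCast, map_natCast, mul_pow]; ring
lemma hall_eq (f g : SymA) : hall f g = hl alpha f g := by
  conv_rhs => rw [f.as_sum]
  rw [hall, map_sum, LinearMap.sum_apply]
  refine Finset.sum_congr rfl fun m _ => ?_
  have : MvPolynomial.monomial m (MvPolynomial.coeff m f) = MvPolynomial.coeff m f • (MvPolynomial.monomial m 1 : SymA) := by simp [MvPolynomial.smul_monomial]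
  rw [this, map_smul, LinearMap.smul_apply, hl_monomial, zalpha_eq, smul_eq_mul]; ring
lemma alpha_ne : alpha ≠ 0 := RatFunc.X_ne_zero
lemma alpha_map : alpha = algebraMap (Polynomial ℚ) F Polynomial.X := (RatFunc.algebraMap_X).symm
lemma alpha_tr (x y : ℤ) (h : alpha * x = y) : x = 0 ∧ y = 0 := by
  have h1 : algebraMap (Polynomial ℚ) F (Polynomial.X * (x : Polynomial ℚ)) = algebraMap (Polynomial ℚ) F (y : Polynomial ℚ) := by
    rw [map_mul, ← alpha_map, map_intCast, map_intCast, h]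
  have h2 := RatFunc.algebraMap_injective ℚ h1
  have h3 := congrArg (fun p => Polynomial.eval 0 p) h2
  have h4 := congrArg (fun p => Polynomial.eval 1 p) h2
  simp at h3 h4
  have h5 : (y:ℚ) = 0 := by rw [← h3]
  have h6 : y = 0 := by exact_mod_cast h5
  exact ⟨by rw [h4, h6], h6⟩
lemma pos_sq {ι : Type} (s : Finset ι) (x : ι → F) (c : ι → ℚ) (e : ι → ℕ) (hc : ∀ i ∈ s, 0 < c i)
    (h : ∑ i ∈ s, x i * x i * (algebraMap ℚ F (c i) * alpha ^ (e i)) = 0) : ∀ i ∈ s, x i = 0 := by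
  obtain ⟨d, hd⟩ := IsLocalization.exist_integer_multiples (nonZeroDivisors (Polynomial ℚ)) s x
  choose P hP using hd
  have hd0 : algebraMap (Polynomial ℚ) F (d : Polynomial ℚ) ≠ 0 := by
    rw [Ne, map_eq_zero_iff _ (RatFunc.algebraMap_injective ℚ)]
    exact nonZeroDivisors.ne_zero d.2
  have h1 : ∑ i ∈ s.attach, P i.1 i.2 * P i.1 i.2 * (Polynomial.C (c i) * Polynomial.X ^ (e i)) = 0 := by
    apply RatFunc.algebraMap_injective ℚ
    rw [map_zero, map_sum]
    have : ∑ i ∈ s.attach, (algebraMap (Polynomial ℚ) F (d : Polynomial ℚ)) ^ 2 * (x i * x i * (algebraMap ℚ F (c i) * alpha ^ (e i))) = 0 := by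
      rw [← Finset.mul_sum, Finset.sum_attach s (fun i => x i * x i * (algebraMap ℚ F (c i) * alpha ^ (e i))), h, mul_zero]
    rw [← this]
    refine Finset.sum_congr rfl fun i _ => ?_
    rw [map_mul, map_mul, map_mul, map_pow, ← alpha_map, hP i.1 i.2, Algebra.smul_def, show algebraMap (Polynomial ℚ) F (Polynomial.C (c i)) = algebraMap ℚ F (c i) from RingHom.congr_fun (RingHom.ext_rat ((algebraMap (Polynomial ℚ) F).comp Polynomial.C) (algebraMap ℚ F)) (c i)]
    ring
  intro i hi
  have h2 : P i hi = 0 := by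
    apply Polynomial.eq_zero_of_infinite_isRoot
    refine (Set.Ioi_infinite (0:ℚ)).mono fun t ht => ?_
    have ht : 0 < t := ht
    have h3 := congrArg (fun p => Polynomial.eval t p) h1
    simp only [Polynomial.eval_finsetSum, Polynomial.eval_mul, Polynomial.eval_C, Polynomial.eval_pow, Polynomial.eval_X, Polynomial.eval_zero] at h3
    rw [Finset.sum_eq_zero_iff_of_nonneg] at h3
    · have h4 := h3 ⟨i, hi⟩ (by simp)
      have : 0 < c i * t ^ e i := mul_pos (hc i hi) (pow_pos ht _)
      have h5 := (mul_eq_zero.mp h4).resolve_right this.ne'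
      exact mul_self_eq_zero.mp h5
    · intro j _
      exact mul_nonneg (mul_self_nonneg _) (mul_pos (hc j.1 j.2) (pow_pos ht _)).le
  have h6 := hP i hi
  rw [h2, map_zero, Algebra.smul_def] at h6
  exact (mul_eq_zero.mp h6.symm).resolve_left hd0
lemma alpha_aniso (f : SymA) (h : hl alpha f f = 0) : f = 0 := by
  rw [← hall_eq, hall] at h
  have := pos_sq f.support (fun m => MvPolynomial.coeff m f) _ (fun m => m.sum fun _ k => k) (fun m _ => ?_) h
  · ext m
    by_cases hm : m ∈ f.support
    · rw [this m hm]; simp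
    · simpa using hm
  · refine Finset.prod_pos fun i _ => ?_
    have := i.pos
    positivity

lemma der_prod {A B ι : Type} [DecidableEq ι] [Field A] [CommRing B] [Algebra A B] (D : Derivation A B B) (s : Finset ι) (φ : ι → B) :
    D (∏ i ∈ s, φ i) = ∑ i ∈ s, (∏ j ∈ s.erase i, φ j) * D (φ i) := by
  induction s using Finset.induction_on with
  | empty => simp
  | insert a s ha ih =>
    rw [Finset.prod_insert ha, Derivation.leibniz, ih, Finset.sum_insert ha, Finset.erase_insert ha, smul_eq_mul, smul_eq_mul, Finset.mul_sum, add_comm]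
    congr 1
    refine Finset.sum_congr rfl fun i hi => ?_
    have hia : a ≠ i := fun e => ha (e ▸ hi)
    rw [Finset.erase_insert_of_ne hia, Finset.prod_insert (fun h => ha (Finset.mem_of_mem_erase h)), mul_assoc]
lemma coeff_evalN (N : ℕ) (f : SymA) : ∀ c : Fin N →₀ ℕ, MvPolynomial.coeff c (evalN N f) = hl alpha f (∏ j, gg alpha (c j)) := by
  induction f using V_ind_prop with
  | h1 x =>
    intro c
    rw [hl_cV, show evalN N (cV x) = MvPolynomial.C x from AlgHom.commutes (evalN N) x, MvPolynomial.coeff_C]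
    have : MvPolynomial.coeff 0 (∏ j, gg alpha (c j)) = ∏ j, (if c j = 0 then (1:F) else 0) := by
      have := map_prod (MvPolynomial.constantCoeff (R := F) (σ := ℕ+)) (fun j => gg alpha (c j)) Finset.univ
      rw [MvPolynomial.constantCoeff_eq] at this
      rw [this]
      refine Finset.prod_congr rfl fun j _ => ?_
      rw [← gz_nat, coeff0_gz]; simp
    rw [this]
    by_cases hc : c = 0
    · subst hc; simp
    · rw [if_neg (Ne.symm hc)]
      obtain ⟨j, hj⟩ := Finsupp.ne_iff.mp hc
      rw [Finset.prod_eq_zero (Finset.mem_univ j) (if_neg (by simpa using hj)), mul_zero]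
  | hadd p q hp hq => intro c; rw [map_add, MvPolynomial.coeff_add, hp, hq, map_add, LinearMap.add_apply]
  | hp j f ih =>
    intro c
    rw [hl_pN, der_prod, map_mul, pN_coe]
    have e1 : evalN N (MvPolynomial.X j) = ∑ i : Fin N, MvPolynomial.X i ^ (j:ℕ) := by simp [evalN]
    rw [e1, Finset.sum_mul, MvPolynomial.coeff_sum, Finset.smul_sum, map_sum]
    refine Finset.sum_congr rfl fun i _ => ?_
    rw [← mul_smul_comm, ← gz_nat, pd_gz alpha alpha_ne _ j.pos, MvPolynomial.X_pow_eq_monomial, MvPolynomial.coeff_monomial_mul', one_mul]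
    by_cases hj : (j:ℕ) ≤ c i
    · rw [if_pos (by rw [Finsupp.single_le_iff]; exact hj), ih]
      congr 1
      rw [← Finset.prod_erase_mul _ _ (Finset.mem_univ i)]
      congr 1
      · refine Finset.prod_congr rfl fun x hx => ?_
        have : i ≠ x := fun e => by subst e; simp at hx
        simp [Finsupp.single_apply, this]
      · rw [show ((c i : ℕ):ℤ) - (j:ℕ) = ((c i - j : ℕ) : ℤ) by omega, gz_nat]; simp
    · rw [if_neg (by rw [Finsupp.single_le_iff]; exact hj), gz_neg _ _ (by omega), mul_zero, map_zero]
lemma prod_getD {A : Type} [CommMonoid A] (φ : ℕ → A) (h0 : φ 0 = 1) (L : List ℕ) : ∀ N, L.length ≤ N → ∏ j ∈ Finset.range N, φ (L.getD j 0) = (L.map φ).prod := by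
  induction L with
  | nil => intro N _; simp [h0]
  | cons x L ih =>
    intro N hN
    obtain ⟨N, rfl⟩ : ∃ k, N = k + 1 := ⟨N - 1, by simp at hN; omega⟩
    rw [Finset.prod_range_succ', List.map_cons, List.prod_cons, mul_comm, ← ih N (by simpa using hN)]
    simp
lemma sp_nu (l : JPartition) : ((sortedParts l : List ℕ) : Multiset ℕ) = nu l := by
  rw [sortedParts, Multiset.coe_reverse, Multiset.sort_eq, Multiset.map_id']; simp [nu, Multiset.bind_def, Multiset.pure_def, Multiset.bind_singleton]
lemma sp_sorted (l : JPartition) : (sortedParts l).Pairwise (· ≥ ·) := by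
  rw [sortedParts, List.pairwise_reverse]
  exact Multiset.pairwise_sort _ _
lemma dom_mle (m l : JPartition) (h : dominates m l) : mle (nu m) (nu l) := by
  refine ⟨by rw [← psize_eq, ← psize_eq]; exact h.1, fun t => ?_⟩
  obtain ⟨k, hk⟩ := list_take_eq t (sortedParts m) (sp_sorted m)
  have h1 := list_take_le t (sortedParts l) k
  have h2 : ((sortedParts m).take k).sum ≤ ((sortedParts l).take k).sum := h.2 k
  rw [← sp_nu, ← sp_nu, S_list, S_list]
  omega
lemma xexp_gm (m : JPartition) (N : ℕ) (hN : plen m ≤ N) : ∏ j, gg alpha (xexp m N j) = gm alpha (nu m) := by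
  have e1 : ∏ j, gg alpha (xexp m N j) = ∏ j ∈ Finset.range N, gg alpha ((sortedParts m).getD j 0) := by
    rw [Finset.prod_range]; rfl
  rw [e1, prod_getD _ (gg_zero alpha), gm, ← sp_nu]
  · simp
  · rw [← Multiset.coe_card, sp_nu, nu, Multiset.card_map]; exact hN
lemma mkJK (J : JPartition → SymA) (hJ : IsJackFamily J) : JK alpha J where
  ha := alpha_ne
  tr := alpha_tr
  aniso := alpha_aniso
  orth l m hlm := by rw [← hall_eq]; exact hJ.orthogonal l m hlm
  tri l σ hne := by
    obtain ⟨m, h1, h2⟩ := gm_strip alpha σ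
    rw [h2] at hne
    have h3 : mle (nu m) (nu l) := by
      by_contra hc
      have h4 := hJ.triangular l m (fun hd => hc (dom_mle m l hd))
      rw [coeff_evalN, xexp_gm m _ (by omega)] at h4
      exact hne h4
    exact ⟨by rw [← h1]; exact h3.1, fun t => by rw [← h1]; exact h3.2 t⟩
  norm l := by rw [← psize_eq]; exact hJ.normalized l
lemma zl_ones (m : Exp) (k : ℕ) : zl alpha (m + Finsupp.single 1 k) * ((m 1).factorial : F) = zl alpha m * ((m 1 + k).factorial : F) * alpha ^ k := by
  induction k with
  | zero => simp
  | succ k ih =>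
    rw [Finsupp.single_add, ← add_assoc, zl_add]
    have e : (m + Finsupp.single (1:ℕ+) k : ℕ+ →₀ ℕ) 1 = m 1 + k := by simp
    rw [e, show m 1 + (k + 1) = (m 1 + k) + 1 from rfl, Nat.factorial_succ, pow_succ]
    push_cast at ih ⊢
    linear_combination ((m 1 : F) + k + 1) * alpha * ih
lemma theta_ev (J : JPartition → SymA) (hJ : IsJackFamily J) (μ lam : JPartition) : theta J μ lam = ev alpha J lam (ee alpha μ) := by
  have h := mkJK J hJ
  rw [theta, psize_eq, psize_eq]
  split_ifs with hlt
  · rw [h.ev_gt lam (Hm_ee μ) hlt]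
  · obtain ⟨k, hk⟩ : ∃ k, S 0 (nu lam) = k + S 0 (nu μ) := ⟨S 0 (nu lam) - S 0 (nu μ), by omega⟩
    rw [h.ev_Hm lam k (Hm_ee μ) hk.symm, hk, Nat.add_sub_cancel, toExp_eq, addOnes, ee, mul_smul_comm, map_smul, LinearMap.smul_apply, pow_p1, pm, MvPolynomial.monomial_mul, one_mul, hl_monomial]
    have e1 : Multiset.toFinsupp (μ + Multiset.replicate k 1) = Multiset.toFinsupp μ + Finsupp.single 1 k := by
      rw [map_add]; congr 1
      ext i; simp [Finsupp.single_apply, Multiset.count_replicate]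
    rw [e1, add_comm (Finsupp.single 1 k)]
    have e2 := zl_ones (Multiset.toFinsupp μ) k
    rw [Multiset.toFinsupp_apply] at e2
    have e3 : (k + pmult μ 1).choose (pmult μ 1) * (pmult μ 1).factorial * k.factorial = (k + pmult μ 1).factorial := by
      have := Nat.choose_mul_factorial_mul_factorial (Nat.le_add_left (pmult μ 1) k)
      rwa [Nat.add_sub_cancel] at this
    have e4 : ((k + pmult μ 1).choose (pmult μ 1) : F) * (pmult μ 1).factorial * k.factorial = (k + pmult μ 1).factorial := by exact_mod_cast e3
    change _ * ((pmult μ 1).factorial : F) = _ * ((pmult μ 1 + k).factorial : F) * _ at e2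
    rw [add_comm (pmult μ 1), ← e4] at e2
    have z1 : ((pmult μ 1).factorial : F) ≠ 0 := by exact_mod_cast Nat.factorial_ne_zero _
    have z2 : (k.factorial : F) ≠ 0 := by exact_mod_cast Nat.factorial_ne_zero _
    have z3 := alpha_ne
    have z4 := zl_ne alpha alpha_ne (Multiset.toFinsupp μ)
    have e5 : zl alpha (Multiset.toFinsupp μ + Finsupp.single 1 k) = zl alpha (Multiset.toFinsupp μ) * ((k + pmult μ 1).choose (pmult μ 1) : F) * k.factorial * alpha ^ k :=
      mul_right_cancel₀ z1 (by rw [e2]; ring)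
    rw [e5, smul_eq_mul]
    field_simp
lemma mkSC (J : JPartition → SymA) (hJ : IsJackFamily J) (g : JPartition → JPartition → JPartition → F) (hg : IsStructCoeffs J g) : SC alpha J g where
  fin := hg.1
  mul μ ν l := by
    have := hg.2 μ ν l
    simp only [theta_ev J hJ] at this
    exact this
lemma Bmat_bm (n ℓ : ℕ) (μ ρ : JPartition) : Bmat n ℓ (toExp μ) (toExp ρ) = bm alpha n ℓ μ ρ := by
  rw [Bmat, toExp_eq, toExp_eq, Bc_eq]; rfl
lemma Bc_bm (n ℓ : ℕ) (μ ρ : JPartition) : MvPolynomial.coeff (toExp μ) (Bc n ℓ (pPow ρ)) = bm alpha n ℓ μ ρ := by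
  rw [toExp_eq, pPow_eq, Bc_eq]; rfl
end part15
end Jk

/-- **Proposition 6.3.** Fix `n ≥ 0`.  The homogeneous parts `𝒢_i^{(α)}`, `i ≤ n`, are
characterized by the equations `H ⬝ 1 = 1` and
`[t^k]((C_ℓ^{(α)}(-t,q) + C_ℓ^{(α)}(-t,r)) ⬝ H) = [t^k](H ⬝ C_ℓ^{(α)}(-t,p))` for all
`ℓ ≥ 1`, `ℓ ≤ k ≤ n + ℓ`:  if `H = ∑_k t^k H_k` is an operator `ℚ(α)[p] → ℚ(α)[q,r]⟦t⟧`
(each `H_k` sending `p_π` to a combination of `q_μ r_ν` with `|μ|+|ν| = |π|+k`, encoded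
by its coefficient family `Hg`) satisfying these equations, then `H_i = 𝒢_i^{(α)}` for
all `i ≤ n`, i.e. `Hg^π_{μ,ν} = g^π_{μ,ν}` whenever `|μ|+|ν| ≤ |π|+n`. -/
theorem statement14
    (J : JPartition → SymA) (hJ : IsJackFamily J)
    (g : JPartition → JPartition → JPartition → F) (hg : IsStructCoeffs J g)
    (n : ℕ)
    (Hg : JPartition → JPartition → JPartition → F)
    (hH0 : ∀ pi mu nu : JPartition, psize mu + psize nu < psize pi → Hg pi mu nu = 0)
    (hH1 : ∀ mu nu : JPartition,
      Hg (0 : Multiset ℕ+) mu nu = if mu = (0 : Multiset ℕ+) ∧ nu = (0 : Multiset ℕ+) then 1 else 0)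
    (hHeq : ∀ ℓq k : ℕ, 1 ≤ ℓq → ℓq ≤ k → k ≤ n + ℓq → ∀ pi mu nu : JPartition,
      (∑ m ∈ Finset.Icc 1 k, ((-1 : F) ^ m / (m : F)) *
          ((∑ᶠ mu' : JPartition, Bmat m ℓq (toExp mu) (toExp mu') * HatT Hg pi mu' nu (k - m))
            + ∑ᶠ nu' : JPartition, Bmat m ℓq (toExp nu) (toExp nu') * HatT Hg pi mu nu' (k - m)))
        = ∑ m ∈ Finset.Icc 1 k, ((-1 : F) ^ m / (m : F)) *
            ∑ᶠ pi' : JPartition,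
              MvPolynomial.coeff (toExp pi') (Bc m ℓq (pPow pi)) * HatT Hg pi' mu nu (k - m)) :
    ∀ pi mu nu : JPartition, psize mu + psize nu ≤ psize pi + n → Hg pi mu nu = g pi mu nu := by
  have h := Jk.mkJK J hJ
  intro pi mu nu hsz
  simp only [Jk.psize_eq] at hH0 hsz
  refine (Jk.mkSC J hJ g hg).uniq h n Hg hH0 hH1 ?_ pi mu nu hsz
  intro ℓ k h1 h2 h3 ρ μ ν hs
  have e := hHeq ℓ k h1 h2 h3 ρ μ ν
  simp only [Jk.Bmat_bm, Jk.Bc_bm] at e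
  rw [Jk.Eqn]
  refine Eq.trans (Finset.sum_congr rfl fun m hm => ?_) (e.trans (Finset.sum_congr rfl fun m hm => ?_))
  · obtain ⟨hm1, hm2⟩ := Finset.mem_Icc.mp hm
    congr 2
    · refine finsum_congr fun x => ?_
      by_cases hx : Jk.S 0 (Jk.nu μ) = Jk.S 0 (Jk.nu x) + m
      · rw [HatT, if_pos (by simp only [Jk.psize_eq]; omega)]
      · rw [h.bm_zero m ℓ hm1 _ _ hx, zero_mul, zero_mul]
    · refine finsum_congr fun x => ?_
      by_cases hx : Jk.S 0 (Jk.nu ν) = Jk.S 0 (Jk.nu x) + m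
      · rw [HatT, if_pos (by simp only [Jk.psize_eq]; omega)]
      · rw [h.bm_zero m ℓ hm1 _ _ hx, zero_mul, zero_mul]
  · obtain ⟨hm1, hm2⟩ := Finset.mem_Icc.mp hm
    congr 1
    refine finsum_congr fun x => ?_
    by_cases hx : Jk.S 0 (Jk.nu x) = Jk.S 0 (Jk.nu ρ) + m
    · rw [HatT, if_pos (by simp only [Jk.psize_eq]; omega)]
    · rw [h.bm_zero m ℓ hm1 _ _ hx, zero_mul, zero_mul]

end
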